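/- arXiv:2605.30586 — 4 statements merged into one kernel-verified Lean document; each statement's English description precedes it below -/
import Mathlib

section
/- Let d be a positive integer and s ∈ (0,1) with d ≥ 4 − 2s, and let N ≥ 3 be an integer. Then for every real-valued u ∈ C_c^∞(Ω^{(N)}) one has T_s[u] ≥ (2·C_{fH}(d,s)/((N−1)(N−2))) · ∫_{ℝ^{dN}} (Σ_{1≤i<j<k≤N} V_{s,3}(x_i,x_j,x_k)) · u(x)² dx. -/
open MeasureTheory Real

noncomputable section

/-- `ℝ^d` as a Euclidean space. -/
abbrev Euc (d : ℕ) := EuclideanSpace ℝ (Fin d)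

/-- The normalisation constant `a_{s,d}` of the fractional Laplacian. -/
def a_sd (d : ℕ) (s : ℝ) : ℝ :=
  s * (2:ℝ) ^ (2*s - 1) * Real.pi ^ (-(d:ℝ)/2) * Real.Gamma (((d:ℝ) + 2*s)/2) /
    Real.Gamma (1 - s)

/-- The sharp fractional Hardy constant `C_{fH}(d,s)`. -/
def C_fH (d : ℕ) (s : ℝ) : ℝ :=
  (2:ℝ) ^ (2*s) * (Real.Gamma (((d:ℝ) + 2*s)/4))^2 / (Real.Gamma (((d:ℝ) - 2*s)/4))^2

/-- The three-particle Hardy potential `V_{s,3}` (cyclic sum). -/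
def V3 {d : ℕ} (s : ℝ) (x₁ x₂ x₃ : Euc d) : ℝ :=
    ‖x₃ - x₂‖ ^ (2*s) / (‖x₃ - x₁‖ ^ (2*s) * ‖x₂ - x₁‖ ^ (2*s))
  + ‖x₁ - x₃‖ ^ (2*s) / (‖x₁ - x₂‖ ^ (2*s) * ‖x₃ - x₂‖ ^ (2*s))
  + ‖x₂ - x₁‖ ^ (2*s) / (‖x₂ - x₃‖ ^ (2*s) * ‖x₁ - x₃‖ ^ (2*s))

/-- The fractional kinetic energy `T_s[u]` of an `N`-particle wave function. -/
def kinetic (d N : ℕ) (s : ℝ) (u : (Fin N → Euc d) → ℝ) : ℝ :=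
  ∑ i : Fin N, a_sd d s *
    ∫ x : Fin N → Euc d, ∫ z : Euc d,
      (u x - u (Function.update x i z))^2 / ‖x i - z‖ ^ ((d:ℝ) + 2*s)

section HeatKernel

open Set ENNReal

lemma lintegral_Ioi_eq_comp_mul (f : ℝ → ℝ≥0∞) {c : ℝ} (hc : 0 < c) :
    ∫⁻ t in Ioi (0:ℝ), f t = ∫⁻ v in Ioi (0:ℝ), ENNReal.ofReal c * f (c * v) := by
  have h := lintegral_image_eq_lintegral_abs_deriv_mul (s := Ioi (0:ℝ)) (f := fun v => c * v)
    (f' := fun _ => c) measurableSet_Ioi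
    (fun x _ => by simpa using ((hasDerivAt_id x).const_mul c).hasDerivWithinAt)
    (fun x _ y _ hxy => mul_left_cancel₀ hc.ne' hxy) f
  have him : (fun v => c * v) '' Ioi (0:ℝ) = Ioi 0 := by
    ext t
    refine ⟨?_, fun ht => ⟨t / c, div_pos ht hc, by field_simp⟩⟩
    rintro ⟨v, hv, rfl⟩
    exact mul_pos hc hv
  rw [him] at h
  simpa [abs_of_pos hc] using h

lemma lintegral_Ioi_eq_comp_inv (f : ℝ → ℝ≥0∞) :
    ∫⁻ t in Ioi (0:ℝ), f t = ∫⁻ v in Ioi (0:ℝ), ENNReal.ofReal (v ^ 2)⁻¹ * f v⁻¹ := by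
  have h := lintegral_image_eq_lintegral_abs_deriv_mul (s := Ioi (0:ℝ)) (f := fun v => v⁻¹)
    (f' := fun v => -(v ^ 2)⁻¹) measurableSet_Ioi
    (fun x hx => (hasDerivAt_inv (ne_of_gt hx)).hasDerivWithinAt)
    (fun x _ y _ hxy => inv_injective hxy) f
  have him : (fun v => v⁻¹) '' Ioi (0:ℝ) = Ioi 0 := by
    ext t
    refine ⟨?_, fun ht => ⟨t⁻¹, inv_pos.2 (mem_Ioi.1 ht), inv_inv t⟩⟩
    rintro ⟨v, hv, rfl⟩
    exact inv_pos.2 (mem_Ioi.1 hv)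
  rw [him] at h
  simpa [abs_of_nonneg, sq_nonneg] using h

lemma lintegral_rpow_mul_exp_neg_mul {a r : ℝ} (ha : 0 < a) (hr : 0 < r) :
    ∫⁻ t in Ioi (0:ℝ), ENNReal.ofReal (t ^ (a - 1) * exp (-(r * t))) =
      ENNReal.ofReal (r ^ (-a) * Gamma a) := by
  rw [← ofReal_integral_eq_lintegral_ofReal, integral_rpow_mul_exp_neg_mul_Ioi ha hr,
    one_div, inv_rpow hr.le, rpow_neg hr.le]
  · have := integrableOn_rpow_mul_exp_neg_mul_rpow (p := 1) (s := a - 1) (b := r)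
      (by linarith) one_pos hr
    simpa [IntegrableOn] using this
  · filter_upwards [ae_restrict_mem measurableSet_Ioi] with t ht
    have : 0 < t := ht
    simp only [Pi.zero_apply]
    positivity

/-- The heat kernel on `ℝ^d`, at time `t / 4`. -/
def heatK {d : ℕ} (t : ℝ) (z : Euc d) : ℝ := (π * t) ^ (-(d:ℝ)/2) * exp (-‖z‖ ^ 2 / t)

variable {d : ℕ}

lemma heatK_nonneg {t : ℝ} (ht : 0 ≤ t) (z : Euc d) : 0 ≤ heatK t z := by
  unfold heatK; positivity

lemma measurable_heatK : Measurable (fun p : ℝ × Euc d => heatK p.1 p.2) := by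
  unfold heatK; fun_prop

lemma heatK_neg (t : ℝ) (z : Euc d) : heatK t (-z) = heatK t z := by simp [heatK]

/-- The constant relating powers of the norm with Mellin transforms of the heat kernel. -/
def mellinConst (d : ℕ) (q : ℝ) : ℝ := π ^ (-(d:ℝ)/2) * Gamma ((d:ℝ)/2 - q)

lemma mellinConst_pos {q : ℝ} (hq : q < (d:ℝ)/2) : 0 < mellinConst d q := by
  have := Gamma_pos_of_pos (sub_pos.2 hq)
  unfold mellinConst
  positivity

lemma lintegral_rpow_mul_heatK {q : ℝ} (hq : q < (d:ℝ)/2) {z : Euc d} (hz : z ≠ 0) :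
    ∫⁻ t in Ioi (0:ℝ), ENNReal.ofReal (t ^ (q - 1) * heatK t z) =
      ENNReal.ofReal (mellinConst d q * ‖z‖ ^ (2*q - d)) := by
  have hz' : 0 < ‖z‖ := norm_pos_iff.2 hz
  rw [lintegral_Ioi_eq_comp_inv]
  have h : ∀ v ∈ Ioi (0:ℝ), ENNReal.ofReal (v ^ 2)⁻¹ * ENNReal.ofReal (v⁻¹ ^ (q - 1) * heatK v⁻¹ z) =
      ENNReal.ofReal (π ^ (-(d:ℝ)/2)) *
        ENNReal.ofReal (v ^ ((d:ℝ)/2 - q - 1) * exp (-(‖z‖ ^ 2 * v))) := by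
    intro v hv
    have hv : 0 < v := hv
    rw [← ENNReal.ofReal_mul (by positivity), ← ENNReal.ofReal_mul (by positivity)]
    congr 1
    unfold heatK
    rw [mul_rpow pi_pos.le (by positivity), inv_rpow hv.le, inv_rpow hv.le, ← rpow_neg hv.le,
      ← rpow_neg hv.le, ← rpow_natCast v 2, ← rpow_neg hv.le, div_inv_eq_mul, neg_mul]
    have : v ^ ((d:ℝ)/2 - q - 1) = v ^ (-((2:ℕ):ℝ)) * v ^ (-(q-1)) * v ^ (-(-(d:ℝ)/2)) := by
      rw [← rpow_add hv, ← rpow_add hv]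
      congr 1
      push_cast
      ring
    rw [this]
    ring
  rw [setLIntegral_congr_fun measurableSet_Ioi h, lintegral_const_mul' _ _ ENNReal.ofReal_ne_top,
    lintegral_rpow_mul_exp_neg_mul (sub_pos.2 hq) (by positivity),
    ← ENNReal.ofReal_mul (by positivity)]
  congr 1
  unfold mellinConst
  rw [← rpow_natCast ‖z‖ 2, ← rpow_mul hz'.le]
  have : (2*q - (d:ℝ)) = ((2:ℕ):ℝ) * -((d:ℝ)/2 - q) := by push_cast; ring
  rw [this]
  ring

lemma lintegral_heatK_mul_heatK {t u : ℝ} (ht : 0 < t) (hu : 0 < u) (x : Euc d) :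
    ∫⁻ y, ENNReal.ofReal (heatK t (x - y) * heatK u y) = ENNReal.ofReal (heatK (t + u) x) := by
  have key : ∀ y : Euc d, heatK t (x - y) * heatK u y =
      ((π * t) ^ (-(d:ℝ)/2) * (π * u) ^ (-(d:ℝ)/2) * exp (-‖x‖ ^ 2 / (t + u))) *
        exp (-((t + u) / (t * u)) * ‖y + -((u / (t + u)) • x)‖ ^ 2) := by
    intro y
    unfold heatK
    rw [mul_mul_mul_comm, ← exp_add, mul_assoc _ (exp _) (exp _), ← exp_add]
    congr 2
    rw [← sub_eq_add_neg, norm_sub_sq_real, norm_sub_sq_real, norm_smul, inner_smul_right,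
      real_inner_comm, mul_pow, norm_eq_abs, sq_abs]
    field_simp
    ring
  simp_rw [key]
  have hb : 0 < (t + u) / (t * u) := by positivity
  have hint : Integrable (fun y : Euc d => exp (-((t + u) / (t * u)) * ‖y‖ ^ 2)) := by
    have := (GaussianFourier.integrable_cexp_neg_mul_sq_norm_add (V := Euc d)
      (b := (((t + u) / (t * u) : ℝ) : ℂ)) (by rwa [Complex.ofReal_re]) 0 0).re
    refine this.congr (ae_of_all _ fun y => ?_)
    simp only [inner_zero_left, Complex.ofReal_zero, mul_zero, add_zero]
    rw [← Complex.ofReal_re (exp _)]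
    push_cast
    rfl
  simp_rw [ENNReal.ofReal_mul (show 0 ≤ (π * t) ^ (-(d:ℝ)/2) * (π * u) ^ (-(d:ℝ)/2) *
    exp (-‖x‖ ^ 2 / (t + u)) by positivity)]
  rw [lintegral_const_mul' _ _ ENNReal.ofReal_ne_top,
    lintegral_add_right_eq_self (fun y : Euc d =>
      ENNReal.ofReal (exp (-((t + u) / (t * u)) * ‖y‖ ^ 2))),
    ← ofReal_integral_eq_lintegral_ofReal hint (ae_of_all _ fun y => (exp_pos _).le),
    GaussianFourier.integral_rexp_neg_mul_sq_norm hb, ← ENNReal.ofReal_mul (by positivity)]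
  congr 1
  rw [finrank_euclideanSpace_fin]
  unfold heatK
  have h1 : (π / ((t + u) / (t * u))) ^ ((d:ℝ)/2) =
      (π * t) ^ ((d:ℝ)/2) * (π * u) ^ ((d:ℝ)/2) * (π * (t + u)) ^ (-(d:ℝ)/2) := by
    rw [neg_div, rpow_neg (by positivity), ← inv_rpow (by positivity),
      ← mul_rpow (by positivity) (by positivity), ← mul_rpow (by positivity) (by positivity)]
    congr 1
    field_simp
  rw [h1, neg_div, rpow_neg (by positivity : 0 ≤ π * t), rpow_neg (by positivity : 0 ≤ π * u)]
  have h2 : (π * t) ^ ((d:ℝ)/2) ≠ 0 := by positivity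
  have h3 : (π * u) ^ ((d:ℝ)/2) ≠ 0 := by positivity
  field_simp

lemma exists_lintegral_rpow_mul_rpow_comp_add {α β : ℝ} :
    ∃ B : ℝ≥0∞, ∀ F : ℝ → ℝ≥0∞, Measurable F →
      ∫⁻ u in Ioi (0:ℝ), ∫⁻ t in Ioi (0:ℝ),
        ENNReal.ofReal (t ^ (α - 1) * u ^ (β - 1)) * F (t + u) =
      B * ∫⁻ r in Ioi (0:ℝ), ENNReal.ofReal (r ^ (α + β - 1)) * F r := by
  refine ⟨∫⁻ v in Ioi (0:ℝ), ENNReal.ofReal (v ^ (α - 1) * (v + 1) ^ (-(α + β))), fun F hF => ?_⟩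
  have h1 : ∀ u ∈ Ioi (0:ℝ), ∫⁻ t in Ioi (0:ℝ),
        ENNReal.ofReal (t ^ (α - 1) * u ^ (β - 1)) * F (t + u) =
      ∫⁻ v in Ioi (0:ℝ), ENNReal.ofReal (v ^ (α - 1) * u ^ (α + β - 1)) * F ((v + 1) * u) := by
    intro u hu
    have hu : 0 < u := hu
    rw [lintegral_Ioi_eq_comp_mul _ hu]
    refine setLIntegral_congr_fun measurableSet_Ioi fun v hv => ?_
    have hv : 0 < v := hv
    rw [← mul_assoc, ← ENNReal.ofReal_mul hu.le, mul_rpow hu.le hv.le]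
    congr 2
    · have : u ^ (α + β - 1) = u ^ (1:ℝ) * u ^ (α - 1) * u ^ (β - 1) := by
        rw [← rpow_add hu, ← rpow_add hu]; congr 1; ring
      rw [this, Real.rpow_one]
      ring
    · ring
  rw [setLIntegral_congr_fun measurableSet_Ioi h1, lintegral_lintegral_swap (by fun_prop),
    ← lintegral_mul_const _ (by fun_prop)]
  refine setLIntegral_congr_fun measurableSet_Ioi fun v hv => ?_
  have hv : 0 < v := hv
  have hv1 : 0 < v + 1 := by linarith
  rw [lintegral_Ioi_eq_comp_mul (fun r => ENNReal.ofReal (r ^ (α + β - 1)) * F r) hv1,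
    ← lintegral_const_mul _ (by fun_prop)]
  refine setLIntegral_congr_fun measurableSet_Ioi fun u hu => ?_
  have hu : 0 < u := hu
  rw [← mul_assoc, ← mul_assoc, ← ENNReal.ofReal_mul (by positivity),
    ← ENNReal.ofReal_mul (by positivity), mul_rpow hv1.le hu.le]
  congr 2
  have : (v + 1) ^ (-(α + β)) * (v + 1) * (v + 1) ^ (α + β - 1) = 1 := by
    nth_rewrite 2 [← Real.rpow_one (v + 1)]
    rw [← rpow_add hv1, ← rpow_add hv1]
    convert Real.rpow_zero (v + 1) using 2
    ring
  linear_combination (- v ^ (α - 1) * u ^ (α + β - 1)) * this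

lemma lintegral_rpow_mul_rpow_comp_add {α β : ℝ} (hα : 0 < α) (hβ : 0 < β)
    {F : ℝ → ℝ≥0∞} (hF : Measurable F) :
    ∫⁻ u in Ioi (0:ℝ), ∫⁻ t in Ioi (0:ℝ),
        ENNReal.ofReal (t ^ (α - 1) * u ^ (β - 1)) * F (t + u) =
      ENNReal.ofReal (Gamma α * Gamma β / Gamma (α + β)) *
        ∫⁻ r in Ioi (0:ℝ), ENNReal.ofReal (r ^ (α + β - 1)) * F r := by
  obtain ⟨B, hB⟩ := exists_lintegral_rpow_mul_rpow_comp_add (α := α) (β := β)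
  have hΓ : ∀ a : ℝ, 0 < a → ∫⁻ t in Ioi (0:ℝ),
      ENNReal.ofReal (t ^ (a - 1) * exp (-t)) = ENNReal.ofReal (Gamma a) := fun a ha => by
    simpa using lintegral_rpow_mul_exp_neg_mul ha one_pos
  have h := hB (fun r => ENNReal.ofReal (exp (-r))) (by fun_prop)
  have h1 : ∀ u ∈ Ioi (0:ℝ), ∫⁻ t in Ioi (0:ℝ),
        ENNReal.ofReal (t ^ (α - 1) * u ^ (β - 1)) * ENNReal.ofReal (exp (-(t + u))) =
      ENNReal.ofReal (u ^ (β - 1) * exp (-u)) * ENNReal.ofReal (Gamma α) := by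
    intro u hu
    have hu : 0 < u := hu
    rw [← hΓ α hα, ← lintegral_const_mul _ (by fun_prop)]
    refine setLIntegral_congr_fun measurableSet_Ioi fun t ht => ?_
    have ht : 0 < t := ht
    rw [← ENNReal.ofReal_mul (by positivity), ← ENNReal.ofReal_mul (by positivity), neg_add,
      exp_add]
    congr 1
    ring
  have h2 : ∀ r ∈ Ioi (0:ℝ), ENNReal.ofReal (r ^ (α + β - 1)) * ENNReal.ofReal (exp (-r)) =
      ENNReal.ofReal (r ^ (α + β - 1) * exp (-r)) := fun r hr => by
    have hr : 0 < r := hr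
    rw [ENNReal.ofReal_mul (by positivity)]
  rw [setLIntegral_congr_fun measurableSet_Ioi h1, setLIntegral_congr_fun measurableSet_Ioi h2,
    hΓ _ (add_pos hα hβ), lintegral_mul_const _ (by fun_prop), hΓ β hβ] at h
  have hΓα := Gamma_pos_of_pos hα
  have hΓβ := Gamma_pos_of_pos hβ
  have hΓαβ := Gamma_pos_of_pos (add_pos hα hβ)
  have hBeq : B = ENNReal.ofReal (Gamma α * Gamma β / Gamma (α + β)) := by
    rw [ENNReal.ofReal_div_of_pos hΓαβ, ENNReal.ofReal_mul hΓα.le, mul_comm, h,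
      ENNReal.mul_div_cancel_right (by simpa using hΓαβ) ENNReal.ofReal_ne_top]
  rw [hB F hF, hBeq]

/-- Composition of Riesz kernels. -/
lemma lintegral_riesz_mul_riesz {α β : ℝ} (hα : 0 < α) (hβ : 0 < β) (hαβ : α + β < (d:ℝ)/2)
    {x : Euc d} (hx : x ≠ 0) :
    ∫⁻ y, ENNReal.ofReal (‖x - y‖ ^ (2*α - d) * ‖y‖ ^ (2*β - d)) =
      ENNReal.ofReal (Gamma α * Gamma β / Gamma (α + β) * mellinConst d (α + β) /
        (mellinConst d α * mellinConst d β) * ‖x‖ ^ (2*(α + β) - d)) := by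
  have hd : 0 < d := by
    rcases Nat.eq_zero_or_pos d with rfl | h
    · simp at hαβ; linarith
    · exact h
  have : Nonempty (Fin d) := ⟨⟨0, hd⟩⟩
  have cα := mellinConst_pos (d := d) (q := α) (by linarith)
  have cβ := mellinConst_pos (d := d) (q := β) (by linarith)
  have cαβ := mellinConst_pos hαβ
  have hm := measurable_heatK (d := d)
  have key : ENNReal.ofReal (mellinConst d α * mellinConst d β) *
      ∫⁻ y, ENNReal.ofReal (‖x - y‖ ^ (2*α - d) * ‖y‖ ^ (2*β - d)) =
      ENNReal.ofReal (Gamma α * Gamma β / Gamma (α + β)) *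
      ENNReal.ofReal (mellinConst d (α + β) * ‖x‖ ^ (2*(α + β) - d)) := by
    rw [← lintegral_const_mul' _ _ ENNReal.ofReal_ne_top]
    calc _ = ∫⁻ y, ∫⁻ u in Ioi (0:ℝ), ∫⁻ t in Ioi (0:ℝ),
            ENNReal.ofReal (t ^ (α - 1) * heatK t (x - y)) *
              ENNReal.ofReal (u ^ (β - 1) * heatK u y) := by
          refine lintegral_congr_ae ?_
          filter_upwards [Measure.ae_ne volume x, Measure.ae_ne volume (0 : Euc d)] with y hyx hy0
          simp_rw [lintegral_mul_const _ (show Measurable fun t : ℝ =>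
              ENNReal.ofReal (t ^ (α - 1) * heatK t (x - y)) by unfold heatK; fun_prop),
            lintegral_const_mul _ (show Measurable fun t : ℝ =>
              ENNReal.ofReal (t ^ (β - 1) * heatK t y) by unfold heatK; fun_prop),
            lintegral_rpow_mul_heatK (q := β) (by linarith) hy0,
            lintegral_rpow_mul_heatK (q := α) (by linarith) (sub_ne_zero.2 hyx.symm)]
          rw [← ENNReal.ofReal_mul (by positivity), ← ENNReal.ofReal_mul (by positivity)]
          congr 1
          ring
      _ = ∫⁻ u in Ioi (0:ℝ), ∫⁻ t in Ioi (0:ℝ), ∫⁻ y,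
            ENNReal.ofReal (t ^ (α - 1) * heatK t (x - y)) *
              ENNReal.ofReal (u ^ (β - 1) * heatK u y) := by
          rw [lintegral_lintegral_swap]
          · refine lintegral_congr fun u => ?_
            rw [lintegral_lintegral_swap]
            unfold heatK
            fun_prop
          · refine (Measurable.lintegral_prod_right' (f := fun p : (Euc d × ℝ) × ℝ =>
              ENNReal.ofReal (p.2 ^ (α - 1) * heatK p.2 (x - p.1.1)) *
              ENNReal.ofReal (p.1.2 ^ (β - 1) * heatK p.1.2 p.1.1)) ?_).aemeasurable
            unfold heatK
            fun_prop
      _ = ∫⁻ u in Ioi (0:ℝ), ∫⁻ t in Ioi (0:ℝ),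
            ENNReal.ofReal (t ^ (α - 1) * u ^ (β - 1)) * ENNReal.ofReal (heatK (t + u) x) := by
          refine setLIntegral_congr_fun measurableSet_Ioi fun u hu => ?_
          refine setLIntegral_congr_fun measurableSet_Ioi fun t ht => ?_
          have hu : 0 < u := hu
          have ht : 0 < t := ht
          rw [← lintegral_heatK_mul_heatK ht hu, ← lintegral_const_mul' _ _ ENNReal.ofReal_ne_top]
          refine lintegral_congr fun y => ?_
          have := heatK_nonneg ht.le (x - y)
          have := heatK_nonneg hu.le y
          rw [← ENNReal.ofReal_mul (by positivity), ← ENNReal.ofReal_mul (by positivity)]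
          congr 1
          ring
      _ = _ := by
          rw [lintegral_rpow_mul_rpow_comp_add hα hβ (F := fun r => ENNReal.ofReal (heatK r x))
            (by unfold heatK; fun_prop), ← lintegral_rpow_mul_heatK hαβ hx]
          congr 1
          refine setLIntegral_congr_fun measurableSet_Ioi fun r hr => ?_
          have hr : 0 < r := hr
          rw [ENNReal.ofReal_mul (by positivity)]
  have hΓα := Gamma_pos_of_pos hα
  have hΓβ := Gamma_pos_of_pos hβ
  have hΓαβ := Gamma_pos_of_pos (add_pos hα hβ)
  rw [← ENNReal.ofReal_mul (by positivity)] at key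
  rw [(ENNReal.eq_div_iff (by simpa using mul_pos cα cβ) ENNReal.ofReal_ne_top).2 key,
    ← ENNReal.ofReal_div_of_pos (by positivity)]
  congr 1
  ring

end HeatKernel

section StarTriangle

open Set ENNReal EuclideanGeometry

variable {d : ℕ}

lemma lintegral_eq_comp_inversion (hd : 0 < d) (f : Euc d → ℝ≥0∞) :
    ∫⁻ y, f y = ∫⁻ z, ENNReal.ofReal (‖z‖ ^ (-2 * (d:ℝ))) * f (inversion 0 1 z) := by
  have : Nonempty (Fin d) := ⟨⟨0, hd⟩⟩
  have h := lintegral_image_eq_lintegral_abs_det_fderiv_mul (volume : Measure (Euc d))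
    (s := {0}ᶜ) (f := inversion 0 1)
    (f' := fun x => ((1 / dist x 0) ^ 2 • ((ℝ ∙ (x - 0))ᗮ.reflection : Euc d →L[ℝ] Euc d)))
    (measurableSet_singleton 0).compl
    (fun x hx => (hasFDerivAt_inversion hx).hasFDerivWithinAt)
    (inversion_injective 0 one_ne_zero).injOn f
  have him : inversion 0 1 '' ({0}ᶜ : Set (Euc d)) = {0}ᶜ := by
    rw [image_compl_eq (inversion_bijective 0 one_ne_zero)]
    simp
  rw [him, restrict_compl_singleton] at h
  rw [h]
  refine lintegral_congr_ae ?_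
  filter_upwards [Measure.ae_ne volume (0 : Euc d)] with z hz
  have hz' : 0 < ‖z‖ := norm_pos_iff.2 hz
  congr 2
  have hdet : |((ℝ ∙ (z - 0))ᗮ.reflection : Euc d →L[ℝ] Euc d).det| = 1 := by
    have := (ℝ ∙ (z - 0))ᗮ.det_reflection (𝕜 := ℝ)
    rw [ContinuousLinearMap.det]
    refine Eq.trans (congrArg abs this) ?_
    simp
  have hsm : ((1 / dist z 0) ^ 2 • ((ℝ ∙ (z - 0))ᗮ.reflection : Euc d →L[ℝ] Euc d)).det =
      ((1 / dist z 0) ^ 2) ^ d * ((ℝ ∙ (z - 0))ᗮ.reflection : Euc d →L[ℝ] Euc d).det := by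
    rw [ContinuousLinearMap.det, ContinuousLinearMap.toLinearMap_smul, LinearMap.det_smul,
      finrank_euclideanSpace_fin]
  rw [hsm, abs_mul, hdet, mul_one, abs_of_nonneg (by positivity), dist_zero_right, one_div,
    neg_mul, rpow_neg hz'.le, rpow_mul hz'.le, ← inv_rpow (by positivity), Real.rpow_natCast, inv_pow,
    show (2:ℝ) = ((2:ℕ):ℝ) by norm_num, Real.rpow_natCast]

lemma norm_inversion_zero_one (z : Euc d) : ‖inversion 0 1 z‖ = ‖z‖⁻¹ := by
  have := dist_inversion_center (0 : Euc d) z 1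
  simpa [dist_zero_right, one_div] using this

lemma norm_inversion_sub_inversion {x y : Euc d} (hx : x ≠ 0) (hy : y ≠ 0) :
    ‖inversion 0 1 x - inversion 0 1 y‖ = ‖x - y‖ / (‖x‖ * ‖y‖) := by
  have := dist_inversion_inversion (c := (0 : Euc d)) hx hy 1
  rw [dist_zero_right, dist_zero_right, dist_eq_norm, dist_eq_norm] at this
  rw [this]
  ring

/-- The constant in the conformally invariant star-triangle relation. -/
def starConst (d : ℕ) (s : ℝ) : ℝ :=
  Gamma s * Gamma (((d:ℝ) - 2*s)/4) / Gamma (s + ((d:ℝ) - 2*s)/4) *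
    mellinConst d (s + ((d:ℝ) - 2*s)/4) /
      (mellinConst d s * mellinConst d (((d:ℝ) - 2*s)/4))

lemma lintegral_star_zero {s : ℝ} (hs : 0 < s) (hds : 2*s < d) {x a : Euc d}
    (hx : x ≠ 0) (ha : a ≠ 0) (hxa : x ≠ a) :
    ∫⁻ y, ENNReal.ofReal (‖x - y‖ ^ (2*s - d) *
        (‖y - a‖ ^ (-((d:ℝ) + 2*s)/2) * ‖y‖ ^ (-((d:ℝ) + 2*s)/2))) =
      ENNReal.ofReal (starConst d s * (‖a‖ ^ (-(2*s)) *
        (‖x - a‖ ^ (-((d:ℝ) - 2*s)/2) * ‖x‖ ^ (-((d:ℝ) - 2*s)/2)))) := by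
  have hd : 0 < d := by
    have : (0:ℝ) < d := by linarith
    exact_mod_cast this
  have : Nonempty (Fin d) := ⟨⟨0, hd⟩⟩
  have inv0 : ∀ {z : Euc d}, z ≠ 0 → inversion 0 1 z ≠ 0 := fun {z} hz h => by
    have := norm_inversion_zero_one z
    rw [h, norm_zero] at this
    exact hz (norm_eq_zero.1 (inv_eq_zero.1 this.symm))
  obtain ⟨X, rfl⟩ : ∃ X, x = inversion 0 1 X := ⟨_, (inversion_inversion 0 one_ne_zero x).symm⟩
  obtain ⟨A, rfl⟩ : ∃ A, a = inversion 0 1 A := ⟨_, (inversion_inversion 0 one_ne_zero a).symm⟩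
  have hX : X ≠ 0 := by rintro rfl; simp at hx
  have hA : A ≠ 0 := by rintro rfl; simp at ha
  have hXA : X ≠ A := by rintro rfl; exact hxa rfl
  have hX' : 0 < ‖X‖ := norm_pos_iff.2 hX
  have hA' : 0 < ‖A‖ := norm_pos_iff.2 hA
  have hXA' : 0 < ‖X - A‖ := norm_pos_iff.2 (sub_ne_zero.2 hXA)
  rw [lintegral_eq_comp_inversion hd]
  have h1 : ∀ᵐ z : Euc d, ENNReal.ofReal (‖z‖ ^ (-2 * (d:ℝ))) *
      ENNReal.ofReal (‖inversion 0 1 X - inversion 0 1 z‖ ^ (2*s - d) *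
        (‖inversion 0 1 z - inversion 0 1 A‖ ^ (-((d:ℝ) + 2*s)/2) *
          ‖inversion 0 1 z‖ ^ (-((d:ℝ) + 2*s)/2))) =
      ENNReal.ofReal (‖X‖ ^ ((d:ℝ) - 2*s) * ‖A‖ ^ (((d:ℝ) + 2*s)/2)) *
        ENNReal.ofReal (‖X - z‖ ^ (2*s - d) * ‖z - A‖ ^ (2*(((d:ℝ) - 2*s)/4) - d)) := by
    filter_upwards [Measure.ae_ne volume (0 : Euc d)] with z hz
    have hz' : 0 < ‖z‖ := norm_pos_iff.2 hz
    rw [← ENNReal.ofReal_mul (by positivity), ← ENNReal.ofReal_mul (by positivity),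
      norm_inversion_sub_inversion hX hz, norm_inversion_sub_inversion hz hA,
      norm_inversion_zero_one, div_rpow (by positivity) (by positivity),
      div_rpow (by positivity) (by positivity), mul_rpow hX'.le hz'.le, mul_rpow hz'.le hA'.le,
      inv_rpow hz'.le]
    congr 1
    have e1 : 2*(((d:ℝ) - 2*s)/4) - d = -((d:ℝ) + 2*s)/2 := by ring
    have e2 : (d:ℝ) - 2*s = -(2*s - d) := by ring
    have e3 : ((d:ℝ) + 2*s)/2 = - (-((d:ℝ) + 2*s)/2) := by ring
    have e4 : ‖z‖ ^ (-2 * (d:ℝ)) = ‖z‖ ^ (2*s - d) * ‖z‖ ^ (-((d:ℝ) + 2*s)/2) *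
        ‖z‖ ^ (-((d:ℝ) + 2*s)/2) := by
      rw [← rpow_add hz', ← rpow_add hz']; congr 1; ring
    rw [e1, e2, e3, e4, rpow_neg hX'.le (2*s - d), rpow_neg hA'.le (-((d:ℝ) + 2*s)/2)]
    have p1 := (rpow_pos_of_pos hz' (2*s - d)).ne'
    have p2 := (rpow_pos_of_pos hz' (-((d:ℝ) + 2*s)/2)).ne'
    have p3 := (rpow_pos_of_pos hX' (2*s - d)).ne'
    have p4 := (rpow_pos_of_pos hA' (-((d:ℝ) + 2*s)/2)).ne'
    field_simp
  rw [lintegral_congr_ae h1, lintegral_const_mul' _ _ ENNReal.ofReal_ne_top,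
    ← lintegral_add_right_eq_self _ A]
  simp_rw [add_sub_cancel_right, ← sub_sub]
  have h2 := lintegral_riesz_mul_riesz hs (β := ((d:ℝ) - 2*s)/4) (by linarith) (by linarith)
    (sub_ne_zero.2 hXA)
  simp_rw [sub_right_comm X A] at h2
  rw [h2, ← ENNReal.ofReal_mul (by positivity), norm_inversion_sub_inversion hX hA,
    norm_inversion_zero_one, norm_inversion_zero_one, div_rpow (by positivity) (by positivity),
    mul_rpow hX'.le hA'.le, inv_rpow hA'.le, inv_rpow hX'.le]
  congr 1
  unfold starConst
  have e1 : 2*(s + ((d:ℝ) - 2*s)/4) - d = -((d:ℝ) - 2*s)/2 := by ring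
  have e2 : ‖X‖ ^ ((d:ℝ) - 2*s) * (‖X‖ ^ (-((d:ℝ) - 2*s)/2) * ‖X‖ ^ (-((d:ℝ) - 2*s)/2)) = 1 := by
    rw [← rpow_add hX', ← rpow_add hX', ← rpow_zero ‖X‖]; congr 1; ring
  have e3 : ‖A‖ ^ (((d:ℝ) + 2*s)/2) * (‖A‖ ^ (-(2*s)) * ‖A‖ ^ (-((d:ℝ) - 2*s)/2)) = 1 := by
    rw [← rpow_add hA', ← rpow_add hA', ← rpow_zero ‖A‖]; congr 1; ring
  rw [e1, eq_div_of_mul_eq (by positivity) e2, eq_div_of_mul_eq (by positivity) e3]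
  field_simp

/-- The star-triangle relation for the ground state of the two-pole Hardy potential. -/
lemma lintegral_star {s : ℝ} (hs : 0 < s) (hds : 2*s < d) {x a b : Euc d}
    (hxb : x ≠ b) (hab : a ≠ b) (hxa : x ≠ a) :
    ∫⁻ y, ENNReal.ofReal (‖x - y‖ ^ (2*s - d) *
        (‖y - a‖ ^ (-((d:ℝ) + 2*s)/2) * ‖y - b‖ ^ (-((d:ℝ) + 2*s)/2))) =
      ENNReal.ofReal (starConst d s * (‖a - b‖ ^ (-(2*s)) *
        (‖x - a‖ ^ (-((d:ℝ) - 2*s)/2) * ‖x - b‖ ^ (-((d:ℝ) - 2*s)/2)))) := by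
  have h := lintegral_star_zero hs hds (sub_ne_zero.2 hxb) (sub_ne_zero.2 hab)
    (fun h => hxa (sub_left_injective h))
  rw [sub_sub_sub_cancel_right] at h
  rw [← lintegral_add_right_eq_self _ b, ← h]
  refine lintegral_congr fun y => ?_
  rw [add_sub_cancel_right, sub_add_eq_sub_sub_swap, ← sub_sub_eq_add_sub, sub_sub_eq_add_sub]

end StarTriangle

section Fourier

open Set ENNReal
open scoped FourierTransform

variable {d : ℕ}

/-- The Fourier transform of a real-valued function. -/
def realFourier (f : Euc d → ℝ) : Euc d → ℂ := 𝓕 (fun x => (f x : ℂ))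

lemma heatK_eq_integral {t : ℝ} (ht : 0 < t) (z : Euc d) :
    (heatK t z : ℂ) = ∫ ξ : Euc d, Complex.exp ((-2 * π * inner ℝ ξ z : ℝ) * Complex.I) *
      (exp (-(π ^ 2 * t * ‖ξ‖ ^ 2)) : ℝ) := by
  have hb : 0 < π ^ 2 * t := by positivity
  have h := fourier_gaussian_innerProductSpace (V := Euc d) (b := ((π ^ 2 * t : ℝ) : ℂ))
    (by rwa [Complex.ofReal_re]) z
  rw [Real.fourier_eq'] at h
  simp only [smul_eq_mul] at h
  have e : ∀ ξ : Euc d, ((exp (-(π ^ 2 * t * ‖ξ‖ ^ 2)) : ℝ) : ℂ) =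
      Complex.exp (-((π ^ 2 * t : ℝ) : ℂ) * (‖ξ‖ : ℂ) ^ 2) := fun ξ => by push_cast; ring_nf
  simp_rw [e]
  rw [h, finrank_euclideanSpace_fin]
  unfold heatK
  have e1 : (π * t) ^ (-(d:ℝ)/2) = (π / (π ^ 2 * t)) ^ ((d:ℝ)/2) := by
    rw [neg_div, rpow_neg (by positivity), ← inv_rpow (by positivity)]
    congr 1
    field_simp
  rw [e1, Complex.ofReal_mul, Complex.ofReal_cpow (by positivity)]
  push_cast
  congr 2
  have : (π : ℂ) ≠ 0 := by exact_mod_cast pi_ne_zero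
  field_simp

lemma integrable_exp_neg_mul_sq_norm {b : ℝ} (hb : 0 < b) :
    Integrable (fun y : Euc d => exp (-(b * ‖y‖ ^ 2))) := by
  have := (GaussianFourier.integrable_cexp_neg_mul_sq_norm_add (V := Euc d)
    (b := (b : ℂ)) (by rwa [Complex.ofReal_re]) 0 0).re
  refine this.congr (ae_of_all _ fun y => ?_)
  simp only [inner_zero_left, Complex.ofReal_zero, mul_zero, add_zero]
  rw [← Complex.ofReal_re (exp _)]
  push_cast
  rw [neg_mul]
  rfl

lemma integrable_heatK {t : ℝ} (ht : 0 < t) : Integrable (heatK t : Euc d → ℝ) := by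
  unfold heatK
  refine ((integrable_exp_neg_mul_sq_norm (d := d) (inv_pos.2 ht)).const_mul
    ((π * t) ^ (-(d:ℝ)/2))).congr (ae_of_all _ fun y => ?_)
  ring_nf

lemma integral_heatK {t : ℝ} (ht : 0 < t) : ∫ z : Euc d, heatK t z = 1 := by
  have h := GaussianFourier.integral_rexp_neg_mul_sq_norm (V := Euc d) (inv_pos.2 ht)
  unfold heatK
  rw [integral_const_mul]
  have e : ∀ z : Euc d, exp (-‖z‖ ^ 2 / t) = exp (-t⁻¹ * ‖z‖ ^ 2) := fun z => by ring_nf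
  simp_rw [e]
  rw [h, finrank_euclideanSpace_fin, div_inv_eq_mul, ← rpow_add (by positivity)]
  convert Real.rpow_zero _ using 2
  ring

lemma conj_realFourier (f : Euc d → ℝ) (ξ : Euc d) :
    (starRingEnd ℂ) (realFourier f ξ) =
      ∫ y, Complex.exp ((2 * π * inner ℝ y ξ : ℝ) * Complex.I) * (f y : ℂ) := by
  unfold realFourier
  rw [Real.fourier_eq', ← integral_conj]
  refine integral_congr_ae (ae_of_all _ fun y => ?_)
  simp only [smul_eq_mul, map_mul, Complex.conj_ofReal, ← Complex.exp_conj, Complex.conj_I]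
  congr 2
  push_cast
  ring

lemma integral_heatK_form {f : Euc d → ℝ} (hf : Integrable f) {t : ℝ} (ht : 0 < t) :
    ∫ p : Euc d × Euc d, heatK t (p.1 - p.2) * (f p.1 * f p.2) =
      ∫ ξ, exp (-(π ^ 2 * t * ‖ξ‖ ^ 2)) * ‖realFourier f ξ‖ ^ 2 := by
  have hint : Integrable (Function.uncurry fun (p : Euc d × Euc d) (ξ : Euc d) =>
      Complex.exp ((-2 * π * inner ℝ ξ (p.1 - p.2) : ℝ) * Complex.I) *
        ((exp (-(π ^ 2 * t * ‖ξ‖ ^ 2)) : ℝ) : ℂ) * ((f p.1 : ℂ) * (f p.2 : ℂ))) := by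
    have h1 := ((hf.ofReal (𝕜 := ℂ)).mul_prod (hf.ofReal (𝕜 := ℂ))).mul_prod
      ((integrable_exp_neg_mul_sq_norm (d := d) (b := π ^ 2 * t) (by positivity)).ofReal (𝕜 := ℂ))
    have h2 := h1.bdd_mul (c := 1) (f := fun q : (Euc d × Euc d) × Euc d =>
      Complex.exp ((-2 * π * inner ℝ q.2 (q.1.1 - q.1.2) : ℝ) * Complex.I)) (by fun_prop)
      (ae_of_all _ fun y => by rw [Complex.norm_exp_ofReal_mul_I])
    refine h2.congr (ae_of_all _ fun q => ?_)
    simp only [Function.uncurry, Complex.coe_algebraMap]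
    ring
  have h := integral_integral_swap hint
  apply Complex.ofReal_injective
  rw [← integral_complex_ofReal, ← integral_complex_ofReal]
  calc _ = ∫ p : Euc d × Euc d, ∫ ξ,
        Complex.exp ((-2 * π * inner ℝ ξ (p.1 - p.2) : ℝ) * Complex.I) *
        ((exp (-(π ^ 2 * t * ‖ξ‖ ^ 2)) : ℝ) : ℂ) * ((f p.1 : ℂ) * (f p.2 : ℂ)) := by
        refine integral_congr_ae (ae_of_all _ fun p => ?_)
        simp only
        rw [integral_mul_const, ← heatK_eq_integral ht]
        push_cast
        ring
    _ = _ := h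
    _ = _ := by
        refine integral_congr_ae (ae_of_all _ fun ξ => ?_)
        simp only
        have e : ∀ p : Euc d × Euc d,
            Complex.exp ((-2 * π * inner ℝ ξ (p.1 - p.2) : ℝ) * Complex.I) *
              ((exp (-(π ^ 2 * t * ‖ξ‖ ^ 2)) : ℝ) : ℂ) * ((f p.1 : ℂ) * (f p.2 : ℂ)) =
            ((exp (-(π ^ 2 * t * ‖ξ‖ ^ 2)) : ℝ) : ℂ) *
              ((Complex.exp ((-2 * π * inner ℝ p.1 ξ : ℝ) * Complex.I) * (f p.1 : ℂ)) *
              (Complex.exp ((2 * π * inner ℝ p.2 ξ : ℝ) * Complex.I) * (f p.2 : ℂ))) := by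
          intro p
          have : Complex.exp ((-2 * π * inner ℝ ξ (p.1 - p.2) : ℝ) * Complex.I) =
              Complex.exp ((-2 * π * inner ℝ p.1 ξ : ℝ) * Complex.I) *
                Complex.exp ((2 * π * inner ℝ p.2 ξ : ℝ) * Complex.I) := by
            rw [← Complex.exp_add, inner_sub_right, real_inner_comm ξ p.1, real_inner_comm ξ p.2]
            congr 1
            push_cast
            ring
          rw [this]
          ring
        simp_rw [e]
        rw [integral_const_mul, Measure.volume_eq_prod,
          integral_prod_mul (fun y => Complex.exp ((-2 * π * inner ℝ y ξ : ℝ) * Complex.I) * (f y : ℂ))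
          (fun y => Complex.exp ((2 * π * inner ℝ y ξ : ℝ) * Complex.I) * (f y : ℂ)),
          ← conj_realFourier]
        have : ∫ y, Complex.exp ((-2 * π * inner ℝ y ξ : ℝ) * Complex.I) * (f y : ℂ) =
            realFourier f ξ := by
          unfold realFourier
          rw [Real.fourier_eq']
          rfl
        rw [this, Complex.mul_conj, Complex.normSq_eq_norm_sq]
        push_cast
        rfl

lemma continuous_realFourier {f : Euc d → ℝ} (hf : Integrable f) : Continuous (realFourier f) :=
  VectorFourier.fourierIntegral_continuous Real.continuous_fourierChar
    (by exact continuous_inner) hf.ofReal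

lemma norm_realFourier_le (f : Euc d → ℝ) (ξ : Euc d) : ‖realFourier f ξ‖ ≤ ∫ x, ‖f x‖ := by
  have := VectorFourier.norm_fourierIntegral_le_integral_norm 𝐞 volume (innerₗ (Euc d))
    (fun x => (f x : ℂ)) ξ
  exact this.trans (le_of_eq (by simp))

lemma lintegral_rpow_mul_one_sub_exp {s lam : ℝ} (hs : s ∈ Ioo (0:ℝ) 1) (hl : 0 ≤ lam) :
    ∫⁻ t in Ioi (0:ℝ), ENNReal.ofReal (t ^ (-s - 1) * (1 - exp (-(lam * t)))) =
      ENNReal.ofReal (lam ^ s * Gamma (1 - s) / s) := by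
  obtain ⟨hs0, hs1⟩ := hs
  rcases hl.eq_or_lt with rfl | hl
  · simp [hs0.ne']
  have h1 : ∀ t ∈ Ioi (0:ℝ), ENNReal.ofReal (t ^ (-s - 1) * (1 - exp (-(lam * t)))) =
      ∫⁻ u in Ioi (0:ℝ), (Iio t).indicator
        (fun u => ENNReal.ofReal (t ^ (-s - 1)) * ENNReal.ofReal (lam * exp (-(lam * u)))) u := by
    intro t ht
    have ht : 0 < t := ht
    rw [setLIntegral_indicator measurableSet_Iio, Iio_inter_Ioi,
      lintegral_const_mul' _ _ ENNReal.ofReal_ne_top, ENNReal.ofReal_mul (by positivity)]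
    congr 1
    have hc : Continuous fun u => lam * exp (-(lam * u)) := by fun_prop
    rw [← ofReal_integral_eq_lintegral_ofReal
      (hc.integrableOn_Icc.mono_set Ioo_subset_Icc_self) (ae_of_all _ fun u => by positivity),
      ← integral_Ioc_eq_integral_Ioo, ← intervalIntegral.integral_of_le ht.le,
      intervalIntegral.integral_eq_sub_of_hasDerivAt (f := fun u => -exp (-(lam * u)))
        (fun u _ => ?_) (hc.intervalIntegrable _ _)]
    · simp
      ring_nf
    · have h : HasDerivAt (fun u => -exp (-(lam * u))) _ u :=
        (((hasDerivAt_id u).const_mul lam).neg.exp).neg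
      exact h.congr_deriv (by simp [mul_comm])
  have h2 : ∀ u ∈ Ioi (0:ℝ), ∫⁻ t in Ioi (0:ℝ), (Iio t).indicator
        (fun u => ENNReal.ofReal (t ^ (-s - 1)) * ENNReal.ofReal (lam * exp (-(lam * u)))) u =
      ENNReal.ofReal (lam / s) * ENNReal.ofReal (u ^ ((1 - s) - 1) * exp (-(lam * u))) := by
    intro u hu
    have hu : 0 < u := hu
    have e : ∀ t : ℝ, (Iio t).indicator
        (fun u => ENNReal.ofReal (t ^ (-s - 1)) * ENNReal.ofReal (lam * exp (-(lam * u)))) u =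
        (Ioi u).indicator (fun t => ENNReal.ofReal (t ^ (-s - 1)) *
          ENNReal.ofReal (lam * exp (-(lam * u)))) t := fun t => by
      simp [indicator]
    simp_rw [e]
    rw [setLIntegral_indicator measurableSet_Ioi, Ioi_inter_Ioi, sup_eq_left.2 hu.le,
      lintegral_mul_const' _ _ ENNReal.ofReal_ne_top,
      ← ofReal_integral_eq_lintegral_ofReal (integrableOn_Ioi_rpow_of_lt (by linarith) hu),
      integral_Ioi_rpow_of_lt (by linarith) hu, ← ENNReal.ofReal_mul', ← ENNReal.ofReal_mul]
    · congr 1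
      have e2 : (1 - s) - 1 = -s - 1 + 1 := by ring
      rw [e2]
      have : -s - 1 + 1 ≠ 0 := by linarith
      field_simp
      ring
    · positivity
    · positivity
    · filter_upwards [ae_restrict_mem measurableSet_Ioi] with t ht
      have : 0 < t := hu.trans ht
      simp only [Pi.zero_apply]
      positivity
  rw [setLIntegral_congr_fun measurableSet_Ioi h1, lintegral_lintegral_swap,
    setLIntegral_congr_fun measurableSet_Ioi h2, lintegral_const_mul' _ _ ENNReal.ofReal_ne_top,
    lintegral_rpow_mul_exp_neg_mul (by linarith) hl, ← ENNReal.ofReal_mul (by positivity)]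
  · congr 1
    have : lam ^ s = lam * lam ^ (-(1 - s)) := by
      nth_rewrite 2 [← Real.rpow_one lam]
      rw [← rpow_add hl]; congr 1; ring
    rw [this]
    ring
  · have : (Function.uncurry fun (t u : ℝ) => (Iio t).indicator
        (fun u => ENNReal.ofReal (t ^ (-s - 1)) * ENNReal.ofReal (lam * exp (-(lam * u)))) u) =
        {p : ℝ × ℝ | p.2 < p.1}.indicator (fun p => ENNReal.ofReal (p.1 ^ (-s - 1)) *
          ENNReal.ofReal (lam * exp (-(lam * p.2)))) := by
      ext p
      simp [indicator, Function.uncurry]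
    rw [this]
    exact (Measurable.indicator (by fun_prop)
      (measurableSet_lt measurable_snd measurable_fst)).aemeasurable

end Fourier

section Sobolev

open Set ENNReal
open scoped FourierTransform ContDiff

variable {d : ℕ}

lemma integrable_realFourier_sq {f : Euc d → ℝ} (hf : ContDiff ℝ ∞ f) (hc : HasCompactSupport f) :
    Integrable (fun ξ => ‖realFourier f ξ‖ ^ 2) := by
  have hc' : HasCompactSupport (fun x => (f x : ℂ)) := hc.comp_left Complex.ofReal_zero
  have hf' : ContDiff ℝ ∞ (fun x => (f x : ℂ)) := Complex.ofRealCLM.contDiff.comp hf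
  have h := (𝓕 (hc'.toSchwartzMap hf')).memLp 2 volume
  have h2 := h.integrable_norm_pow (by norm_num)
  refine h2.congr (ae_of_all _ fun ξ => ?_)
  simp only [SchwartzMap.fourier_coe]
  rfl

lemma integral_realFourier_inner {f g : Euc d → ℝ} (hf : ContDiff ℝ ∞ f)
    (hfc : HasCompactSupport f) (hg : ContDiff ℝ ∞ g) (hgc : HasCompactSupport g) :
    ∫ ξ, inner ℂ (realFourier f ξ) (realFourier g ξ) = ((∫ x, f x * g x : ℝ) : ℂ) := by
  have hfc' : HasCompactSupport (fun x => (f x : ℂ)) := hfc.comp_left Complex.ofReal_zero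
  have hf' : ContDiff ℝ ∞ (fun x => (f x : ℂ)) := Complex.ofRealCLM.contDiff.comp hf
  have hgc' : HasCompactSupport (fun x => (g x : ℂ)) := hgc.comp_left Complex.ofReal_zero
  have hg' : ContDiff ℝ ∞ (fun x => (g x : ℂ)) := Complex.ofRealCLM.contDiff.comp hg
  have h := SchwartzMap.integral_inner_fourier_fourier (hfc'.toSchwartzMap hf')
    (hgc'.toSchwartzMap hg')
  simp only [SchwartzMap.fourier_coe] at h
  refine (Eq.trans ?_ h).trans ?_
  · rfl
  · rw [← integral_complex_ofReal]
    refine integral_congr_ae (ae_of_all _ fun x => ?_)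
    change inner ℂ (f x : ℂ) (g x : ℂ) = _
    simp [mul_comm]

lemma integral_realFourier_sq {f : Euc d → ℝ} (hf : ContDiff ℝ ∞ f) (hc : HasCompactSupport f) :
    ∫ ξ, ‖realFourier f ξ‖ ^ 2 = ∫ x, f x ^ 2 := by
  have h := integral_realFourier_inner hf hc hf hc
  apply Complex.ofReal_injective
  rw [← integral_complex_ofReal]
  simp only [inner_self_eq_norm_sq_to_K] at h
  simp only [Complex.ofReal_pow, sq (f _)]
  exact h

set_option maxHeartbeats 1000000 in
lemma lintegral_heatK_mul_sq_sub {f : Euc d → ℝ} (hf : ContDiff ℝ ∞ f) (hc : HasCompactSupport f)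
    {t : ℝ} (ht : 0 < t) :
    ∫⁻ p : Euc d × Euc d, ENNReal.ofReal (heatK t (p.1 - p.2) * (f p.1 - f p.2) ^ 2) =
      ENNReal.ofReal 2 * ∫⁻ ξ, ENNReal.ofReal ((1 - exp (-(π ^ 2 * t * ‖ξ‖ ^ 2))) * ‖realFourier f ξ‖ ^ 2) := by
  have hfi : Integrable f := hf.continuous.integrable_of_hasCompactSupport hc
  have hf2 : Integrable (fun x => f x ^ 2) :=
    by
    have h : HasCompactSupport (fun x => f x ^ 2) := hc.comp_left (g := (· ^ 2)) (by simp)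
    exact (hf.continuous.pow 2).integrable_of_hasCompactSupport h
  have h1 : Integrable (fun p : Euc d × Euc d => heatK t (p.1 - p.2) * f p.2 ^ 2) := by
    refine (Integrable.convolution_integrand (ContinuousLinearMap.mul ℝ ℝ) hf2
      (integrable_heatK ht)).congr (ae_of_all _ fun p => ?_)
    simp [mul_comm]
  have h2 : Integrable (fun p : Euc d × Euc d => heatK t (p.1 - p.2) * f p.1 ^ 2) := by
    refine h1.swap.congr (ae_of_all _ fun p => ?_)
    simp only [Function.comp, Prod.fst_swap, Prod.snd_swap]
    rw [← heatK_neg, neg_sub]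
  have hm : Measurable (fun p : Euc d × Euc d => heatK t (p.1 - p.2)) := by
    have := (measurable_heatK (d := d)).comp
      (f := fun p : Euc d × Euc d => (t, p.1 - p.2)) (by fun_prop)
    exact this
  have hfm : Measurable f := hf.continuous.measurable
  have h3 : Integrable (fun p : Euc d × Euc d => heatK t (p.1 - p.2) * (f p.1 * f p.2)) := by
    refine (h1.add h2).mono' (by fun_prop) (ae_of_all _ fun p => ?_)
    have h0 := heatK_nonneg ht.le (p.1 - p.2)
    simp only [Pi.add_apply]
    rw [norm_mul, norm_of_nonneg h0, ← mul_add]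
    refine mul_le_mul_of_nonneg_left ?_ h0
    rw [Real.norm_eq_abs, abs_le]
    constructor <;> nlinarith [sq_nonneg (f p.1 + f p.2), sq_nonneg (f p.1 - f p.2)]
  have e1 : ∫ p : Euc d × Euc d, heatK t (p.1 - p.2) * f p.2 ^ 2 = ∫ x, f x ^ 2 := by
    rw [Measure.volume_eq_prod, integral_prod_symm _ h1]
    refine integral_congr_ae (ae_of_all _ fun y => ?_)
    simp only
    rw [integral_mul_const, integral_sub_right_eq_self (fun x => heatK t x) y, integral_heatK ht,
      one_mul]
  have e2 : ∫ p : Euc d × Euc d, heatK t (p.1 - p.2) * f p.1 ^ 2 = ∫ x, f x ^ 2 := by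
    rw [Measure.volume_eq_prod, integral_prod _ h2]
    refine integral_congr_ae (ae_of_all _ fun y => ?_)
    simp only
    rw [integral_mul_const, integral_sub_left_eq_self (fun x => heatK t x) _ y, integral_heatK ht,
      one_mul]
  have e3 := integral_heatK_form hfi ht
  have hF := integrable_realFourier_sq hf hc
  have hFe : Integrable (fun ξ => exp (-(π ^ 2 * t * ‖ξ‖ ^ 2)) * ‖realFourier f ξ‖ ^ 2) := by
    refine hF.bdd_mul (c := 1) (by fun_prop) (ae_of_all _ fun ξ => ?_)
    rw [norm_of_nonneg (exp_pos _).le, exp_le_one_iff]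
    have : 0 ≤ π ^ 2 * t * ‖ξ‖ ^ 2 := by positivity
    linarith
  have e4 : ∀ p : Euc d × Euc d, heatK t (p.1 - p.2) * (f p.1 - f p.2) ^ 2 =
      heatK t (p.1 - p.2) * f p.1 ^ 2 + heatK t (p.1 - p.2) * f p.2 ^ 2 -
        2 * (heatK t (p.1 - p.2) * (f p.1 * f p.2)) := fun p => by ring
  have hI := (h2.add h1).sub (h3.const_mul 2)
  have e5 : ∫ p : Euc d × Euc d, heatK t (p.1 - p.2) * (f p.1 - f p.2) ^ 2 =
      2 * ∫ ξ, (1 - exp (-(π ^ 2 * t * ‖ξ‖ ^ 2))) * ‖realFourier f ξ‖ ^ 2 := by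
    simp_rw [e4, sub_mul, one_mul]
    rw [integral_sub hF hFe, integral_sub (by exact h2.add h1) (h3.const_mul 2), integral_add h2 h1,
      integral_const_mul, e1, e2, e3, integral_realFourier_sq hf hc]
    ring
  rw [← ofReal_integral_eq_lintegral_ofReal, e5, ENNReal.ofReal_mul (by norm_num),
    ofReal_integral_eq_lintegral_ofReal]
  · simp only [sub_mul, one_mul]
    exact hF.sub hFe
  · refine ae_of_all _ fun ξ => mul_nonneg (sub_nonneg.2 (exp_le_one_iff.2 ?_)) (by positivity)
    have : 0 ≤ π ^ 2 * t * ‖ξ‖ ^ 2 := by positivity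
    linarith
  · exact hI.congr (ae_of_all _ fun p => (e4 p).symm)
  · exact ae_of_all _ fun p => mul_nonneg (heatK_nonneg ht.le _) (sq_nonneg _)

/-- The quadratic form of the fractional Laplacian as a double integral. -/
def fracEnergy (s : ℝ) (f : Euc d → ℝ) : ℝ≥0∞ :=
  ∫⁻ p : Euc d × Euc d,
    ENNReal.ofReal (a_sd d s * ((f p.1 - f p.2) ^ 2 / ‖p.1 - p.2‖ ^ ((d:ℝ) + 2*s)))

lemma lintegral_rpow_mul_realFourier_sq {s : ℝ} (hs : s ∈ Ioo (0:ℝ) 1) {f : Euc d → ℝ}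
    (hf : ContDiff ℝ ∞ f) (hc : HasCompactSupport f) :
    ∫⁻ ξ, ENNReal.ofReal ((4 * (π ^ 2 * ‖ξ‖ ^ 2)) ^ s * ‖realFourier f ξ‖ ^ 2) =
      fracEnergy s f := by
  obtain ⟨hs0, hs1⟩ := hs
  have hG : 0 < Gamma (1 - s) := Gamma_pos_of_pos (by linarith)
  have hfi : Integrable f := hf.continuous.integrable_of_hasCompactSupport hc
  have hFm : Measurable (realFourier f) := (continuous_realFourier hfi).measurable
  have hfm : Measurable f := hf.continuous.measurable
  have hkm := measurable_heatK (d := d)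
  have hm : Measurable (fun q : (Euc d × Euc d) × ℝ => heatK q.2 (q.1.1 - q.1.2)) :=
    hkm.comp (f := fun q : (Euc d × Euc d) × ℝ => (q.2, q.1.1 - q.1.2)) (by fun_prop)
  set k : ℝ := 4 ^ s * s / (2 * Gamma (1 - s)) with hk
  have hk0 : 0 < k := by positivity
  have h1 : ∀ ξ : Euc d, ENNReal.ofReal ((4 * (π ^ 2 * ‖ξ‖ ^ 2)) ^ s * ‖realFourier f ξ‖ ^ 2) =
      ENNReal.ofReal k * ∫⁻ t in Ioi (0:ℝ), ENNReal.ofReal (t ^ (-s - 1)) * (ENNReal.ofReal 2 *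
        ENNReal.ofReal ((1 - exp (-(π ^ 2 * t * ‖ξ‖ ^ 2))) * ‖realFourier f ξ‖ ^ 2)) := by
    intro ξ
    have e : ∀ t ∈ Ioi (0:ℝ), ENNReal.ofReal (t ^ (-s - 1)) * (ENNReal.ofReal 2 *
        ENNReal.ofReal ((1 - exp (-(π ^ 2 * t * ‖ξ‖ ^ 2))) * ‖realFourier f ξ‖ ^ 2)) =
        ENNReal.ofReal (2 * ‖realFourier f ξ‖ ^ 2) *
          ENNReal.ofReal (t ^ (-s - 1) * (1 - exp (-(π ^ 2 * ‖ξ‖ ^ 2 * t)))) := by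
      intro t ht
      have ht : 0 < t := ht
      rw [← ENNReal.ofReal_mul two_pos.le, ← ENNReal.ofReal_mul (rpow_nonneg ht.le _),
        ← ENNReal.ofReal_mul (by positivity)]
      ring_nf
    rw [setLIntegral_congr_fun measurableSet_Ioi e, lintegral_const_mul' _ _ ENNReal.ofReal_ne_top,
      lintegral_rpow_mul_one_sub_exp ⟨hs0, hs1⟩ (by positivity), ← ENNReal.ofReal_mul (by positivity),
      ← ENNReal.ofReal_mul hk0.le, mul_rpow (by norm_num) (by positivity)]
    congr 1
    rw [hk]
    field_simp
  simp_rw [h1]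
  have hAs : AEMeasurable (Function.uncurry fun (ξ : Euc d) (t : ℝ) =>
      ENNReal.ofReal (t ^ (-s - 1)) * (ENNReal.ofReal 2 * ENNReal.ofReal
        ((1 - exp (-(π ^ 2 * t * ‖ξ‖ ^ 2))) * ‖realFourier f ξ‖ ^ 2)))
      (volume.prod (volume.restrict (Ioi 0))) := by
    apply Measurable.aemeasurable
    unfold Function.uncurry
    fun_prop
  rw [lintegral_const_mul' _ _ ENNReal.ofReal_ne_top, lintegral_lintegral_swap hAs]
  have h2 : ∀ t ∈ Ioi (0:ℝ), ∫⁻ ξ : Euc d, ENNReal.ofReal (t ^ (-s - 1)) * (ENNReal.ofReal 2 * ENNReal.ofReal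
        ((1 - exp (-(π ^ 2 * t * ‖ξ‖ ^ 2))) * ‖realFourier f ξ‖ ^ 2)) =
      ∫⁻ p : Euc d × Euc d, ENNReal.ofReal (t ^ (-s - 1) * (heatK t (p.1 - p.2) *
        (f p.1 - f p.2) ^ 2)) := by
    intro t ht
    have ht : 0 < t := ht
    rw [lintegral_const_mul' _ _ ENNReal.ofReal_ne_top, lintegral_const_mul' _ _ ENNReal.ofReal_ne_top,
      ← lintegral_heatK_mul_sq_sub hf hc ht, ← lintegral_const_mul' _ _ ENNReal.ofReal_ne_top]
    simp_rw [← ENNReal.ofReal_mul (rpow_nonneg ht.le (-s - 1))]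
  have hBs : AEMeasurable (Function.uncurry fun (t : ℝ) (p : Euc d × Euc d) =>
      ENNReal.ofReal (t ^ (-s - 1) * (heatK t (p.1 - p.2) * (f p.1 - f p.2) ^ 2)))
      ((volume.restrict (Ioi 0)).prod volume) := by
    apply Measurable.aemeasurable
    unfold Function.uncurry
    have := hm.comp (measurable_swap (α := ℝ) (β := Euc d × Euc d))
    simp only [Function.comp_def, Prod.fst_swap, Prod.snd_swap] at this
    fun_prop
  rw [setLIntegral_congr_fun measurableSet_Ioi h2, lintegral_lintegral_swap hBs,
    ← lintegral_const_mul' _ _ ENNReal.ofReal_ne_top]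
  unfold fracEnergy
  refine lintegral_congr fun p => ?_
  rcases eq_or_ne p.1 p.2 with h | h
  · simp [h]
  have e : ∀ t ∈ Ioi (0:ℝ), ENNReal.ofReal (t ^ (-s - 1) * (heatK t (p.1 - p.2) *
        (f p.1 - f p.2) ^ 2)) = ENNReal.ofReal ((f p.1 - f p.2) ^ 2) *
        ENNReal.ofReal (t ^ (-s - 1) * heatK t (p.1 - p.2)) := by
    intro t ht
    rw [← ENNReal.ofReal_mul (by positivity)]
    ring_nf
  have hd0 : (0:ℝ) ≤ d := Nat.cast_nonneg d
  have hq : -s < (d:ℝ)/2 := by linarith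
  have hz : p.1 - p.2 ≠ 0 := sub_ne_zero.2 h
  have hz' : 0 < ‖p.1 - p.2‖ := norm_pos_iff.2 hz
  rw [setLIntegral_congr_fun measurableSet_Ioi e, lintegral_const_mul' _ _ ENNReal.ofReal_ne_top,
    lintegral_rpow_mul_heatK hq hz, ← ENNReal.ofReal_mul (by positivity),
    ← ENNReal.ofReal_mul hk0.le]
  congr 1
  have e1 : 2 * -s - (d:ℝ) = -((d:ℝ) + 2*s) := by ring
  have e2 : (d:ℝ)/2 - -s = ((d:ℝ) + 2*s)/2 := by ring
  have e3 : (2:ℝ) ^ (2*s - 1) = 4 ^ s / 2 := by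
    rw [Real.rpow_sub two_pos, Real.rpow_mul two_pos.le]; norm_num
  rw [e1, rpow_neg hz'.le, hk]
  unfold a_sd mellinConst
  rw [e2, e3]
  field_simp

end Sobolev

section Duality

open Set ENNReal
open scoped FourierTransform ContDiff

variable {d : ℕ}

lemma nullSingletonClass_euc (hd : 0 < d) : NullSingletonClass (volume : Measure (Euc d)) := by
  have : Nonempty (Fin d) := ⟨⟨0, hd⟩⟩
  infer_instance

/-- The constant of the Riesz kernel of `(-Δ)^{-s}`. -/
def rieszConst (d : ℕ) (s : ℝ) : ℝ := 4 ^ (-s) / Gamma s * mellinConst d s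

lemma lintegral_rpow_neg_mul_realFourier_sq_le {s : ℝ} (hs : 0 < s) (hds : 2*s < d) {h : Euc d → ℝ}
    (hi : Integrable h) (hhm : Measurable h) :
    ∫⁻ ξ, ENNReal.ofReal ((4 * (π ^ 2 * ‖ξ‖ ^ 2)) ^ (-s) * ‖realFourier h ξ‖ ^ 2) ≤
      ENNReal.ofReal (rieszConst d s) * ∫⁻ x, ∫⁻ y,
        ENNReal.ofReal (‖x - y‖ ^ (2*s - d) * (|h x| * |h y|)) := by
  have hd0 : (0:ℝ) < d := by linarith
  have hd : 0 < d := by exact_mod_cast hd0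
  have := nullSingletonClass_euc hd
  have hG : 0 < Gamma s := Gamma_pos_of_pos hs
  have hFm : Measurable (realFourier h) := (continuous_realFourier hi).measurable
  have hkm := measurable_heatK (d := d)
  have hm : Measurable (fun q : (Euc d × Euc d) × ℝ => heatK q.2 (q.1.1 - q.1.2)) :=
    hkm.comp (f := fun q : (Euc d × Euc d) × ℝ => (q.2, q.1.1 - q.1.2)) (by fun_prop)
  set k : ℝ := 4 ^ (-s) / Gamma s with hk
  have hk0 : 0 < k := by positivity
  have h1 : ∀ ξ : Euc d, ENNReal.ofReal ((4 * (π ^ 2 * ‖ξ‖ ^ 2)) ^ (-s) * ‖realFourier h ξ‖ ^ 2) ≤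
      ENNReal.ofReal k * ∫⁻ t in Ioi (0:ℝ), ENNReal.ofReal (t ^ (s - 1)) *
        ENNReal.ofReal (exp (-(π ^ 2 * t * ‖ξ‖ ^ 2)) * ‖realFourier h ξ‖ ^ 2) := by
    intro ξ
    rcases eq_or_ne ξ 0 with rfl | hξ
    · simp [Real.zero_rpow (neg_ne_zero.2 hs.ne')]
    have hξ' : 0 < ‖ξ‖ := norm_pos_iff.2 hξ
    have e : ∀ t ∈ Ioi (0:ℝ), ENNReal.ofReal (t ^ (s - 1)) *
        ENNReal.ofReal (exp (-(π ^ 2 * t * ‖ξ‖ ^ 2)) * ‖realFourier h ξ‖ ^ 2) =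
        ENNReal.ofReal (‖realFourier h ξ‖ ^ 2) *
          ENNReal.ofReal (t ^ (s - 1) * exp (-(π ^ 2 * ‖ξ‖ ^ 2 * t))) := by
      intro t ht
      rw [← ENNReal.ofReal_mul (rpow_nonneg (le_of_lt ht) _), ← ENNReal.ofReal_mul (by positivity)]
      ring_nf
    rw [setLIntegral_congr_fun measurableSet_Ioi e, lintegral_const_mul' _ _ ENNReal.ofReal_ne_top,
      lintegral_rpow_mul_exp_neg_mul hs (by positivity), ← ENNReal.ofReal_mul (by positivity),
      ← ENNReal.ofReal_mul hk0.le, mul_rpow (by norm_num) (by positivity)]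
    apply le_of_eq
    congr 1
    rw [hk]
    field_simp
  refine (lintegral_mono h1).trans ?_
  have hAs : AEMeasurable (Function.uncurry fun (ξ : Euc d) (t : ℝ) =>
      ENNReal.ofReal (t ^ (s - 1)) * ENNReal.ofReal
        (exp (-(π ^ 2 * t * ‖ξ‖ ^ 2)) * ‖realFourier h ξ‖ ^ 2))
      (volume.prod (volume.restrict (Ioi 0))) := by
    apply Measurable.aemeasurable
    unfold Function.uncurry
    fun_prop
  rw [lintegral_const_mul' _ _ ENNReal.ofReal_ne_top, lintegral_lintegral_swap hAs]
  have h2 : ∀ t ∈ Ioi (0:ℝ), ∫⁻ ξ : Euc d, ENNReal.ofReal (t ^ (s - 1)) * ENNReal.ofReal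
        (exp (-(π ^ 2 * t * ‖ξ‖ ^ 2)) * ‖realFourier h ξ‖ ^ 2) ≤
      ∫⁻ p : Euc d × Euc d, ENNReal.ofReal (t ^ (s - 1) * (heatK t (p.1 - p.2) *
        (|h p.1| * |h p.2|))) := by
    intro t ht
    have ht : 0 < t := ht
    simp_rw [ENNReal.ofReal_mul (rpow_nonneg ht.le (s - 1))]
    rw [lintegral_const_mul' _ _ ENNReal.ofReal_ne_top, lintegral_const_mul' _ _ ENNReal.ofReal_ne_top]
    gcongr
    rw [← ofReal_integral_eq_lintegral_ofReal, ← integral_heatK_form hi ht]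
    · refine (ENNReal.ofReal_le_ofReal (le_abs_self _)).trans ?_
      rw [← Real.norm_eq_abs, ofReal_norm]
      refine (enorm_integral_le_lintegral_enorm _).trans (lintegral_mono fun p => ?_)
      rw [← ofReal_norm, norm_mul, norm_mul, norm_of_nonneg (heatK_nonneg ht.le _)]
      rfl
    · refine ((integrable_exp_neg_mul_sq_norm (d := d) (b := π ^ 2 * t) (by positivity)).bdd_mul
        (f := fun ξ => ‖realFourier h ξ‖ ^ 2) (c := (∫ x, ‖h x‖) ^ 2)
        (hFm.norm.pow_const 2).aestronglyMeasurable (ae_of_all _ fun ξ => ?_)).congr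
        (ae_of_all _ fun ξ => mul_comm _ _)
      rw [norm_pow, norm_norm]
      gcongr
      exact norm_realFourier_le h ξ
    · exact ae_of_all _ fun ξ => by positivity
  have hBs : AEMeasurable (Function.uncurry fun (t : ℝ) (p : Euc d × Euc d) =>
      ENNReal.ofReal (t ^ (s - 1) * (heatK t (p.1 - p.2) * (|h p.1| * |h p.2|))))
      ((volume.restrict (Ioi 0)).prod volume) := by
    apply Measurable.aemeasurable
    unfold Function.uncurry
    have := hm.comp (measurable_swap (α := ℝ) (β := Euc d × Euc d))
    simp only [Function.comp_def, Prod.fst_swap, Prod.snd_swap] at this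
    fun_prop
  refine (mul_le_mul_right (setLIntegral_mono' measurableSet_Ioi h2) _).trans ?_
  rw [lintegral_lintegral_swap hBs]
  have e : ∀ p : Euc d × Euc d, p.1 ≠ p.2 → ∫⁻ t in Ioi (0:ℝ), ENNReal.ofReal (t ^ (s - 1) *
        (heatK t (p.1 - p.2) * (|h p.1| * |h p.2|))) =
        ENNReal.ofReal (mellinConst d s) *
          ENNReal.ofReal (‖p.1 - p.2‖ ^ (2*s - d) * (|h p.1| * |h p.2|)) := by
    intro p hp
    have hq : s < (d:ℝ)/2 := by linarith
    rw [← ENNReal.ofReal_mul (mellinConst_pos hq).le, ← mul_assoc (mellinConst d s),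
      ENNReal.ofReal_mul' (by positivity), ← lintegral_rpow_mul_heatK hq (sub_ne_zero.2 hp),
      ← lintegral_mul_const' _ _ ENNReal.ofReal_ne_top]
    refine setLIntegral_congr_fun measurableSet_Ioi fun t ht => ?_
    rw [← ENNReal.ofReal_mul' (by positivity), mul_assoc]
  have hq : s < (d:ℝ)/2 := by linarith
  rw [Measure.volume_eq_prod, lintegral_prod]
  · unfold rieszConst
    rw [← hk, ENNReal.ofReal_mul hk0.le, mul_assoc]
    gcongr
    rw [← lintegral_const_mul' _ _ ENNReal.ofReal_ne_top]
    refine lintegral_mono fun x => ?_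
    rw [← lintegral_const_mul' _ _ ENNReal.ofReal_ne_top]
    refine lintegral_mono_ae ?_
    filter_upwards [compl_mem_ae_iff.2 (measure_singleton x)] with y hy
    exact (e (x, y) (fun h => hy h.symm)).le
  · apply Measurable.aemeasurable
    refine Measurable.lintegral_prod_right' (f := fun q : (Euc d × Euc d) × ℝ =>
      ENNReal.ofReal (q.2 ^ (s - 1) * (heatK q.2 (q.1.1 - q.1.2) * (|h q.1.1| * |h q.1.2|)))) ?_
    fun_prop

lemma lintegral_mul_le_energy_add_riesz {s : ℝ} (hs : s ∈ Ioo (0:ℝ) 1) (hds : 2*s < d)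
    {f h : Euc d → ℝ} (hf : ContDiff ℝ ∞ f) (hfc : HasCompactSupport f)
    (hh : ContDiff ℝ ∞ h) (hhc : HasCompactSupport h) :
    ENNReal.ofReal (2 * ∫ x, h x * f x) ≤ fracEnergy s f +
      ENNReal.ofReal (rieszConst d s) * ∫⁻ x, ∫⁻ y,
        ENNReal.ofReal (‖x - y‖ ^ (2*s - d) * (|h x| * |h y|)) := by
  have hd0 : (0:ℝ) < d := by linarith [hs.1]
  have hd : 0 < d := by exact_mod_cast hd0
  have := nullSingletonClass_euc hd
  have hfi : Integrable f := hf.continuous.integrable_of_hasCompactSupport hfc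
  have hhi : Integrable h := hh.continuous.integrable_of_hasCompactSupport hhc
  have hFm : Measurable (realFourier f) := (continuous_realFourier hfi).measurable
  refine le_trans ?_ (add_le_add_right
    (lintegral_rpow_neg_mul_realFourier_sq_le hs.1 hds hhi hh.continuous.measurable) _)
  rw [← lintegral_rpow_mul_realFourier_sq hs hf hfc, ← lintegral_add_left (by fun_prop)]
  have e : ENNReal.ofReal (2 * ∫ x, h x * f x) ≤
      ENNReal.ofReal ‖2 * ∫ ξ, inner ℂ (realFourier h ξ) (realFourier f ξ)‖ := by
    rw [integral_realFourier_inner hh hhc hf hfc, norm_mul, Complex.norm_real]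
    refine ENNReal.ofReal_le_ofReal ?_
    simp only [RCLike.norm_ofNat]
    gcongr
    exact le_abs_self _
  refine e.trans ?_
  rw [← integral_const_mul, ofReal_norm]
  refine (enorm_integral_le_lintegral_enorm _).trans (lintegral_mono_ae ?_)
  filter_upwards [compl_mem_ae_iff.2 (measure_singleton (0 : Euc d))] with ξ hξ
  have hξ' : 0 < ‖ξ‖ := norm_pos_iff.2 hξ
  rw [← ENNReal.ofReal_add (by positivity) (by positivity), ← ofReal_norm]
  refine ENNReal.ofReal_le_ofReal ?_
  have hc := norm_inner_le_norm (𝕜 := ℂ) (realFourier h ξ) (realFourier f ξ)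
  rw [norm_mul, RCLike.norm_ofNat]
  set r : ℝ := 4 * (π ^ 2 * ‖ξ‖ ^ 2)
  have hr : 0 < r := by positivity
  have e1 : r ^ s = (r ^ (s/2)) ^ 2 := by
    rw [← Real.rpow_natCast, ← Real.rpow_mul hr.le]; norm_num
  have e2 : r ^ (-s) = (r ^ (-(s/2))) ^ 2 := by
    rw [← Real.rpow_natCast, ← Real.rpow_mul hr.le]; norm_num
  have e3 : r ^ (s/2) * r ^ (-(s/2)) = 1 := by
    rw [← Real.rpow_add hr]; simp
  rw [e1, e2]
  have h4 := sq_nonneg (r ^ (s/2) * ‖realFourier f ξ‖ - r ^ (-(s/2)) * ‖realFourier h ξ‖)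
  have h5 : (r ^ (s/2) * ‖realFourier f ξ‖) * (r ^ (-(s/2)) * ‖realFourier h ξ‖) =
      ‖realFourier h ξ‖ * ‖realFourier f ξ‖ := by
    rw [mul_mul_mul_comm, e3]; ring
  nlinarith

end Duality

section TwoPole

open Set ENNReal
open scoped ContDiff

variable {d : ℕ}

lemma C_fH_pos {s : ℝ} (hs : 0 < s) (hds : 2*s < d) : 0 < C_fH d s := by
  have h1 := Gamma_pos_of_pos (show 0 < ((d:ℝ) + 2*s)/4 by linarith)
  have h2 := Gamma_pos_of_pos (show 0 < ((d:ℝ) - 2*s)/4 by linarith)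
  unfold C_fH
  positivity

lemma C_fH_mul_rieszConst_mul_starConst {s : ℝ} (hs : 0 < s) (hds : 2*s < d) :
    C_fH d s * (rieszConst d s * starConst d s) = 1 := by
  have h1 := Gamma_pos_of_pos (show 0 < ((d:ℝ) + 2*s)/4 by linarith)
  have h2 := Gamma_pos_of_pos (show 0 < ((d:ℝ) - 2*s)/4 by linarith)
  have h3 := Gamma_pos_of_pos hs
  have h4 := mellinConst_pos (show s < (d:ℝ)/2 by linarith)
  have e1 : mellinConst d (((d:ℝ) + 2*s)/4) = π ^ (-(d:ℝ)/2) * Gamma (((d:ℝ) - 2*s)/4) := by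
    unfold mellinConst; ring_nf
  have e2 : mellinConst d (((d:ℝ) - 2*s)/4) = π ^ (-(d:ℝ)/2) * Gamma (((d:ℝ) + 2*s)/4) := by
    unfold mellinConst; ring_nf
  have e3 : (2:ℝ) ^ (2*s) = 4 ^ s := by
    rw [Real.rpow_mul two_pos.le]; norm_num
  have e0 : s + ((d:ℝ) - 2*s)/4 = ((d:ℝ) + 2*s)/4 := by ring
  unfold C_fH rieszConst starConst
  rw [e0, e1, e2, e3, Real.rpow_neg (by norm_num)]
  field_simp

/-- The potential with poles at `a` and `b`. -/
def twoPole (s : ℝ) (a b x : Euc d) : ℝ :=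
  ‖a - b‖ ^ (2*s) / (‖x - a‖ ^ (2*s) * ‖x - b‖ ^ (2*s))

lemma twoPole_nonneg (s : ℝ) (a b x : Euc d) : 0 ≤ twoPole s a b x := by
  unfold twoPole; positivity

lemma twoPole_eq {s : ℝ} {a b x : Euc d} (hxa : x ≠ a) (hxb : x ≠ b) :
    twoPole s a b x = ‖a - b‖ ^ (2*s) *
      (‖x - a‖ ^ (-((d:ℝ) + 2*s)/2) * ‖x - b‖ ^ (-((d:ℝ) + 2*s)/2)) /
      (‖x - a‖ ^ (-((d:ℝ) - 2*s)/2) * ‖x - b‖ ^ (-((d:ℝ) - 2*s)/2)) := by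
  have ha : 0 < ‖x - a‖ := norm_pos_iff.2 (sub_ne_zero.2 hxa)
  have hb : 0 < ‖x - b‖ := norm_pos_iff.2 (sub_ne_zero.2 hxb)
  have e : -((d:ℝ) + 2*s)/2 = -((d:ℝ) - 2*s)/2 - 2*s := by ring
  unfold twoPole
  rw [e, Real.rpow_sub ha, Real.rpow_sub hb]
  field_simp

lemma contDiff_twoPole_mul {s : ℝ} {a b : Euc d} {f : Euc d → ℝ} (hf : ContDiff ℝ ∞ f)
    (ha : a ∉ tsupport f) (hb : b ∉ tsupport f) :
    ContDiff ℝ ∞ (fun x => twoPole s a b x * f x) := by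
  rw [contDiff_iff_contDiffAt]
  intro x
  by_cases hx : x ∈ tsupport f
  · have hxa : x - a ≠ 0 := sub_ne_zero.2 fun h => ha (h ▸ hx)
    have hxb : x - b ≠ 0 := sub_ne_zero.2 fun h => hb (h ▸ hx)
    have h1 : ContDiffAt ℝ ∞ (fun x => ‖x - a‖ ^ (2*s)) x :=
      ((contDiffAt_id.sub contDiffAt_const).norm ℝ hxa).rpow_const_of_ne (norm_ne_zero_iff.2 hxa)
    have h2 : ContDiffAt ℝ ∞ (fun x => ‖x - b‖ ^ (2*s)) x :=
      ((contDiffAt_id.sub contDiffAt_const).norm ℝ hxb).rpow_const_of_ne (norm_ne_zero_iff.2 hxb)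
    have := norm_pos_iff.2 hxa
    have := norm_pos_iff.2 hxb
    exact (contDiffAt_const.div (h1.mul h2) (by positivity)).mul hf.contDiffAt
  · have h : (fun x => twoPole s a b x * f x) =ᶠ[nhds x] fun _ => 0 := by
      filter_upwards [notMem_tsupport_iff_eventuallyEq.1 hx] with y hy
      simp [hy]
    exact contDiffAt_const.congr_of_eventuallyEq h

lemma lintegral_lintegral_add_symm {α : Type*} [MeasurableSpace α] {μ : Measure α} [SFinite μ]
    {J : α → α → ℝ≥0∞} (hJ : Measurable (Function.uncurry J)) :
    ∫⁻ x, ∫⁻ y, (J x y + J y x) ∂μ ∂μ = (∫⁻ x, ∫⁻ y, J x y ∂μ ∂μ) + ∫⁻ x, ∫⁻ y, J x y ∂μ ∂μ := by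
  have h1 : ∀ x, Measurable (J x) := fun x => hJ.comp measurable_prodMk_left
  have h2 : Measurable fun x => ∫⁻ y, J x y ∂μ := hJ.lintegral_prod_right'
  simp_rw [fun x => lintegral_add_left (μ := μ) (h1 x) (fun y => J y x)]
  rw [lintegral_add_left h2]
  congr 1
  exact (lintegral_lintegral_swap hJ.aemeasurable).symm

lemma lintegral_riesz_twoPole_le {s : ℝ} (hs : 0 < s) (hds : 2*s < d) {a b : Euc d} (hab : a ≠ b)
    {f : Euc d → ℝ} (hfm : Measurable f) (hfa : f a = 0) (hfb : f b = 0) :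
    ∫⁻ x, ∫⁻ y, ENNReal.ofReal (‖x - y‖ ^ (2*s - d) *
        (|twoPole s a b x * f x| * |twoPole s a b y * f y|)) ≤
      ENNReal.ofReal (starConst d s) * ∫⁻ x, ENNReal.ofReal (twoPole s a b x * f x ^ 2) := by
  set L : ℝ := ‖a - b‖ ^ (2*s) with hL
  have hab' : 0 < ‖a - b‖ := norm_pos_iff.2 (sub_ne_zero.2 hab)
  have hL0 : 0 < L := by positivity
  set U : Euc d → ℝ := fun x => ‖x - a‖ ^ (-((d:ℝ) + 2*s)/2) * ‖x - b‖ ^ (-((d:ℝ) + 2*s)/2) with hU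
  set W : Euc d → ℝ := fun x => ‖x - a‖ ^ (-((d:ℝ) - 2*s)/2) * ‖x - b‖ ^ (-((d:ℝ) - 2*s)/2) with hW
  have hU0 : ∀ x, 0 ≤ U x := fun x => by simp only [hU]; positivity
  have hUm : Measurable U := by simp only [hU]; fun_prop
  have hWm : Measurable W := by simp only [hW]; fun_prop
  have hV : ∀ x, twoPole s a b x * f x = L * U x * (f x / W x) := by
    intro x
    rcases eq_or_ne x a with rfl | hxa
    · simp [hfa]
    rcases eq_or_ne x b with rfl | hxb
    · simp [hfb]
    rw [twoPole_eq hxa hxb]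
    ring
  set K : Euc d → ℝ := fun x => L ^ 2 / 2 * (U x * (f x / W x) ^ 2) with hK
  have hK0 : ∀ x, 0 ≤ K x := fun x => by
    have := hU0 x
    simp only [hK]; positivity
  have hKm : Measurable K := by simp only [hK]; fun_prop
  have hpt : ∀ x y, ENNReal.ofReal (‖x - y‖ ^ (2*s - d) *
        (|twoPole s a b x * f x| * |twoPole s a b y * f y|)) ≤
      ENNReal.ofReal (K x) * ENNReal.ofReal (‖x - y‖ ^ (2*s - d) * U y) +
      ENNReal.ofReal (K y) * ENNReal.ofReal (‖y - x‖ ^ (2*s - d) * U x) := by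
    intro x y
    have h1 := hU0 x
    have h2 := hU0 y
    have h3 := hK0 x
    have h4 := hK0 y
    rw [← ENNReal.ofReal_mul h3, ← ENNReal.ofReal_mul h4, ← ENNReal.ofReal_add (by positivity)
      (by positivity)]
    refine ENNReal.ofReal_le_ofReal ?_
    rw [hV, hV, norm_sub_rev y x, abs_mul, abs_mul (L * U y), abs_of_nonneg (a := L * U x)
      (by positivity), abs_of_nonneg (a := L * U y) (by positivity)]
    simp only [hK]
    have h5 : 0 ≤ ‖x - y‖ ^ (2*s - d) * (L ^ 2 * (U x * U y)) := by positivity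
    have h6 : |f x / W x| * |f y / W y| ≤ (f x / W x) ^ 2 / 2 + (f y / W y) ^ 2 / 2 := by
      rw [← sq_abs (f x / W x), ← sq_abs (f y / W y)]
      nlinarith [sq_nonneg (|f x / W x| - |f y / W y|)]
    have h7 := mul_le_mul_of_nonneg_left h6 h5
    calc _ = ‖x - y‖ ^ (2*s - d) * (L ^ 2 * (U x * U y)) * (|f x / W x| * |f y / W y|) := by ring
      _ ≤ _ := h7
      _ = _ := by ring
  set J : Euc d → Euc d → ℝ≥0∞ := fun x y =>
    ENNReal.ofReal (K x) * ENNReal.ofReal (‖x - y‖ ^ (2*s - d) * U y) with hJ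
  have hJm : Measurable (Function.uncurry J) := by
    simp only [hJ, Function.uncurry_def]; fun_prop
  have hJI : ∫⁻ x, ∫⁻ y, J x y = ENNReal.ofReal (starConst d s / 2) *
      ∫⁻ x, ENNReal.ofReal (twoPole s a b x * f x ^ 2) := by
    rw [← lintegral_const_mul' _ _ ENNReal.ofReal_ne_top]
    refine lintegral_congr fun x => ?_
    simp only [hJ]
    rw [lintegral_const_mul' _ _ ENNReal.ofReal_ne_top]
    rcases eq_or_ne x a with rfl | hxa
    · simp [hK, hfa]
    rcases eq_or_ne x b with rfl | hxb
    · simp [hK, hfb]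
    simp only [hU]
    rw [lintegral_star hs hds hxb hab hxa, ← ENNReal.ofReal_mul (hK0 x),
      ← ENNReal.ofReal_mul' (mul_nonneg (twoPole_nonneg _ _ _ _) (sq_nonneg _))]
    congr 1
    rw [sq (f x), ← mul_assoc (twoPole s a b x), hV]
    have hxa' : 0 < ‖x - a‖ := norm_pos_iff.2 (sub_ne_zero.2 hxa)
    have hxb' : 0 < ‖x - b‖ := norm_pos_iff.2 (sub_ne_zero.2 hxb)
    have hW0 : 0 < W x := by simp only [hW]; positivity
    change K x * (starConst d s * (‖a - b‖ ^ (-(2*s)) * W x)) = _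
    rw [Real.rpow_neg hab'.le, ← hL]
    simp only [hK]
    field_simp
  calc _ ≤ ∫⁻ x, ∫⁻ y, (J x y + J y x) := lintegral_mono fun x => lintegral_mono fun y => hpt x y
    _ = (∫⁻ x, ∫⁻ y, J x y) + ∫⁻ x, ∫⁻ y, J x y := lintegral_lintegral_add_symm hJm
    _ = _ := by
      have hsc : 0 ≤ starConst d s := by
        have h1 := C_fH_mul_rieszConst_mul_starConst hs hds
        have h2 := C_fH_pos hs hds
        have h4 := mellinConst_pos (show s < (d:ℝ)/2 by linarith)
        have h3 := Gamma_pos_of_pos hs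
        have h5 : 0 < rieszConst d s := by unfold rieszConst; positivity
        by_contra hcon
        have := mul_neg_of_pos_of_neg h2 (mul_neg_of_pos_of_neg h5 (not_le.1 hcon))
        linarith
      rw [hJI, ← add_mul, ← ENNReal.ofReal_add (by positivity) (by positivity), add_halves]

theorem lintegral_twoPole_le_fracEnergy {s : ℝ} (hs : s ∈ Ioo (0:ℝ) 1) (hds : 2*s < d)
    {a b : Euc d} (hab : a ≠ b) {f : Euc d → ℝ} (hf : ContDiff ℝ ∞ f) (hfc : HasCompactSupport f)
    (ha : a ∉ tsupport f) (hb : b ∉ tsupport f) :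
    ∫⁻ x, ENNReal.ofReal (C_fH d s * (twoPole s a b x * f x ^ 2)) ≤ fracEnergy s f := by
  have hC := C_fH_pos hs.1 hds
  have hV := contDiff_twoPole_mul (s := s) hf ha hb
  have hVc : HasCompactSupport (fun x => twoPole s a b x * f x) := hfc.mul_left
  set h : Euc d → ℝ := fun x => C_fH d s * (twoPole s a b x * f x) with hh
  have hhs : ContDiff ℝ ∞ h := contDiff_const.mul hV
  have hhc : HasCompactSupport h := hVc.mul_left
  have key := lintegral_mul_le_energy_add_riesz hs hds hf hfc hhs hhc
  have hfa : f a = 0 := image_eq_zero_of_notMem_tsupport ha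
  have hfb : f b = 0 := image_eq_zero_of_notMem_tsupport hb
  have hR := lintegral_riesz_twoPole_le hs.1 hds hab hf.continuous.measurable hfa hfb
  set I : ℝ≥0∞ := ∫⁻ x, ENNReal.ofReal (C_fH d s * (twoPole s a b x * f x ^ 2)) with hI
  have hnn : ∀ x, 0 ≤ C_fH d s * (twoPole s a b x * f x ^ 2) := fun x => by
    have := twoPole_nonneg s a b x
    positivity
  have hint : Integrable (fun x => h x * f x) :=
    (hhs.continuous.mul hf.continuous).integrable_of_hasCompactSupport hhc.mul_right
  have e : ∀ x, h x * f x = C_fH d s * (twoPole s a b x * f x ^ 2) := fun x => by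
    simp only [hh]; ring
  have hIe : I = ENNReal.ofReal (∫ x, h x * f x) := by
    rw [ofReal_integral_eq_lintegral_ofReal hint (ae_of_all _ fun x => (hnn x).trans (e x).ge)]
    simp_rw [e]
    rfl
  have hIt : I ≠ ⊤ := hIe ▸ ENNReal.ofReal_ne_top
  have hκ : 0 ≤ rieszConst d s := by
    have h4 := mellinConst_pos (show s < (d:ℝ)/2 by linarith)
    have h3 := Gamma_pos_of_pos hs.1
    unfold rieszConst; positivity
  have hR2 : ENNReal.ofReal (rieszConst d s) * ∫⁻ x, ∫⁻ y,
        ENNReal.ofReal (‖x - y‖ ^ (2*s - d) * (|h x| * |h y|)) ≤ I := by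
    have e1 : ∀ x y, ENNReal.ofReal (‖x - y‖ ^ (2*s - d) * (|h x| * |h y|)) =
        ENNReal.ofReal (C_fH d s ^ 2) * ENNReal.ofReal (‖x - y‖ ^ (2*s - d) *
        (|twoPole s a b x * f x| * |twoPole s a b y * f y|)) := by
      intro x y
      rw [← ENNReal.ofReal_mul (by positivity)]
      simp only [hh]
      rw [abs_mul, abs_mul (C_fH d s), abs_of_pos hC]
      ring_nf
    simp_rw [e1, lintegral_const_mul' _ _ ENNReal.ofReal_ne_top]
    calc _ ≤ ENNReal.ofReal (rieszConst d s) * (ENNReal.ofReal (C_fH d s ^ 2) *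
          (ENNReal.ofReal (starConst d s) *
            ∫⁻ x, ENNReal.ofReal (twoPole s a b x * f x ^ 2))) := by gcongr
      _ = I := by
        simp_rw [hI, ENNReal.ofReal_mul hC.le]
        rw [lintegral_const_mul' _ _ ENNReal.ofReal_ne_top, ← mul_assoc, ← mul_assoc,
          ← ENNReal.ofReal_mul hκ, ← ENNReal.ofReal_mul (by positivity)]
        congr 2
        have := C_fH_mul_rieszConst_mul_starConst hs.1 hds
        linear_combination C_fH d s * this
  rw [ENNReal.ofReal_mul two_pos.le, ← hIe, ENNReal.ofReal_ofNat, two_mul] at key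
  exact (ENNReal.add_le_add_iff_right hIt).1 (key.trans (by gcongr))

end TwoPole

section Particles

open Set ENNReal
open scoped ContDiff

variable {d N : ℕ}

/-- The density of the kinetic energy of the `i`-th particle. -/
def kineticDensity (s : ℝ) (u : (Fin N → Euc d) → ℝ) (i : Fin N) (x : Fin N → Euc d) : ℝ≥0∞ :=
  ∫⁻ z : Euc d, ENNReal.ofReal (a_sd d s *
    ((u x - u (Function.update x i z)) ^ 2 / ‖x i - z‖ ^ ((d:ℝ) + 2*s)))

lemma measurable_update_apply (i : Fin N) :
    Measurable fun p : (Fin N → Euc d) × Euc d => Function.update p.1 i p.2 :=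
  (continuous_fst.update i continuous_snd).measurable

lemma measurable_kineticDensity_integrand (s : ℝ) {u : (Fin N → Euc d) → ℝ} (hu : Measurable u)
    (i : Fin N) : Measurable fun p : (Fin N → Euc d) × Euc d => (a_sd d s *
      ((u p.1 - u (Function.update p.1 i p.2)) ^ 2 / ‖p.1 i - p.2‖ ^ ((d:ℝ) + 2*s))) := by
  have h := hu.comp (measurable_update_apply (d := d) i)
  simp only [Function.comp_def] at h
  fun_prop

lemma measurable_kineticDensity (s : ℝ) {u : (Fin N → Euc d) → ℝ} (hu : Measurable u)
    (i : Fin N) : Measurable (kineticDensity s u i) :=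
  Measurable.lintegral_prod_right' (measurable_kineticDensity_integrand s hu i).ennreal_ofReal

lemma lintegral_kineticDensity_update (s : ℝ) {u : (Fin N → Euc d) → ℝ} (hu : Continuous u)
    (i : Fin N) (x : Fin N → Euc d) :
    ∫⁻ y, kineticDensity s u i (Function.update x i y) =
      fracEnergy s (u ∘ Function.update x i) := by
  have hf : Measurable (u ∘ Function.update x i) :=
    (hu.comp (continuous_const.update i continuous_id)).measurable
  unfold fracEnergy kineticDensity
  rw [Measure.volume_eq_prod, lintegral_prod _ (by fun_prop)]
  simp

theorem lintegral_twoPole_le_kineticDensity {s : ℝ} (hs : s ∈ Ioo (0:ℝ) 1) (hds : 2*s < d)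
    {u : (Fin N → Euc d) → ℝ} (hu : ContDiff ℝ ∞ u) (hc : HasCompactSupport u)
    (hoff : tsupport u ⊆ {x | ∀ i j, i ≠ j → x i ≠ x j}) {i j k : Fin N} (hij : i ≠ j)
    (hik : i ≠ k) :
    ∫⁻ x, ENNReal.ofReal (C_fH d s * (twoPole s (x j) (x k) (x i) * u x ^ 2)) ≤
      ∫⁻ x, kineticDensity s u i x := by
  have hum : Measurable u := hu.continuous.measurable
  rw [volume_pi]
  refine lintegral_le_of_lmarginal_le {i} ?_ (measurable_kineticDensity s hum i) fun x => ?_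
  · unfold twoPole; fun_prop
  rw [lmarginal_singleton, lmarginal_singleton]
  simp only
  rw [lintegral_kineticDensity_update s hu.continuous i x]
  simp only [Function.update_of_ne hij.symm, Function.update_of_ne hik.symm, Function.update_self]
  rcases eq_or_ne (x j) (x k) with h | h
  · have h2 : (0:ℝ) ^ (2*s) = 0 := Real.zero_rpow (by linarith [hs.1])
    simp [twoPole, h, h2]
  have hcont : Continuous (Function.update x i) := continuous_const.update i continuous_id
  have hts := tsupport_comp_subset_preimage u hcont
  refine lintegral_twoPole_le_fracEnergy hs hds h (hu.comp (contDiff_update _ x i))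
    (hc.comp_isClosedEmbedding (isClosedEmbedding_update x i)) (fun hm => ?_) (fun hm => ?_)
  · exact hoff (hts hm) i j hij (by simp [hij.symm])
  · exact hoff (hts hm) i k hik (by simp [hik.symm])

lemma lintegral_min_one_sq_mul_rpow_lt_top (hd : 0 < d) {s : ℝ} (hs : s ∈ Ioo (0:ℝ) 1) :
    ∫⁻ h : Euc d, ENNReal.ofReal (min 1 (‖h‖ ^ 2) * ‖h‖ ^ (-((d:ℝ) + 2*s))) < ⊤ := by
  have : Nonempty (Fin d) := ⟨⟨0, hd⟩⟩
  have hI : Integrable (fun h : Euc d => (fun y : ℝ => min 1 (y ^ 2) * y ^ (-((d:ℝ) + 2*s))) ‖h‖) := by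
    refine (integrable_fun_norm_addHaar volume
      (f := fun y : ℝ => min 1 (y ^ 2) * y ^ (-((d:ℝ) + 2*s)))).2 ?_
    rw [finrank_euclideanSpace_fin, ← Ioc_union_Ioi_eq_Ioi (zero_le_one (α := ℝ))]
    have e : ∀ y : ℝ, 0 < y → y ^ (d - 1) * y ^ (-((d:ℝ) + 2*s)) = y ^ (-1 - 2*s) := by
      intro y hy
      rw [← Real.rpow_natCast, ← Real.rpow_add hy, Nat.cast_sub hd]
      congr 1
      push_cast
      ring
    refine IntegrableOn.union ?_ ?_
    · have h1 : IntegrableOn (fun y : ℝ => y ^ (1 - 2*s)) (Ioc 0 1) :=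
        (intervalIntegrable_iff_integrableOn_Ioc_of_le zero_le_one).1
          (intervalIntegral.intervalIntegrable_rpow' (by linarith [hs.2]))
      refine h1.congr_fun (fun y hy => ?_) measurableSet_Ioc
      have hy2 : y ^ 2 ≤ 1 := pow_le_one₀ hy.1.le hy.2
      simp only [smul_eq_mul]
      rw [min_eq_right hy2, mul_left_comm, e y hy.1, ← Real.rpow_natCast, ← Real.rpow_add hy.1]
      congr 1
      push_cast
      ring
    · have h1 : IntegrableOn (fun y : ℝ => y ^ (-1 - 2*s)) (Ioi 1) :=
        integrableOn_Ioi_rpow_of_lt (by linarith [hs.1]) zero_lt_one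
      refine h1.congr_fun (fun y hy => ?_) measurableSet_Ioi
      have hy1 : 1 < y := hy
      have hy2 : 1 ≤ y ^ 2 := one_le_pow₀ hy1.le
      simp only [smul_eq_mul]
      rw [min_eq_left hy2, mul_left_comm, e y (by linarith), one_mul]
  exact hI.lintegral_lt_top

lemma exists_sq_sub_add_le {E : Type*} [NormedAddCommGroup E] [NormedSpace ℝ E] {u : E → ℝ}
    (hu : ContDiff ℝ ∞ u) (hc : HasCompactSupport u) :
    ∃ B : ℝ, 0 ≤ B ∧ ∀ x v, (u x - u (x + v)) ^ 2 ≤ B * min 1 (‖v‖ ^ 2) *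
      ((tsupport u).indicator 1 x + (tsupport u).indicator 1 (x + v)) := by
  obtain ⟨L, hL⟩ := hu.lipschitzWith_of_hasCompactSupport hc (by simp)
  obtain ⟨M, hM⟩ := hu.continuous.bounded_above_of_compact_support hc
  have hM0 : 0 ≤ M := (norm_nonneg _).trans (hM 0)
  refine ⟨L ^ 2 + (2 * M) ^ 2, by positivity, fun x v => ?_⟩
  have h1 : (u x - u (x + v)) ^ 2 ≤ L ^ 2 * ‖v‖ ^ 2 := by
    have := hL.dist_le_mul x (x + v)
    rw [dist_eq_norm, dist_eq_norm, sub_add_cancel_left, norm_neg] at this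
    rw [← sq_abs, ← mul_pow]
    exact pow_le_pow_left₀ (abs_nonneg _) this 2
  have h2 : (u x - u (x + v)) ^ 2 ≤ (2 * M) ^ 2 := by
    rw [← sq_abs]
    refine pow_le_pow_left₀ (abs_nonneg _) ?_ 2
    have := norm_sub_le (u x) (u (x + v))
    rw [Real.norm_eq_abs] at this
    linarith [hM x, hM (x + v)]
  have h3 : (u x - u (x + v)) ^ 2 ≤ (L ^ 2 + (2 * M) ^ 2) * min 1 (‖v‖ ^ 2) := by
    rcases min_cases 1 (‖v‖ ^ 2) with h | h <;> rw [h.1] <;> nlinarith [sq_nonneg M, sq_nonneg (L:ℝ)]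
  by_cases hx : x ∈ tsupport u
  · refine h3.trans (le_mul_of_one_le_right (by positivity) ?_)
    simp only [indicator_of_mem hx, Pi.one_apply, le_add_iff_nonneg_right]
    exact indicator_nonneg (by simp) _
  by_cases hxv : x + v ∈ tsupport u
  · refine h3.trans (le_mul_of_one_le_right (by positivity) ?_)
    simp only [indicator_of_mem hxv, Pi.one_apply, le_add_iff_nonneg_left]
    exact indicator_nonneg (by simp) _
  · simp [hx, hxv, image_eq_zero_of_notMem_tsupport]

lemma update_add_apply (x : Fin N → Euc d) (i : Fin N) (h : Euc d) :
    Function.update x i (x i + h) = x + Pi.single i h := by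
  ext j
  rcases eq_or_ne j i with rfl | hj <;> simp [*]

lemma a_sd_pos (hd : 0 < d) {s : ℝ} (hs : s ∈ Ioo (0:ℝ) 1) : 0 < a_sd d s := by
  obtain ⟨hs0, hs1⟩ := hs
  have hd' : (0:ℝ) < d := by exact_mod_cast hd
  have h1 := Gamma_pos_of_pos (show 0 < ((d:ℝ) + 2*s)/2 by positivity)
  have h2 := Gamma_pos_of_pos (show 0 < 1 - s by linarith)
  unfold a_sd
  positivity

lemma lintegral_kineticDensity_lt_top (hd : 0 < d) {s : ℝ} (hs : s ∈ Ioo (0:ℝ) 1)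
    {u : (Fin N → Euc d) → ℝ} (hu : ContDiff ℝ ∞ u) (hc : HasCompactSupport u) (i : Fin N) :
    ∫⁻ x, kineticDensity s u i x < ⊤ := by
  have ha := a_sd_pos hd hs
  obtain ⟨B, hB0, hB⟩ := exists_sq_sub_add_le hu hc
  generalize hS : tsupport u = S at hB
  have hSm : MeasurableSet S := hS ▸ (isClosed_tsupport u).measurableSet
  have hSf : volume S < ⊤ := hS ▸ hc.isCompact.measure_lt_top
  have hSi : ∀ y, ENNReal.ofReal (S.indicator 1 y) = S.indicator 1 y := fun y => by
    by_cases hy : y ∈ S <;> simp [hy]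
  have hum : Measurable u := hu.continuous.measurable
  have hum2 : Measurable fun p : (Fin N → Euc d) × Euc d => u (p.1 + Pi.single i p.2) := by
    have hsingle : Continuous fun h : Euc d => (Pi.single i h : Fin N → Euc d) :=
      (continuous_const.update i continuous_id :
        Continuous fun h : Euc d => Function.update (0 : Fin N → Euc d) i h)
    exact (hu.continuous.comp
      (continuous_fst.add (hsingle.comp continuous_snd))).measurable
  have e : ∀ x, kineticDensity s u i x = ∫⁻ h : Euc d, ENNReal.ofReal (a_sd d s *
      ((u x - u (x + Pi.single i h)) ^ 2 * ‖h‖ ^ (-((d:ℝ) + 2*s)))) := by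
    intro x
    unfold kineticDensity
    rw [← lintegral_add_left_eq_self _ (x i)]
    refine lintegral_congr fun h => ?_
    rw [update_add_apply, sub_add_cancel_left, norm_neg, Real.rpow_neg (norm_nonneg _), div_eq_mul_inv]
  simp_rw [e]
  rw [lintegral_lintegral_swap]
  · calc _ ≤ ∫⁻ h : Euc d, ENNReal.ofReal (a_sd d s * B * 2) * volume S *
          ENNReal.ofReal (min 1 (‖h‖ ^ 2) * ‖h‖ ^ (-((d:ℝ) + 2*s))) := by
          refine lintegral_mono fun h => ?_
          set r : ℝ := min 1 (‖h‖ ^ 2) * ‖h‖ ^ (-((d:ℝ) + 2*s)) with hr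
          have hr0 : 0 ≤ r := by positivity
          set c : ℝ := a_sd d s * B * r with hcdef
          have hc0 : 0 ≤ c := by positivity
          calc _ ≤ ∫⁻ x : Fin N → Euc d, (ENNReal.ofReal c * S.indicator 1 x +
                ENNReal.ofReal c * S.indicator 1 (x + Pi.single i h)) := by
                refine lintegral_mono fun x => ?_
                have h1 := hB x (Pi.single i h)
                rw [Pi.norm_single] at h1
                have h2 : a_sd d s * ((u x - u (x + Pi.single i h)) ^ 2 *
                    ‖h‖ ^ (-((d:ℝ) + 2*s))) ≤
                    c * S.indicator 1 x + c * S.indicator 1 (x + Pi.single i h) := by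
                  have h3 : 0 ≤ a_sd d s * ‖h‖ ^ (-((d:ℝ) + 2*s)) := by positivity
                  have h4 := mul_le_mul_of_nonneg_left h1 h3
                  rw [hcdef, hr]
                  linarith
                refine (ENNReal.ofReal_le_ofReal h2).trans (ENNReal.ofReal_add_le.trans
                  (le_of_eq ?_))
                rw [ENNReal.ofReal_mul hc0, ENNReal.ofReal_mul hc0, hSi, hSi]
            _ = ENNReal.ofReal c * volume S + ENNReal.ofReal c * volume S := by
                have hm : Measurable (S.indicator (1 : (Fin N → Euc d) → ℝ≥0∞)) :=
                  measurable_one.indicator hSm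
                rw [lintegral_add_left (hm.const_mul _),
                  lintegral_const_mul' _ _ ENNReal.ofReal_ne_top,
                  lintegral_const_mul' _ _ ENNReal.ofReal_ne_top,
                  lintegral_add_right_eq_self (fun x => S.indicator 1 x) (Pi.single i h),
                  lintegral_indicator_one hSm]
            _ = _ := by
                rw [← add_mul, ← ENNReal.ofReal_add hc0 hc0, mul_right_comm _ (volume S),
                  ← ENNReal.ofReal_mul (by positivity), hcdef]
                congr 2
                ring
    _ < ⊤ := by
          rw [lintegral_const_mul' _ _ (ENNReal.mul_ne_top ENNReal.ofReal_ne_top hSf.ne)]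
          exact ENNReal.mul_lt_top (ENNReal.mul_lt_top ENNReal.ofReal_lt_top hSf)
            (lintegral_min_one_sq_mul_rpow_lt_top hd hs)
  · apply Measurable.aemeasurable
    have hf : Measurable fun p : (Fin N → Euc d) × Euc d => u p.1 := hum.comp measurable_fst
    exact ((((hf).sub hum2).pow_const 2).mul
      (measurable_snd.norm.pow_const _)).const_mul _ |>.ennreal_ofReal

lemma a_sd_mul_integral_eq_toReal (hd : 0 < d) {s : ℝ} (hs : s ∈ Ioo (0:ℝ) 1)
    {u : (Fin N → Euc d) → ℝ} (hu : ContDiff ℝ ∞ u) (hc : HasCompactSupport u) (i : Fin N) :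
    a_sd d s * ∫ x : Fin N → Euc d, ∫ z : Euc d,
      (u x - u (Function.update x i z)) ^ 2 / ‖x i - z‖ ^ ((d:ℝ) + 2*s) =
      (∫⁻ x, kineticDensity s u i x).toReal := by
  have ha := a_sd_pos hd hs
  have hm := measurable_kineticDensity_integrand s hu.continuous.measurable i
  rw [← integral_toReal (measurable_kineticDensity s hu.continuous.measurable i).aemeasurable
    (ae_lt_top (measurable_kineticDensity s hu.continuous.measurable i)
      (lintegral_kineticDensity_lt_top hd hs hu hc i).ne), ← integral_const_mul]
  refine integral_congr_ae (ae_of_all _ fun x => ?_)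
  simp only
  rw [← integral_const_mul, integral_eq_lintegral_of_nonneg_ae]
  · rfl
  · exact ae_of_all _ fun z => by positivity
  · exact (hm.comp measurable_prodMk_left).aestronglyMeasurable

end Particles

section Triples

open Set ENNReal
open scoped ContDiff

variable {d N : ℕ}

lemma V3_eq_twoPole (s : ℝ) (x₁ x₂ x₃ : Euc d) :
    V3 s x₁ x₂ x₃ = twoPole s x₂ x₃ x₁ + twoPole s x₁ x₃ x₂ + twoPole s x₁ x₂ x₃ := by
  unfold V3 twoPole
  rw [norm_sub_rev x₃ x₂, norm_sub_rev x₃ x₁, norm_sub_rev x₂ x₁]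
  ring

/-- Summing over ordered triples counts each particle `(N - 1)(N - 2) / 2` times. -/
lemma sum_ordered_triples (T : Fin N → ℝ) :
    ∑ i : Fin N, ∑ j : Fin N, ∑ k : Fin N, (if i < j ∧ j < k then T i + T j + T k else 0) =
      ((N:ℝ) - 1) * ((N:ℝ) - 2) / 2 * ∑ i, T i := by
  set A : Fin N → Fin N → Fin N → ℝ := fun i j k => if i < j ∧ j < k then 1 else 0 with hA
  have e1 : ∑ i, ∑ j, ∑ k, (if i < j ∧ j < k then T i + T j + T k else 0) =
      ∑ i, ∑ j, ∑ k, (A i j k + A j i k + A j k i) * T i := by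
    have h2 : ∑ i, ∑ j, ∑ k, A j i k * T i = ∑ i, ∑ j, ∑ k, A i j k * T j := Finset.sum_comm
    have h3 : ∑ i, ∑ j, ∑ k, A j k i * T i = ∑ i, ∑ j, ∑ k, A i j k * T k := by
      rw [Finset.sum_comm]
      exact Finset.sum_congr rfl fun _ _ => Finset.sum_comm
    simp only [add_mul, Finset.sum_add_distrib, h2, h3]
    simp only [← Finset.sum_add_distrib]
    refine Finset.sum_congr rfl fun i _ => Finset.sum_congr rfl fun j _ =>
      Finset.sum_congr rfl fun k _ => ?_
    simp only [hA]
    split_ifs <;> ring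
  have e2 : ∀ i, ∑ j, ∑ k, (A i j k + A j i k + A j k i) =
      ((N:ℝ) - 1) * ((N:ℝ) - 2) / 2 := by
    intro i
    have h1 : 2 * ∑ j, ∑ k, (A i j k + A j i k + A j k i) =
        ∑ j, ∑ k, if j ≠ i then (1 - (if k = i then 1 else 0) - (if k = j then 1 else 0) : ℝ)
          else 0 := by
      rw [two_mul]
      nth_rw 2 [Finset.sum_comm]
      simp only [← Finset.sum_add_distrib]
      refine Finset.sum_congr rfl fun j _ => Finset.sum_congr rfl fun k _ => ?_
      simp only [hA]
      have asymm : ∀ a b : Fin N, ¬(a < b ∧ b < a) := fun a b h => h.1.asymm h.2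
      rcases eq_or_ne j i with rfl | hji
      · simpa using fun h : j < k => h.le
      rcases eq_or_ne k i with rfl | hki
      · simp [asymm, hji, hji.symm]
      rcases eq_or_ne k j with rfl | hkj
      · simp [asymm, hki]
      simp only [ne_eq, hji, hki, hkj, not_false_eq_true, if_true, if_false]
      rcases hji.lt_or_gt with h | h <;> rcases hki.lt_or_gt with h' | h' <;>
        rcases hkj.lt_or_gt with h'' | h'' <;>
        first
        | (exfalso; omega)
        | simp [h, h', h'', h.not_gt, h'.not_gt, h''.not_gt]
    have h2 : ∀ j, (∑ k, if j ≠ i then (1 - (if k = i then 1 else 0) -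
        (if k = j then 1 else 0) : ℝ) else 0) = ((N:ℝ) - 2) * (1 - if j = i then 1 else 0) := by
      intro j
      by_cases h : j = i
      · simp [h]
      · simp [h, Finset.sum_sub_distrib]
        ring
    simp only [h2, ← Finset.mul_sum, Finset.sum_sub_distrib] at h1
    simp at h1
    linarith
  rw [e1, Finset.mul_sum]
  refine Finset.sum_congr rfl fun i _ => ?_
  simp only [← Finset.sum_mul, e2]

lemma integrable_twoPole_mul_sq_and_le (hd : 0 < d) {s : ℝ} (hs : s ∈ Ioo (0:ℝ) 1)
    (hds : 2*s < d) {u : (Fin N → Euc d) → ℝ} (hu : ContDiff ℝ ∞ u) (hc : HasCompactSupport u)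
    (hoff : tsupport u ⊆ {x | ∀ i j, i ≠ j → x i ≠ x j}) {i j k : Fin N} (hij : i ≠ j)
    (hik : i ≠ k) :
    Integrable (fun x => twoPole s (x j) (x k) (x i) * u x ^ 2) ∧
    C_fH d s * ∫ x, twoPole s (x j) (x k) (x i) * u x ^ 2 ≤
      (∫⁻ x, kineticDensity s u i x).toReal := by
  have hC := C_fH_pos hs.1 hds
  have hle := lintegral_twoPole_le_kineticDensity hs hds hu hc hoff hij hik
  have hfin := lintegral_kineticDensity_lt_top hd hs hu hc i
  have hum : Measurable u := hu.continuous.measurable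
  have hm : AEStronglyMeasurable
      (fun x => C_fH d s * (twoPole s (x j) (x k) (x i) * u x ^ 2)) volume := by
    apply Measurable.aestronglyMeasurable
    unfold twoPole
    fun_prop
  have h0 : ∀ x, 0 ≤ C_fH d s * (twoPole s (x j) (x k) (x i) * u x ^ 2) := fun x =>
    mul_nonneg hC.le (mul_nonneg (twoPole_nonneg s _ _ _) (sq_nonneg _))
  constructor
  · have hI : Integrable (fun x => C_fH d s * (twoPole s (x j) (x k) (x i) * u x ^ 2)) :=
      ⟨hm, (hasFiniteIntegral_iff_ofReal (ae_of_all _ h0)).2 (hle.trans_lt hfin)⟩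
    exact (integrable_const_mul_iff hC.ne'.isUnit _).1 hI
  · rw [← integral_const_mul, integral_eq_lintegral_of_nonneg_ae (ae_of_all _ h0) hm]
    exact ENNReal.toReal_mono hfin.ne hle

end Triples

/-- **Corollary 1.3** (many-particle fractional Hardy inequality with the
three-body potential). -/
theorem many_particle_fractional_Hardy
    (d : ℕ) (hd : 0 < d) (s : ℝ) (hs : s ∈ Set.Ioo (0:ℝ) 1)
    (hds : (4:ℝ) - 2*s ≤ (d:ℝ)) (N : ℕ) (hN : 3 ≤ N)
    (u : (Fin N → Euc d) → ℝ)
    (hu_smooth : ContDiff ℝ (⊤ : ℕ∞) u) (hu_supp : HasCompactSupport u)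
    (hu_off : tsupport u ⊆ {x : Fin N → Euc d | ∀ i j, i ≠ j → x i ≠ x j}) :
    2 * C_fH d s / (((N:ℝ) - 1) * ((N:ℝ) - 2)) *
      ∫ x : Fin N → Euc d,
        (∑ i : Fin N, ∑ j : Fin N, ∑ k : Fin N,
          if i < j ∧ j < k then V3 s (x i) (x j) (x k) else 0) * (u x)^2
      ≤ kinetic d N s u := by
  have hds' : 2*s < d := by linarith [hs.2]
  set T : Fin N → ℝ := fun i => (∫⁻ x, kineticDensity s u i x).toReal with hT
  have hkin : kinetic d N s u = ∑ i, T i :=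
    Finset.sum_congr rfl fun i _ => a_sd_mul_integral_eq_toReal hd hs hu_smooth hu_supp i
  have key : ∀ i j k : Fin N,
      Integrable (fun x : Fin N → Euc d =>
        (if i < j ∧ j < k then V3 s (x i) (x j) (x k) else 0) * u x ^ 2) ∧
      C_fH d s * ∫ x : Fin N → Euc d,
        (if i < j ∧ j < k then V3 s (x i) (x j) (x k) else 0) * u x ^ 2 ≤
        if i < j ∧ j < k then T i + T j + T k else 0 := by
    intro i j k
    split_ifs with h
    · have hik := (h.1.trans h.2).ne
      have p1 := integrable_twoPole_mul_sq_and_le hd hs hds' hu_smooth hu_supp hu_off h.1.ne hik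
      have p2 := integrable_twoPole_mul_sq_and_le hd hs hds' hu_smooth hu_supp hu_off
        h.1.ne' h.2.ne
      have p3 := integrable_twoPole_mul_sq_and_le hd hs hds' hu_smooth hu_supp hu_off
        hik.symm h.2.ne'
      simp only [V3_eq_twoPole, add_mul]
      refine ⟨(p1.1.add p2.1).add p3.1, ?_⟩
      rw [integral_add (by exact p1.1.add p2.1) p3.1, integral_add p1.1 p2.1]
      linarith [p1.2, p2.2, p3.2]
    · simp
  have hint : C_fH d s * ∫ x : Fin N → Euc d,
        (∑ i : Fin N, ∑ j : Fin N, ∑ k : Fin N,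
          if i < j ∧ j < k then V3 s (x i) (x j) (x k) else 0) * (u x)^2 ≤
      ((N:ℝ) - 1) * ((N:ℝ) - 2) / 2 * ∑ i, T i := by
    rw [← sum_ordered_triples]
    simp only [Finset.sum_mul]
    rw [integral_finsetSum _ fun i _ => integrable_finsetSum _ fun j _ =>
      integrable_finsetSum _ fun k _ => (key i j k).1, Finset.mul_sum]
    refine Finset.sum_le_sum fun i _ => ?_
    rw [integral_finsetSum _ fun j _ =>
      integrable_finsetSum _ fun k _ => (key i j k).1, Finset.mul_sum]
    refine Finset.sum_le_sum fun j _ => ?_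
    rw [integral_finsetSum _ fun k _ => (key i j k).1, Finset.mul_sum]
    exact Finset.sum_le_sum fun k _ => (key i j k).2
  have hN' : (3:ℝ) ≤ N := by exact_mod_cast hN
  have hpos : 0 < ((N:ℝ) - 1) * ((N:ℝ) - 2) := mul_pos (by linarith) (by linarith)
  rw [hkin, div_mul_eq_mul_div, div_le_iff₀ hpos]
  linarith
end
end

section
/- Let s ∈ (0,1) and let a, b, c be positive real numbers. Then c^{2s}/(a^{2s}·b^{2s}) + b^{2s}/(a^{2s}·c^{2s}) + a^{2s}/(b^{2s}·c^{2s}) = 1/a^{2s} + 1/b^{2s} + 1/c^{2s} + ((a^{2s}−b^{2s})² + (b^{2s}−c^{2s})² + (c^{2s}−a^{2s})²)/(2·a^{2s}·b^{2s}·c^{2s}). Consequently, for pairwise distinct x₁,x₂,x₃ ∈ ℝ^d, V_{s,3}(x₁,x₂,x₃) = Σ_{1≤i<j≤3} 1/|x_i−x_j|^{2s} + R_s(x₁,x₂,x₃), where R_s ≥ 0 vanishes exactly at equilateral configurations. -/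
open MeasureTheory Real

noncomputable section

/-- The non-negative defect term `R_s(x₁,x₂,x₃)`. -/
def Rdef {d : ℕ} (s : ℝ) (x₁ x₂ x₃ : Euc d) : ℝ :=
  ((‖x₁ - x₂‖^(2*s) - ‖x₁ - x₃‖^(2*s))^2 + (‖x₁ - x₃‖^(2*s) - ‖x₂ - x₃‖^(2*s))^2
      + (‖x₂ - x₃‖^(2*s) - ‖x₁ - x₂‖^(2*s))^2)
    / (2 * ‖x₁ - x₂‖^(2*s) * ‖x₁ - x₃‖^(2*s) * ‖x₂ - x₃‖^(2*s))

theorem div_sum_eq_inv_sum_add_defect {A B C : ℝ} (hA : A ≠ 0) (hB : B ≠ 0) (hC : C ≠ 0) :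
    C / (A * B) + B / (A * C) + A / (B * C)
      = 1 / A + 1 / B + 1 / C
        + ((A - B) ^ 2 + (B - C) ^ 2 + (C - A) ^ 2) / (2 * A * B * C) := by
  field_simp
  ring

theorem defect_eq_zero_iff {A B C : ℝ} (hA : 0 < A) (hB : 0 < B) (hC : 0 < C) :
    ((A - B) ^ 2 + (B - C) ^ 2 + (C - A) ^ 2) / (2 * A * B * C) = 0 ↔ A = B ∧ B = C := by
  rw [div_eq_zero_iff, or_iff_left (by positivity)]
  constructor
  · intro h
    constructor <;> nlinarith [sq_nonneg (A - B), sq_nonneg (B - C), sq_nonneg (C - A)]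
  · rintro ⟨rfl, rfl⟩
    simp

/-- The algebraic defect identity and the resulting pointwise decomposition
`V_{s,3} = pairwise Coulomb potential + R_s`, with `R_s ≥ 0` vanishing exactly at
equilateral configurations. -/
theorem V3_defect_decomposition (s : ℝ) (hs : s ∈ Set.Ioo (0:ℝ) 1) :
    (∀ a b c : ℝ, 0 < a → 0 < b → 0 < c →
      c^(2*s)/(a^(2*s)*b^(2*s)) + b^(2*s)/(a^(2*s)*c^(2*s)) + a^(2*s)/(b^(2*s)*c^(2*s))
        = 1/a^(2*s) + 1/b^(2*s) + 1/c^(2*s)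
          + ((a^(2*s) - b^(2*s))^2 + (b^(2*s) - c^(2*s))^2 + (c^(2*s) - a^(2*s))^2)
            / (2*a^(2*s)*b^(2*s)*c^(2*s))) ∧
    (∀ (d : ℕ) (x₁ x₂ x₃ : Euc d), x₁ ≠ x₂ → x₁ ≠ x₃ → x₂ ≠ x₃ →
      V3 s x₁ x₂ x₃
          = 1/‖x₁ - x₂‖^(2*s) + 1/‖x₁ - x₃‖^(2*s) + 1/‖x₂ - x₃‖^(2*s)
            + Rdef s x₁ x₂ x₃ ∧
        0 ≤ Rdef s x₁ x₂ x₃ ∧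
        (Rdef s x₁ x₂ x₃ = 0 ↔ ‖x₁ - x₂‖ = ‖x₁ - x₃‖ ∧ ‖x₁ - x₃‖ = ‖x₂ - x₃‖)) := by
  have hs0 : 2 * s ≠ 0 := by linarith [hs.1]
  refine ⟨fun a b c ha hb hc => div_sum_eq_inv_sum_add_defect (rpow_pos_of_pos ha _).ne'
    (rpow_pos_of_pos hb _).ne' (rpow_pos_of_pos hc _).ne', fun d x₁ x₂ x₃ h₁₂ h₁₃ h₂₃ => ?_⟩
  have pos {x y : Euc d} (h : x ≠ y) : 0 < ‖x - y‖ ^ (2 * s) :=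
    rpow_pos_of_pos (norm_pos_iff.2 (sub_ne_zero.2 h)) _
  have hA := pos h₁₂
  have hB := pos h₁₃
  have hC := pos h₂₃
  refine ⟨?_, ?_, ?_⟩
  · rw [V3, Rdef, norm_sub_rev x₃ x₂, norm_sub_rev x₃ x₁, norm_sub_rev x₂ x₁,
      ← div_sum_eq_inv_sum_add_defect hA.ne' hB.ne' hC.ne']
    ring
  · unfold Rdef
    positivity
  · rw [Rdef, defect_eq_zero_iff hA hB hC,
      rpow_left_inj (norm_nonneg _) (norm_nonneg _) hs0,
      rpow_left_inj (norm_nonneg _) (norm_nonneg _) hs0]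
end
end

section
/- Let d ≥ 2 be an integer, s ∈ (0,1], and let x₁, x₂, x₃ ∈ ℝ^d be pairwise distinct. Then Σ_{1≤i<j≤3} 1/|x_i−x_j|^{2s} ≥ 3^{1−s} · (2·P(x₁,x₂,x₃))^s, with equality if and only if |x₁−x₂| = |x₁−x₃| = |x₂−x₃|. -/
open MeasureTheory Real
open scoped RealInnerProductSpace

noncomputable section

/-- The cyclic sum `P(x₁,x₂,x₃) = Σ_cyc ((x_k−x_i)·(x_j−x_i))/(|x_k−x_i|²|x_j−x_i|²)`,
which equals `1/(2R²)` for non-collinear triples with circumradius `R`. -/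
def Pcirc {d : ℕ} (x₁ x₂ x₃ : Euc d) : ℝ :=
    ⟪x₃ - x₁, x₂ - x₁⟫ / (‖x₃ - x₁‖^2 * ‖x₂ - x₁‖^2)
  + ⟪x₁ - x₂, x₃ - x₂⟫ / (‖x₁ - x₂‖^2 * ‖x₃ - x₂‖^2)
  + ⟪x₂ - x₃, x₁ - x₃⟫ / (‖x₂ - x₃‖^2 * ‖x₁ - x₃‖^2)

/-- Sixteen times the squared area of a triangle with squared side lengths `A`, `B`, `C`. -/
def heron (A B C : ℝ) : ℝ := 2 * (A * B + B * C + C * A) - (A ^ 2 + B ^ 2 + C ^ 2)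

/-- Schur's inequality of degree one, for the squared side lengths of a triangle. -/
lemma add_mul_heron_le {A B C : ℝ} (hA : 0 ≤ A) (hB : 0 ≤ B) (hC : 0 ≤ C) :
    (A + B + C) * heron A B C ≤ 9 * (A * B * C) := by
  unfold heron
  rcases le_total A B with h1 | h1 <;> rcases le_total B C with h2 | h2 <;>
    rcases le_total A C with h3 | h3 <;>
    nlinarith [mul_nonneg (sub_nonneg.2 h1) (sub_nonneg.2 h2),
      mul_nonneg (sub_nonneg.2 h1) (sub_nonneg.2 h3),
      mul_nonneg (sub_nonneg.2 h2) (sub_nonneg.2 h3),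
      mul_nonneg hA (mul_nonneg (sub_nonneg.2 h1) (sub_nonneg.2 h3)),
      mul_nonneg hB (mul_nonneg (sub_nonneg.2 h1) (sub_nonneg.2 h2)),
      mul_nonneg hC (mul_nonneg (sub_nonneg.2 h2) (sub_nonneg.2 h3)),
      mul_nonneg (add_nonneg hA hB) (sq_nonneg (A - B)),
      mul_nonneg (add_nonneg hB hC) (sq_nonneg (B - C)),
      mul_nonneg (add_nonneg hA hC) (sq_nonneg (A - C)),
      mul_nonneg hA (sq_nonneg (B - C)), mul_nonneg hB (sq_nonneg (A - C)),
      mul_nonneg hC (sq_nonneg (A - B)),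
      mul_nonneg (sub_nonneg.2 h1) (sq_nonneg (A - B)),
      mul_nonneg (sub_nonneg.2 h2) (sq_nonneg (B - C)),
      mul_nonneg (sub_nonneg.2 h3) (sq_nonneg (A - C))]

lemma heron_sq_mul_le {A B C : ℝ} (hA : 0 ≤ A) (hB : 0 ≤ B) (hC : 0 ≤ C)
    (hN : 0 ≤ heron A B C) :
    heron A B C ^ 2 * (3 * heron A B C + 2 * ((A - B) ^ 2 + (B - C) ^ 2 + (C - A) ^ 2))
      ≤ 81 * (A * B * C) ^ 2 := by
  have h := pow_le_pow_left₀ (by positivity) (add_mul_heron_le hA hB hC) 2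
  calc _ = ((A + B + C) * heron A B C) ^ 2 := by unfold heron; ring
    _ ≤ (9 * (A * B * C)) ^ 2 := h
    _ = _ := by ring

lemma heron_pow_three_le {A B C : ℝ} (hA : 0 ≤ A) (hB : 0 ≤ B) (hC : 0 ≤ C)
    (hN : 0 ≤ heron A B C) : heron A B C ^ 3 ≤ 27 * (A * B * C) ^ 2 := by
  have h : 0 ≤ heron A B C ^ 2 * ((A - B) ^ 2 + (B - C) ^ 2 + (C - A) ^ 2) := by positivity
  linarith [heron_sq_mul_le hA hB hC hN]

lemma eq_and_eq_of_heron_pow_three_eq {A B C : ℝ} (hA : 0 < A) (hB : 0 < B) (hC : 0 < C)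
    (hN : 0 ≤ heron A B C) (h : heron A B C ^ 3 = 27 * (A * B * C) ^ 2) : A = B ∧ B = C := by
  have hpos : 0 < heron A B C := by
    refine hN.lt_of_ne fun h0 => ?_
    rw [← h0] at h
    have : 0 < (A * B * C) ^ 2 := by positivity
    linarith
  have hle : heron A B C ^ 2 * ((A - B) ^ 2 + (B - C) ^ 2 + (C - A) ^ 2) ≤ 0 := by
    linarith [heron_sq_mul_le hA.le hB.le hC.le hN]
  have hsum := nonpos_of_mul_nonpos_right hle (by positivity)
  constructor <;> nlinarith [sq_nonneg (A - B), sq_nonneg (B - C), sq_nonneg (C - A)]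

/-- The inequality between the arithmetic and geometric means of three numbers, cubed. -/
lemma mul_le_add_pow_three {p q r : ℝ} (hp : 0 ≤ p) (hq : 0 ≤ q) (hr : 0 ≤ r) :
    27 * (p * q * r) ≤ (p + q + r) ^ 3 := by
  nlinarith [mul_nonneg hp (sq_nonneg (q - r)), mul_nonneg hq (sq_nonneg (p - r)),
    mul_nonneg hr (sq_nonneg (p - q)), mul_nonneg hp (sq_nonneg (p - q)),
    mul_nonneg hp (sq_nonneg (p - r)), mul_nonneg hq (sq_nonneg (p - q)),
    mul_nonneg hq (sq_nonneg (q - r)), mul_nonneg hr (sq_nonneg (p - r)),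
    mul_nonneg hr (sq_nonneg (q - r))]

lemma rpow_one_sub_mul_rpow {x s : ℝ} (hx : 0 ≤ x) :
    (3 : ℝ) ^ (1 - s) * x ^ s = 3 * (x / 3) ^ s := by
  rw [Real.div_rpow hx (by norm_num), Real.rpow_sub (by norm_num), Real.rpow_one]
  ring

section SquaredSides

variable {A B C s : ℝ}

lemma rpow_pow_three_le (hs : 0 < s) (hA : 0 < A) (hB : 0 < B) (hC : 0 < C)
    (hN : 0 ≤ heron A B C) :
    ((heron A B C / (A * B * C) / 3) ^ s) ^ 3 ≤ 1 / A ^ s * (1 / B ^ s) * (1 / C ^ s) ∧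
      (((heron A B C / (A * B * C) / 3) ^ s) ^ 3 = 1 / A ^ s * (1 / B ^ s) * (1 / C ^ s) →
        A = B ∧ B = C) := by
  have hE : 0 < A * B * C := by positivity
  have hX : 0 ≤ heron A B C / (A * B * C) / 3 := by positivity
  have hl : ((heron A B C / (A * B * C) / 3) ^ s) ^ 3
      = ((heron A B C / (A * B * C) / 3) ^ 3) ^ s := Real.rpow_pow_comm hX s 3
  have hr : 1 / A ^ s * (1 / B ^ s) * (1 / C ^ s) = (1 / (A * B * C)) ^ s := by
    rw [Real.div_rpow zero_le_one hE.le, Real.one_rpow, Real.mul_rpow (by positivity) hC.le,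
      Real.mul_rpow hA.le hB.le]
    field_simp
  have hdiv : (heron A B C / (A * B * C) / 3) ^ 3
      = heron A B C ^ 3 / (27 * (A * B * C) ^ 2) * (1 / (A * B * C)) := by
    field_simp
    norm_num
  rw [hl, hr]
  constructor
  · refine Real.rpow_le_rpow (by positivity) ?_ hs.le
    rw [hdiv]
    refine mul_le_of_le_one_left (by positivity) ?_
    exact (div_le_one (by positivity)).2 (heron_pow_three_le hA.le hB.le hC.le hN)
  · intro h
    have h' := (Real.rpow_left_inj (by positivity) (by positivity) hs.ne').1 h
    rw [hdiv, mul_eq_right₀ (by positivity), div_eq_one_iff_eq (by positivity)] at h'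
    exact eq_and_eq_of_heron_pow_three_eq hA hB hC hN h'

lemma heron_rpow_le_sum (hs : 0 < s) (hA : 0 < A) (hB : 0 < B) (hC : 0 < C)
    (hN : 0 ≤ heron A B C) :
    (3 : ℝ) ^ (1 - s) * (heron A B C / (A * B * C)) ^ s
        ≤ 1 / A ^ s + 1 / B ^ s + 1 / C ^ s ∧
      (1 / A ^ s + 1 / B ^ s + 1 / C ^ s
          = (3 : ℝ) ^ (1 - s) * (heron A B C / (A * B * C)) ^ s ↔ A = B ∧ B = C) := by
  rw [rpow_one_sub_mul_rpow (by positivity)]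
  obtain ⟨hle, heq⟩ := rpow_pow_three_le hs hA hB hC hN
  have hamgm := mul_le_add_pow_three (p := 1 / A ^ s) (q := 1 / B ^ s) (r := 1 / C ^ s)
    (by positivity) (by positivity) (by positivity)
  refine ⟨?_, fun h => ?_, ?_⟩
  · refine le_of_pow_le_pow_left₀ three_ne_zero (by positivity) ?_
    rw [mul_pow]
    linarith
  · refine heq (le_antisymm hle ?_)
    rw [h, mul_pow] at hamgm
    linarith
  · rintro ⟨rfl, rfl⟩
    have : heron A A A / (A * A * A) / 3 = 1 / A := by
      unfold heron
      field_simp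
      norm_num
    rw [this, Real.div_rpow zero_le_one hA.le, Real.one_rpow]
    ring

end SquaredSides

lemma inner_sub_sub_eq {E : Type*} [NormedAddCommGroup E] [InnerProductSpace ℝ E] (x y z : E) :
    ⟪z - x, y - x⟫ = (‖x - z‖ ^ 2 + ‖x - y‖ ^ 2 - ‖y - z‖ ^ 2) / 2 := by
  have h := norm_sub_sq_real (z - x) (y - x)
  rw [sub_sub_sub_cancel_right, norm_sub_rev z y, norm_sub_rev z x, norm_sub_rev y x] at h
  linarith

lemma heron_nonneg {E : Type*} [NormedAddCommGroup E] [InnerProductSpace ℝ E] (x y z : E) :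
    0 ≤ heron (‖x - y‖ ^ 2) (‖x - z‖ ^ 2) (‖y - z‖ ^ 2) := by
  have h := real_inner_mul_inner_self_le (z - x) (y - x)
  rw [real_inner_self_eq_norm_sq, real_inner_self_eq_norm_sq, inner_sub_sub_eq,
    norm_sub_rev z x, norm_sub_rev y x] at h
  unfold heron
  linarith

lemma two_mul_Pcirc {d : ℕ} {x₁ x₂ x₃ : Euc d} (h12 : x₁ ≠ x₂) (h13 : x₁ ≠ x₃) (h23 : x₂ ≠ x₃) :
    2 * Pcirc x₁ x₂ x₃ = heron (‖x₁ - x₂‖ ^ 2) (‖x₁ - x₃‖ ^ 2) (‖x₂ - x₃‖ ^ 2)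
      / (‖x₁ - x₂‖ ^ 2 * ‖x₁ - x₃‖ ^ 2 * ‖x₂ - x₃‖ ^ 2) := by
  have h1 := norm_sub_pos_iff.2 h12
  have h2 := norm_sub_pos_iff.2 h13
  have h3 := norm_sub_pos_iff.2 h23
  unfold Pcirc heron
  rw [inner_sub_sub_eq x₁ x₂ x₃, inner_sub_sub_eq x₂ x₃ x₁, inner_sub_sub_eq x₃ x₁ x₂,
    norm_sub_rev x₃ x₁, norm_sub_rev x₂ x₁, norm_sub_rev x₃ x₂]
  field_simp
  ring

/-- The geometric inequality `Σ_{i<j} 1/|x_i−x_j|^{2s} ≥ 3^{1−s}·(2P)^s = 3^{1−s}/R^{2s}`,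
with equality exactly at equilateral configurations. -/
theorem pairwise_Coulomb_vs_circumradius
    (d : ℕ) (hd : 2 ≤ d) (s : ℝ) (hs : s ∈ Set.Ioc (0:ℝ) 1)
    (x₁ x₂ x₃ : Euc d) (h12 : x₁ ≠ x₂) (h13 : x₁ ≠ x₃) (h23 : x₂ ≠ x₃) :
    (3:ℝ)^(1-s) * (2 * Pcirc x₁ x₂ x₃)^s
        ≤ 1/‖x₁ - x₂‖^(2*s) + 1/‖x₁ - x₃‖^(2*s) + 1/‖x₂ - x₃‖^(2*s) ∧
      (1/‖x₁ - x₂‖^(2*s) + 1/‖x₁ - x₃‖^(2*s) + 1/‖x₂ - x₃‖^(2*s)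
          = (3:ℝ)^(1-s) * (2 * Pcirc x₁ x₂ x₃)^s
        ↔ ‖x₁ - x₂‖ = ‖x₁ - x₃‖ ∧ ‖x₁ - x₃‖ = ‖x₂ - x₃‖) := by
  have h1 := norm_sub_pos_iff.2 h12
  have h2 := norm_sub_pos_iff.2 h13
  have h3 := norm_sub_pos_iff.2 h23
  have hpow (x : Euc d) : ‖x‖ ^ (2 * s) = (‖x‖ ^ 2) ^ s := by
    rw [Real.rpow_mul (norm_nonneg x), Real.rpow_two]
  rw [two_mul_Pcirc h12 h13 h23, hpow, hpow, hpow,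
    ← pow_left_inj₀ h1.le h2.le two_ne_zero, ← pow_left_inj₀ h2.le h3.le two_ne_zero]
  exact heron_rpow_le_sum hs.1 (by positivity) (by positivity) (by positivity)
    (heron_nonneg x₁ x₂ x₃)
end
end

section
/- Let d be a positive integer and s ∈ (0,1) with d ≥ 4 − 2s. Then for every real-valued u ∈ C_c^∞(Ω^{(3)}) one has T_s[u] ≥ 3^{1−s}·C_{fH}(d,s) · ∫_{ℝ^{3d}} (2·P(x₁,x₂,x₃))^s · u(x₁,x₂,x₃)² dx₁dx₂dx₃; in geometric terms the integrand weight equals u²/R_{123}^{2s}, where R_{123} is the circumradius of the triangle with vertices x₁, x₂, x₃. -/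
open MeasureTheory Real
open scoped RealInnerProductSpace

noncomputable section

open scoped ENNReal

/-- The heat kernel on `ℝ^d`. -/
def heatKernel (d : ℕ) (t : ℝ) (x : Euc d) : ℝ :=
  (4 * π * t) ^ (-(d:ℝ)/2) * Real.exp (-‖x‖^2 / (4*t))

lemma heatKernel_nonneg {d : ℕ} {t : ℝ} (ht : 0 ≤ t) (x : Euc d) : 0 ≤ heatKernel d t x := by
  unfold heatKernel; positivity

lemma heatKernel_sub_comm {d : ℕ} (t : ℝ) (x y : Euc d) :
    heatKernel d t (x - y) = heatKernel d t (y - x) := by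
  simp only [heatKernel, norm_sub_rev x y]

lemma lintegral_exp_neg_mul_norm_sq {d : ℕ} {b : ℝ} (hb : 0 < b) :
    ∫⁻ x : Euc d, ENNReal.ofReal (Real.exp (-b * ‖x‖^2)) = ENNReal.ofReal ((π / b) ^ ((d:ℝ)/2)) := by
  have h := GaussianFourier.integral_rexp_neg_mul_sq_norm (V := Euc d) hb
  have hpos : 0 < (π / b) ^ ((d:ℝ)/2) := by positivity
  rw [finrank_euclideanSpace_fin] at h
  rw [← ofReal_integral_eq_lintegral_ofReal, h]
  · by_contra hn
    rw [integral_undef hn] at h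
    exact hpos.ne h
  · exact .of_forall fun x => by positivity

lemma lintegral_heatKernel {d : ℕ} {t : ℝ} (ht : 0 < t) :
    ∫⁻ x : Euc d, ENNReal.ofReal (heatKernel d t x) = 1 := by
  have h := lintegral_exp_neg_mul_norm_sq (d := d) (b := 1 / (4*t)) (by positivity)
  have h0 : (0:ℝ) ≤ (4 * π * t) ^ (-(d:ℝ)/2) := by positivity
  simp only [heatKernel, ENNReal.ofReal_mul h0]
  rw [lintegral_const_mul _ (by fun_prop)]
  have : ∀ x : Euc d, -‖x‖^2 / (4*t) = -(1/(4*t)) * ‖x‖^2 := fun x => by ring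
  simp_rw [this, h]
  rw [← ENNReal.ofReal_mul h0, ← ENNReal.ofReal_one]
  congr 1
  rw [show π / (1/(4*t)) = 4 * π * t by field_simp, ← Real.rpow_add (by positivity)]
  rw [neg_div, neg_add_cancel, Real.rpow_zero]

lemma lintegral_heatKernel_mul_heatKernel {d : ℕ} {t τ : ℝ} (ht : 0 < t) (hτ : 0 < τ)
    (x : Euc d) :
    ∫⁻ z : Euc d, ENNReal.ofReal (heatKernel d t (x - z)) * ENNReal.ofReal (heatKernel d τ z) =
      ENNReal.ofReal (heatKernel d (t + τ) x) := by
  have hr : 0 < t * τ / (t + τ) := by positivity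
  have key : ∀ z : Euc d, ENNReal.ofReal (heatKernel d t (x - z)) *
      ENNReal.ofReal (heatKernel d τ z) = ENNReal.ofReal (heatKernel d (t + τ) x) *
        ENNReal.ofReal (heatKernel d (t * τ / (t + τ)) (z - (τ / (t + τ)) • x)) := by
    intro z
    rw [← ENNReal.ofReal_mul (heatKernel_nonneg ht.le _),
      ← ENNReal.ofReal_mul (heatKernel_nonneg (by positivity) _)]
    congr 1
    unfold heatKernel
    rw [mul_mul_mul_comm _ (Real.exp (-‖x - z‖^2 / (4*t))),
      mul_mul_mul_comm _ (Real.exp (-‖x‖^2 / (4*(t + τ)))), ← Real.exp_add, ← Real.exp_add,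
      ← Real.mul_rpow (by positivity) (by positivity),
      ← Real.mul_rpow (by positivity) (by positivity)]
    congr 2
    · field_simp
    · rw [norm_sub_sq_real, norm_sub_sq_real, norm_smul, inner_smul_right, real_inner_comm z x,
        mul_pow, Real.norm_eq_abs, sq_abs]
      field_simp
      ring
  simp_rw [key]
  rw [lintegral_const_mul _ (by unfold heatKernel; fun_prop),
    lintegral_sub_right_eq_self (fun z => ENNReal.ofReal (heatKernel d (t * τ / (t + τ)) z)),
    lintegral_heatKernel hr, mul_one]

lemma lintegral_rpow_mul_exp_neg_div {q c : ℝ} (hq : 0 < q) (hc : 0 < c) :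
    ∫⁻ t in Set.Ioi (0:ℝ), ENNReal.ofReal (t ^ (-1 - q) * Real.exp (-c / t)) =
      ENNReal.ofReal (c ^ (-q) * Real.Gamma q) := by
  have h := integral_comp_rpow_Ioi (fun y : ℝ => y ^ (q - 1) * Real.exp (-(c * y)))
    (p := -1) (by norm_num)
  rw [Real.integral_rpow_mul_exp_neg_mul_Ioi hq hc] at h
  have h2 : ∫ t in Set.Ioi (0:ℝ), t ^ (-1 - q) * Real.exp (-c / t) =
      c ^ (-q) * Real.Gamma q := by
    rw [one_div, Real.inv_rpow hc.le, ← Real.rpow_neg hc.le] at h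
    rw [← h]
    refine setIntegral_congr_fun measurableSet_Ioi fun t ht => ?_
    have ht : 0 < t := ht
    simp only [abs_neg, abs_one, one_mul, smul_eq_mul]
    rw [← mul_assoc, ← Real.rpow_mul ht.le, ← Real.rpow_add ht, Real.rpow_neg_one]
    congr 2
    · ring
    · ring
  have hpos : 0 < c ^ (-q) * Real.Gamma q := by
    have := Real.Gamma_pos_of_pos hq
    positivity
  rw [← ofReal_integral_eq_lintegral_ofReal, h2]
  · by_contra hn
    rw [integral_undef hn] at h2
    exact hpos.ne h2
  · refine (ae_restrict_iff' measurableSet_Ioi).2 (.of_forall fun t ht => ?_)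
    have ht : 0 < t := ht
    simp only [Pi.zero_apply]
    positivity

/-- Riesz potentials and kernels as superpositions of heat kernels. -/
lemma lintegral_rpow_mul_heatKernel {d : ℕ} {b : ℝ} (hb : b < (d:ℝ)/2) {x : Euc d} (hx : x ≠ 0) :
    ∫⁻ t in Set.Ioi (0:ℝ), ENNReal.ofReal (t ^ (b - 1)) * ENNReal.ofReal (heatKernel d t x) =
      ENNReal.ofReal ((4 * π) ^ (-(d:ℝ)/2) *
        ((‖x‖^2/4) ^ (b - (d:ℝ)/2) * Real.Gamma ((d:ℝ)/2 - b))) := by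
  have hx' : 0 < ‖x‖ := norm_pos_iff.2 hx
  have h := lintegral_rpow_mul_exp_neg_div (q := (d:ℝ)/2 - b) (c := ‖x‖^2/4) (by linarith)
    (by positivity)
  rw [neg_sub] at h
  have h0 : (0:ℝ) ≤ (4 * π) ^ (-(d:ℝ)/2) := by positivity
  rw [ENNReal.ofReal_mul h0, ← h, ← lintegral_const_mul _ (by fun_prop)]
  refine setLIntegral_congr_fun measurableSet_Ioi fun t ht => ?_
  have ht : 0 < t := ht
  rw [← ENNReal.ofReal_mul (by positivity), ← ENNReal.ofReal_mul h0, heatKernel,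
    Real.mul_rpow (by positivity) ht.le,
    show -1 - ((d:ℝ)/2 - b) = (b - 1) + (-(d:ℝ)/2) by ring, Real.rpow_add ht,
    show -(‖x‖^2/4)/t = -‖x‖^2/(4*t) by field_simp]
  congr 1
  ring

/-- The increment `τ^(β-1) - (τ-t)₊^(β-1)`, with `(τ-t)₊^0` read as an indicator function. -/
def rpowDrop (β τ t : ℝ) : ℝ := τ ^ (β - 1) - if t < τ then (τ - t) ^ (β - 1) else 0

@[fun_prop]
lemma measurable_rpowDrop (β : ℝ) : Measurable fun p : ℝ × ℝ => rpowDrop β p.1 p.2 := by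
  unfold rpowDrop
  refine Measurable.sub (by fun_prop) (Measurable.ite ?_ (by fun_prop) (by fun_prop))
  exact measurableSet_lt measurable_snd measurable_fst

lemma rpowDrop_nonneg {β τ t : ℝ} (hβ : 1 ≤ β) (hτ : 0 < τ) (ht : 0 < t) :
    0 ≤ rpowDrop β τ t := by
  unfold rpowDrop
  split_ifs with h
  · exact sub_nonneg.2 (Real.rpow_le_rpow (by linarith) (by linarith) (by linarith))
  · rw [sub_zero]; positivity

lemma rpowDrop_mul {β τ t : ℝ} (hτ : 0 < τ) :
    rpowDrop β τ (τ * t) = τ ^ (β - 1) * rpowDrop β 1 t := by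
  unfold rpowDrop
  have : τ * t < τ ↔ t < 1 := by
    constructor <;> intro h <;> nlinarith
  simp only [this, Real.one_rpow]
  split_ifs with h
  · rw [show τ - τ * t = τ * (1 - t) by ring, Real.mul_rpow hτ.le (by linarith)]; ring
  · ring

lemma lintegral_Ioi_rpow_tail {s r : ℝ} (hs : 0 < s) (hr : 0 < r) :
    ∫⁻ t in Set.Ioi r, ENNReal.ofReal (t ^ (-1 - s)) = ENNReal.ofReal (r ^ (-s) / s) := by
  rw [← ofReal_integral_eq_lintegral_ofReal (integrableOn_Ioi_rpow_of_lt (by linarith) hr),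
    integral_Ioi_rpow_of_lt (by linarith) hr]
  · congr 1
    rw [show -1 - s + 1 = -s by ring, neg_div_neg_eq]
  · refine (ae_restrict_iff' measurableSet_Ioi).2 (.of_forall fun t ht => ?_)
    exact Real.rpow_nonneg (hr.trans ht).le _

lemma ofReal_rpowDrop_one {β t : ℝ} (hβ : 1 < β) (ht : 0 < t) :
    ENNReal.ofReal (rpowDrop β 1 t) = ∫⁻ r in Set.Ioo (0:ℝ) 1,
      (Set.Iio t).indicator (fun r => ENNReal.ofReal ((β - 1) * (1 - r) ^ (β - 2))) r := by
  set m := min t 1 with hm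
  have hm0 : 0 < m := lt_min ht one_pos
  have hset : Set.Iio t ∩ Set.Ioo (0:ℝ) 1 = Set.Ioo 0 m := by
    ext r; simp only [Set.mem_inter_iff, Set.mem_Iio, Set.mem_Ioo, hm, lt_min_iff]; tauto
  rw [lintegral_indicator measurableSet_Iio, Measure.restrict_restrict measurableSet_Iio, hset,
    setLIntegral_congr Ioo_ae_eq_Ioc]
  have hint : IntervalIntegrable (fun r : ℝ => (β - 1) * (1 - r) ^ (β - 2)) volume 0 m := by
    refine IntervalIntegrable.const_mul ?_ _
    have := (intervalIntegral.intervalIntegrable_rpow' (r := β - 2) (by linarith)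
      (a := 1 - 0) (b := 1 - m)).comp_sub_left 1
    simpa using this
  rw [← ofReal_integral_eq_lintegral_ofReal
    ((intervalIntegrable_iff_integrableOn_Ioc_of_le hm0.le).1 hint),
    ← intervalIntegral.integral_of_le hm0.le]
  · congr 1
    rw [intervalIntegral.integral_const_mul,
      intervalIntegral.integral_comp_sub_left (fun r => r ^ (β - 2)),
      integral_rpow (Or.inl (by linarith)), show β - 2 + 1 = β - 1 by ring, sub_zero,
      Real.one_rpow, mul_div_cancel₀ _ (by linarith), rpowDrop, Real.one_rpow]
    split_ifs with h
    · rw [hm, min_eq_left h.le]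
    · rw [hm, min_eq_right (not_lt.1 h), sub_self, Real.zero_rpow (by linarith)]
  · refine (ae_restrict_iff' measurableSet_Ioc).2 (.of_forall fun r hr => ?_)
    have h1 : r ≤ 1 := hr.2.trans (min_le_right _ _)
    exact mul_nonneg (by linarith) (Real.rpow_nonneg (by linarith) _)

lemma lintegral_rpow_mul_rpowDrop_one {s β : ℝ} (hs : s ∈ Set.Ioo (0:ℝ) 1) (hβ : 1 ≤ β) :
    ∫⁻ t in Set.Ioi (0:ℝ), ENNReal.ofReal (t ^ (-1 - s)) * ENNReal.ofReal (rpowDrop β 1 t) =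
      ENNReal.ofReal (Real.Gamma (1 - s) * Real.Gamma β / (s * Real.Gamma (β - s))) := by
  obtain ⟨hs0, hs1⟩ := hs
  rcases hβ.eq_or_lt with rfl | hβ
  · have h1 : ∀ t : ℝ, ENNReal.ofReal (t ^ (-1 - s)) * ENNReal.ofReal (rpowDrop 1 1 t) =
        (Set.Ici 1).indicator (fun t => ENNReal.ofReal (t ^ (-1 - s))) t := by
      intro t
      by_cases h : t < 1
      · simp [rpowDrop, h]
      · simp [rpowDrop, h, not_lt.1 h]
    have h2 : Set.Ici (1:ℝ) ∩ Set.Ioi 0 = Set.Ici 1 :=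
      Set.inter_eq_left.2 fun x hx => Set.mem_Ioi.2 (one_pos.trans_le hx)
    simp_rw [h1]
    rw [lintegral_indicator measurableSet_Ici, Measure.restrict_restrict measurableSet_Ici, h2,
      setLIntegral_congr Ioi_ae_eq_Ici.symm, lintegral_Ioi_rpow_tail hs0 one_pos, Real.one_rpow,
      Real.Gamma_one, mul_one]
    have := Real.Gamma_pos_of_pos (show 0 < 1 - s by linarith)
    congr 1
    field_simp
  · have hmeas : Measurable (Function.uncurry fun t r : ℝ => ENNReal.ofReal (t ^ (-1 - s)) *
        (Set.Iio t).indicator (fun r => ENNReal.ofReal ((β - 1) * (1 - r) ^ (β - 2))) r) := by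
      have : (Function.uncurry fun t r : ℝ => ENNReal.ofReal (t ^ (-1 - s)) *
        (Set.Iio t).indicator (fun r => ENNReal.ofReal ((β - 1) * (1 - r) ^ (β - 2))) r) =
        fun p : ℝ × ℝ => ENNReal.ofReal (p.1 ^ (-1 - s)) *
          ({p : ℝ × ℝ | p.2 < p.1}.indicator
            (fun p => ENNReal.ofReal ((β - 1) * (1 - p.2) ^ (β - 2))) p) := by
        ext p; simp [Set.indicator, Function.uncurry]
      rw [this]
      exact Measurable.mul (by fun_prop)
        (Measurable.indicator (by fun_prop) (measurableSet_lt measurable_snd measurable_fst))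
    have hb : 0 < ProbabilityTheory.beta (1 - s) (β - 1) :=
      ProbabilityTheory.beta_pos (by linarith) (by linarith)
    calc _ = ∫⁻ t in Set.Ioi (0:ℝ), ∫⁻ r in Set.Ioo (0:ℝ) 1, ENNReal.ofReal (t ^ (-1 - s)) *
          (Set.Iio t).indicator (fun r => ENNReal.ofReal ((β - 1) * (1 - r) ^ (β - 2))) r := by
          refine setLIntegral_congr_fun measurableSet_Ioi fun t ht => ?_
          rw [lintegral_const_mul _ (Measurable.indicator (by fun_prop) measurableSet_Iio),
            ← ofReal_rpowDrop_one hβ ht]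
      _ = ∫⁻ r in Set.Ioo (0:ℝ) 1, ∫⁻ t in Set.Ioi (0:ℝ), ENNReal.ofReal (t ^ (-1 - s)) *
          (Set.Iio t).indicator (fun r => ENNReal.ofReal ((β - 1) * (1 - r) ^ (β - 2))) r :=
          lintegral_lintegral_swap hmeas.aemeasurable
      _ = ∫⁻ r in Set.Ioo (0:ℝ) 1,
          ENNReal.ofReal ((β - 1) / s * ProbabilityTheory.beta (1 - s) (β - 1)) *
          ENNReal.ofReal (1 / ProbabilityTheory.beta (1 - s) (β - 1) * r ^ ((1 - s) - 1) *
            (1 - r) ^ ((β - 1) - 1)) := by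
          refine setLIntegral_congr_fun measurableSet_Ioo fun r hr => ?_
          have hset : Set.Ioi r ∩ Set.Ioi 0 = Set.Ioi r :=
            Set.inter_eq_left.2 fun x hx => lt_trans hr.1 hx
          have h1 : ∀ t : ℝ, ENNReal.ofReal (t ^ (-1 - s)) *
              (Set.Iio t).indicator (fun r => ENNReal.ofReal ((β - 1) * (1 - r) ^ (β - 2))) r =
              ENNReal.ofReal ((β - 1) * (1 - r) ^ (β - 2)) *
                (Set.Ioi r).indicator (fun t => ENNReal.ofReal (t ^ (-1 - s))) t := by
            intro t
            by_cases h : r < t <;> simp [h, mul_comm]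
          have hr1 : 0 < 1 - r := by linarith [hr.2]
          have hr0 : 0 < r := hr.1
          simp_rw [h1]
          rw [lintegral_const_mul _ (Measurable.indicator (by fun_prop) measurableSet_Ioi),
            lintegral_indicator measurableSet_Ioi, Measure.restrict_restrict measurableSet_Ioi,
            hset, lintegral_Ioi_rpow_tail hs0 hr.1,
            ← ENNReal.ofReal_mul (mul_nonneg (by linarith) (by positivity)),
            ← ENNReal.ofReal_mul (mul_nonneg (div_nonneg (by linarith) hs0.le) hb.le)]
          congr 1
          rw [show 1 - s - 1 = -s by ring, show β - 1 - 1 = β - 2 by ring]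
          field_simp
      _ = _ := by
          rw [lintegral_const_mul' _ _ ENNReal.ofReal_ne_top, ← ProbabilityTheory.lintegral_betaPDF,
            ProbabilityTheory.lintegral_betaPDF_eq_one (by linarith) (by linarith), mul_one]
          congr 1
          have h1 := Real.Gamma_add_one (s := β - 1) (by linarith)
          rw [sub_add_cancel] at h1
          rw [ProbabilityTheory.beta, h1, show 1 - s + (β - 1) = β - s by ring]
          field_simp

lemma lintegral_rpow_mul_rpowDrop {s β τ : ℝ} (hs : s ∈ Set.Ioo (0:ℝ) 1) (hβ : 1 ≤ β)
    (hτ : 0 < τ) :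
    ∫⁻ t in Set.Ioi (0:ℝ), ENNReal.ofReal (t ^ (-1 - s)) * ENNReal.ofReal (rpowDrop β τ t) =
      ENNReal.ofReal (Real.Gamma (1 - s) * Real.Gamma β / (s * Real.Gamma (β - s))) *
        ENNReal.ofReal (τ ^ (β - s - 1)) := by
  have hg : Measurable ((Set.Ioi (0:ℝ)).indicator fun t =>
      ENNReal.ofReal (t ^ (-1 - s)) * ENNReal.ofReal (rpowDrop β τ t)) :=
    Measurable.indicator (by fun_prop) measurableSet_Ioi
  rw [← lintegral_indicator measurableSet_Ioi, ← Real.smul_map_volume_mul_left hτ.ne',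
    lintegral_smul_measure, lintegral_map hg (by fun_prop), ← lintegral_rpow_mul_rpowDrop_one hs hβ,
    ← lintegral_mul_const _ (by fun_prop), ← lintegral_indicator measurableSet_Ioi, smul_eq_mul,
    ← lintegral_const_mul' _ _ ENNReal.ofReal_ne_top]
  refine lintegral_congr fun t => ?_
  by_cases ht : 0 < t
  · rw [Set.indicator_of_mem (Set.mem_Ioi.2 (mul_pos hτ ht)), Set.indicator_of_mem
      (Set.mem_Ioi.2 ht), rpowDrop_mul hτ]
    have hD := rpowDrop_nonneg hβ one_pos ht
    rw [← ENNReal.ofReal_mul (by positivity), ← ENNReal.ofReal_mul (by positivity),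
      ← ENNReal.ofReal_mul (by positivity), ← ENNReal.ofReal_mul (by positivity), abs_of_pos hτ,
      Real.mul_rpow hτ.le ht.le]
    congr 1
    have : τ ^ (β - s - 1) = τ * τ ^ (-1 - s) * τ ^ (β - 1) := by
      nth_rewrite 2 [← Real.rpow_one τ]
      rw [← Real.rpow_add hτ, ← Real.rpow_add hτ]
      congr 1; ring
    rw [this]; ring
  · have h' : ¬ 0 < τ * t := fun h => ht (pos_of_mul_pos_right h hτ.le)
    rw [Set.indicator_of_notMem (by simpa using h'), Set.indicator_of_notMem (by simpa using ht),
      mul_zero]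

/-- The Riesz potential `∫₀^∞ t^(b-1) p_t(x) dt` of the heat kernel, in closed form. -/
def rieszPotential (d : ℕ) (b : ℝ) (x : Euc d) : ℝ :=
  (4 * π) ^ (-(d:ℝ)/2) * ((‖x‖^2/4) ^ (b - (d:ℝ)/2) * Real.Gamma ((d:ℝ)/2 - b))

@[fun_prop]
lemma measurable_rieszPotential (d : ℕ) (b : ℝ) : Measurable (rieszPotential d b) := by
  unfold rieszPotential; fun_prop

lemma rieszPotential_pos {d : ℕ} {b : ℝ} (hb : b < (d:ℝ)/2) {x : Euc d} (hx : x ≠ 0) :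
    0 < rieszPotential d b x := by
  have hx' : 0 < ‖x‖ := norm_pos_iff.2 hx
  have := Real.Gamma_pos_of_pos (show 0 < (d:ℝ)/2 - b by linarith)
  unfold rieszPotential
  positivity

lemma lintegral_heatKernel_mul_rieszPotential {d : ℕ} (hd : 0 < d) {b : ℝ} (hb : b < (d:ℝ)/2)
    {t : ℝ} (ht : 0 < t) (x : Euc d) :
    ∫⁻ z : Euc d, ENNReal.ofReal (heatKernel d t (x - z)) * ENNReal.ofReal (rieszPotential d b z) =
      ∫⁻ τ in Set.Ioi (0:ℝ), ENNReal.ofReal (if t < τ then (τ - t) ^ (b - 1) else 0) *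
        ENNReal.ofReal (heatKernel d τ x) := by
  have : Nonempty (Fin d) := ⟨⟨0, hd⟩⟩
  have h0 : ∀ᵐ z : Euc d, z ≠ 0 := Measure.ae_ne volume 0
  calc _ = ∫⁻ z : Euc d, ∫⁻ τ in Set.Ioi (0:ℝ), ENNReal.ofReal (heatKernel d t (x - z)) *
        (ENNReal.ofReal (τ ^ (b - 1)) * ENNReal.ofReal (heatKernel d τ z)) := by
        refine lintegral_congr_ae (h0.mono fun z hz => ?_)
        simp only
        rw [rieszPotential, ← lintegral_rpow_mul_heatKernel hb hz,
          lintegral_const_mul' _ _ ENNReal.ofReal_ne_top]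
    _ = ∫⁻ τ in Set.Ioi (0:ℝ), ∫⁻ z : Euc d, ENNReal.ofReal (heatKernel d t (x - z)) *
        (ENNReal.ofReal (τ ^ (b - 1)) * ENNReal.ofReal (heatKernel d τ z)) := by
        refine lintegral_lintegral_swap (Measurable.aemeasurable ?_)
        unfold Function.uncurry heatKernel
        fun_prop
    _ = ∫⁻ τ in Set.Ioi (0:ℝ), ENNReal.ofReal (τ ^ (b - 1)) *
        ENNReal.ofReal (heatKernel d (τ + t) x) := by
        refine setLIntegral_congr_fun measurableSet_Ioi fun τ hτ => ?_
        simp only [mul_left_comm _ (ENNReal.ofReal (τ ^ (b - 1)))]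
        rw [lintegral_const_mul' _ _ ENNReal.ofReal_ne_top,
          lintegral_heatKernel_mul_heatKernel ht hτ, add_comm]
    _ = _ := by
        rw [← lintegral_indicator measurableSet_Ioi, ← lintegral_indicator measurableSet_Ioi,
          ← lintegral_add_right_eq_self (μ := volume) (fun τ : ℝ => (Set.Ioi (0:ℝ)).indicator
            (fun τ => ENNReal.ofReal (if t < τ then (τ - t) ^ (b - 1) else 0) *
              ENNReal.ofReal (heatKernel d τ x)) τ) t]
        refine lintegral_congr fun τ => ?_
        by_cases hτ : 0 < τ
        · have : 0 < τ + t := by linarith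
          simp [Set.indicator, hτ, this]
        · simp [Set.indicator, hτ]

/-- The heat flow of a Riesz potential, together with what it has lost. -/
lemma lintegral_heatKernel_mul_rieszPotential_add {d : ℕ} (hd : 0 < d) {b : ℝ} (hb1 : 1 ≤ b)
    (hb : b < (d:ℝ)/2) {t : ℝ} (ht : 0 < t) {x : Euc d} (hx : x ≠ 0) :
    (∫⁻ z : Euc d, ENNReal.ofReal (heatKernel d t (x - z)) *
      ENNReal.ofReal (rieszPotential d b z)) +
      ∫⁻ τ in Set.Ioi (0:ℝ), ENNReal.ofReal (rpowDrop b τ t) * ENNReal.ofReal (heatKernel d τ x) =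
      ENNReal.ofReal (rieszPotential d b x) := by
  rw [lintegral_heatKernel_mul_rieszPotential hd hb ht, rieszPotential,
    ← lintegral_rpow_mul_heatKernel hb hx, ← lintegral_add_right]
  · refine setLIntegral_congr_fun measurableSet_Ioi fun τ hτ => ?_
    rw [← add_mul, ← ENNReal.ofReal_add _ (rpowDrop_nonneg hb1 hτ ht), rpowDrop,
      add_sub_cancel]
    split_ifs with h
    · exact Real.rpow_nonneg (by linarith) _
    · exact le_rfl
  · unfold rpowDrop heatKernel
    refine Measurable.mul (Measurable.ennreal_ofReal (Measurable.sub (by fun_prop)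
      (Measurable.ite measurableSet_Ioi (by fun_prop) (by fun_prop)))) (by fun_prop)

/-- Ground state inequality for a symmetric Markov kernel: if `φ` is a positive function with
`kφ/φ = 1 - R`, then the Dirichlet form of `k` dominates `2 ∫ f² R`. -/
lemma ground_state_inequality {E : Type*} [MeasurableSpace E] {μ : Measure E} [SFinite μ]
    {k : E → E → ℝ≥0∞} (hk : Measurable (Function.uncurry k)) (hsymm : ∀ x y, k x y = k y x)
    (hone : ∀ x, ∫⁻ y, k x y ∂μ = 1) {f φ : E → ℝ} (hf : Measurable f) (hφ : Measurable φ)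
    (hφpos : ∀ᵐ x ∂μ, 0 < φ x) (hf2 : ∫⁻ x, ENNReal.ofReal (f x ^ 2) ∂μ ≠ ∞) {R : E → ℝ≥0∞}
    (hR : ∀ᵐ x ∂μ, ∫⁻ y, k x y * ENNReal.ofReal (φ y) ∂μ + R x = ENNReal.ofReal (φ x)) :
    2 * ∫⁻ x, ENNReal.ofReal (f x ^ 2) * (ENNReal.ofReal (φ x)⁻¹ * R x) ∂μ ≤
      ∫⁻ x, ∫⁻ y, k x y * ENNReal.ofReal ((f x - f y) ^ 2) ∂μ ∂μ := by
  set F : E → ℝ≥0∞ := fun x => ENNReal.ofReal (f x ^ 2)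
  set M : E → ℝ≥0∞ := fun x =>
    ENNReal.ofReal (φ x)⁻¹ * ∫⁻ y, k x y * ENNReal.ofReal (φ y) ∂μ with hM
  set A := ∫⁻ x, ∫⁻ y, k x y * ENNReal.ofReal ((f x - f y) ^ 2) ∂μ ∂μ
  set B : E → E → ℝ≥0∞ := fun x y =>
    k x y * (F x * (ENNReal.ofReal (φ x)⁻¹ * ENNReal.ofReal (φ y))) with hB
  have hFm : Measurable F := by fun_prop
  have hkφ : Measurable fun x => ∫⁻ y, k x y * ENNReal.ofReal (φ y) ∂μ :=
    Measurable.lintegral_prod_right' (f := fun p : E × E => k p.1 p.2 * ENNReal.ofReal (φ p.2))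
      (hk.mul (by fun_prop))
  have hMm : Measurable M := by
    exact Measurable.mul (by fun_prop) hkφ
  have hBm : Measurable (Function.uncurry B) := by
    exact hk.mul (show Measurable fun p : E × E =>
      F p.1 * (ENNReal.ofReal (φ p.1)⁻¹ * ENNReal.ofReal (φ p.2)) by fun_prop)
  have hBint : ∫⁻ x, ∫⁻ y, B x y ∂μ ∂μ = ∫⁻ x, F x * M x ∂μ := by
    refine lintegral_congr fun x => ?_
    have : ∀ y, B x y = F x * ENNReal.ofReal (φ x)⁻¹ * (k x y * ENNReal.ofReal (φ y)) := by
      intro y; simp only [hB]; ring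
    simp_rw [this]
    rw [lintegral_const_mul' _ _ (ENNReal.mul_ne_top ENNReal.ofReal_ne_top ENNReal.ofReal_ne_top),
      hM, mul_assoc]
  have hBswap : ∫⁻ x, ∫⁻ y, B y x ∂μ ∂μ = ∫⁻ x, F x * M x ∂μ := by
    rw [← hBint]
    exact (lintegral_lintegral_swap hBm.aemeasurable).symm
  have hF1 : ∫⁻ x, ∫⁻ y, k x y * F x ∂μ ∂μ = ∫⁻ x, F x ∂μ := by
    refine lintegral_congr fun x => ?_
    rw [lintegral_mul_const' _ _ ENNReal.ofReal_ne_top, hone, one_mul]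
  have hF2 : ∫⁻ x, ∫⁻ y, k x y * F y ∂μ ∂μ = ∫⁻ x, F x ∂μ := by
    rw [lintegral_lintegral_swap (Measurable.aemeasurable (hk.mul (hFm.comp measurable_snd))),
      ← hF1]
    simp_rw [hsymm]
  have hAB : 2 * ∫⁻ x, F x ∂μ ≤ A + 2 * ∫⁻ x, F x * M x ∂μ := by
    calc 2 * ∫⁻ x, F x ∂μ = ∫⁻ x, ∫⁻ y, (k x y * F x + k x y * F y) ∂μ ∂μ := by
          rw [two_mul]
          nth_rewrite 1 [← hF1]
          nth_rewrite 1 [← hF2]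
          rw [← lintegral_add_left]
          · refine lintegral_congr fun x => ?_
            rw [lintegral_add_left]
            exact (hk.comp measurable_prodMk_left).mul measurable_const
          · exact Measurable.lintegral_prod_right' (f := fun p : E × E => k p.1 p.2 * F p.1)
              (hk.mul (by fun_prop))
      _ ≤ ∫⁻ x, ∫⁻ y, (k x y * ENNReal.ofReal ((f x - f y) ^ 2) + B x y + B y x) ∂μ ∂μ := by
          refine lintegral_mono_ae (hφpos.mono fun x hx => lintegral_mono_ae
            (hφpos.mono fun y hy => ?_))
          simp only [hB, F]
          rw [hsymm y x, ← mul_add, ← mul_add, ← mul_add, ← ENNReal.ofReal_mul (by positivity),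
            ← ENNReal.ofReal_mul (by positivity), ← ENNReal.ofReal_mul (by positivity),
            ← ENNReal.ofReal_mul (by positivity), ← ENNReal.ofReal_add (by positivity)
            (by positivity), ← ENNReal.ofReal_add (by positivity) (by positivity),
            ← ENNReal.ofReal_add (by positivity) (by positivity)]
          gcongr k x y * ENNReal.ofReal ?_
          have h : (f x - f y)^2 + f x ^ 2 * ((φ x)⁻¹ * φ y) + f y ^ 2 * ((φ y)⁻¹ * φ x) -
              (f x ^ 2 + f y ^ 2) = (f x * φ y - f y * φ x)^2 / (φ x * φ y) := by
            field_simp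
            ring
          have : 0 ≤ (f x * φ y - f y * φ x)^2 / (φ x * φ y) := by positivity
          linarith
      _ = A + 2 * ∫⁻ x, F x * M x ∂μ := by
          rw [two_mul, ← add_assoc]
          nth_rewrite 1 [← hBint]
          rw [← hBswap]
          have hk1 : Measurable fun p : E × E => k p.1 p.2 * ENNReal.ofReal ((f p.1 - f p.2) ^ 2) :=
            hk.mul (by fun_prop)
          rw [← lintegral_add_left hk1.lintegral_prod_right', ← lintegral_add_left]
          · refine lintegral_congr fun x => ?_
            rw [lintegral_add_left, lintegral_add_left]
            · exact hk1.comp measurable_prodMk_left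
            · exact (hk1.comp measurable_prodMk_left).add (hBm.comp measurable_prodMk_left)
          · exact hk1.lintegral_prod_right'.add hBm.lintegral_prod_right'
  have hsplit : ∫⁻ x, F x ∂μ =
      ∫⁻ x, F x * M x ∂μ + ∫⁻ x, F x * (ENNReal.ofReal (φ x)⁻¹ * R x) ∂μ := by
    rw [← lintegral_add_left (show Measurable fun x => F x * M x from hFm.mul hMm)]
    refine lintegral_congr_ae ?_
    filter_upwards [hφpos, hR] with x hx hRx
    rw [hM, ← mul_add, ← mul_add, hRx, ← ENNReal.ofReal_mul (by positivity),
      inv_mul_cancel₀ hx.ne', ENNReal.ofReal_one, mul_one]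
  have hfin : 2 * ∫⁻ x, F x * M x ∂μ ≠ ∞ :=
    ENNReal.mul_ne_top (by simp) (ne_top_of_le_ne_top hf2 (by rw [hsplit]; exact le_self_add))
  rw [hsplit, mul_add, add_comm A] at hAB
  exact (ENNReal.add_le_add_iff_left hfin).1 hAB

lemma ofReal_a_sd_mul {d : ℕ} (hd : 0 < d) {s : ℝ} (hs : s ∈ Set.Ioo (0:ℝ) 1) {x : Euc d}
    (hx : x ≠ 0) :
    ENNReal.ofReal (a_sd d s / ‖x‖ ^ ((d:ℝ) + 2*s)) =
      ENNReal.ofReal (s / (2 * Real.Gamma (1 - s))) *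
        ∫⁻ t in Set.Ioi (0:ℝ), ENNReal.ofReal (t ^ (-1 - s)) *
          ENNReal.ofReal (heatKernel d t x) := by
  obtain ⟨hs0, hs1⟩ := hs
  have hd' : (0:ℝ) < d := by exact_mod_cast hd
  have hx' : 0 < ‖x‖ := norm_pos_iff.2 hx
  have hG := Real.Gamma_pos_of_pos (show 0 < 1 - s by linarith)
  have h := lintegral_rpow_mul_heatKernel (b := -s) (by linarith) hx
  rw [show -s - 1 = -1 - s by ring] at h
  rw [h, ← ENNReal.ofReal_mul (by positivity)]
  congr 1
  have h1 : (4 * π) ^ (-(d:ℝ)/2) = 2 ^ (-(d:ℝ)) * π ^ (-(d:ℝ)/2) := by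
    rw [Real.mul_rpow (by norm_num) Real.pi_pos.le, show (4:ℝ) = 2 ^ (2:ℝ) by norm_num,
      ← Real.rpow_mul (by norm_num)]
    congr 2; ring
  have h2 : (‖x‖^2/4) ^ (-s - (d:ℝ)/2) = 2 ^ (2*s + d) / ‖x‖ ^ ((d:ℝ) + 2*s) := by
    rw [show ‖x‖^2/4 = (‖x‖/2) ^ (2:ℝ) by rw [Real.rpow_two]; ring,
      ← Real.rpow_mul (by positivity), show 2 * (-s - (d:ℝ)/2) = -((d:ℝ) + 2*s) by ring,
      Real.rpow_neg (by positivity), Real.div_rpow hx'.le (by norm_num), inv_div, add_comm (d:ℝ)]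
  have h3 : (2:ℝ) ^ (2*s - 1) = 2 ^ (-(d:ℝ)) * 2 ^ (2*s + d) / 2 := by
    rw [← Real.rpow_add two_pos, Real.rpow_sub_one two_ne_zero]
    congr 2; ring
  rw [a_sd, h1, h2, h3, show (d:ℝ)/2 - -s = ((d:ℝ) + 2*s)/2 by ring]
  field_simp

lemma hardy_constant_eq {d : ℕ} {s : ℝ} (hs : s ∈ Set.Ioo (0:ℝ) 1) (hds : 2*s < (d:ℝ))
    {x : Euc d} (hx : x ≠ 0) :
    s / (2 * Real.Gamma (1 - s)) * 2 * ((rieszPotential d (((d:ℝ) + 2*s)/4) x)⁻¹ *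
      (Real.Gamma (1 - s) * Real.Gamma (((d:ℝ) + 2*s)/4) /
        (s * Real.Gamma (((d:ℝ) + 2*s)/4 - s)) *
        rieszPotential d (((d:ℝ) + 2*s)/4 - s) x)) = C_fH d s * (‖x‖ ^ (2*s))⁻¹ := by
  obtain ⟨hs0, hs1⟩ := hs
  have hx' : 0 < ‖x‖ := norm_pos_iff.2 hx
  have hG := Real.Gamma_pos_of_pos (show 0 < 1 - s by linarith)
  have hG1 := Real.Gamma_pos_of_pos (show 0 < ((d:ℝ) + 2*s)/4 by linarith)
  have hG2 := Real.Gamma_pos_of_pos (show 0 < ((d:ℝ) - 2*s)/4 by linarith)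
  have h1 : (‖x‖^2/4) ^ (((d:ℝ) + 2*s)/4 - s - (d:ℝ)/2) =
      (‖x‖^2/4) ^ (((d:ℝ) + 2*s)/4 - (d:ℝ)/2) * (2 ^ (2*s) * (‖x‖ ^ (2*s))⁻¹) := by
    have : (2:ℝ) ^ (2*s) * (‖x‖ ^ (2*s))⁻¹ = (‖x‖^2/4) ^ (-s) := by
      rw [show ‖x‖^2/4 = (‖x‖/2) ^ (2:ℝ) by rw [Real.rpow_two]; ring,
        ← Real.rpow_mul (by positivity), mul_neg,
        Real.rpow_neg (by positivity), Real.div_rpow hx'.le (by norm_num), inv_div]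
      rfl
    rw [this, ← Real.rpow_add (by positivity)]
    congr 1; ring
  rw [rieszPotential, rieszPotential, h1, C_fH,
    show ((d:ℝ) + 2*s)/4 - s = ((d:ℝ) - 2*s)/4 by ring,
    show (d:ℝ)/2 - ((d:ℝ) - 2*s)/4 = ((d:ℝ) + 2*s)/4 by ring,
    show (d:ℝ)/2 - ((d:ℝ) + 2*s)/4 = ((d:ℝ) - 2*s)/4 by ring]
  field_simp

lemma lintegral_rpow_mul_lintegral_rpowDrop_mul_heatKernel {d : ℕ} {s β : ℝ}
    (hs : s ∈ Set.Ioo (0:ℝ) 1) (hβ : 1 ≤ β) (hβd : β < (d:ℝ)/2) {x : Euc d} (hx : x ≠ 0) :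
    ∫⁻ t in Set.Ioi (0:ℝ), ENNReal.ofReal (t ^ (-1 - s)) *
      ∫⁻ τ in Set.Ioi (0:ℝ), ENNReal.ofReal (rpowDrop β τ t) *
        ENNReal.ofReal (heatKernel d τ x) =
      ENNReal.ofReal (Real.Gamma (1 - s) * Real.Gamma β / (s * Real.Gamma (β - s))) *
        ENNReal.ofReal (rieszPotential d (β - s) x) := by
  have hm : Measurable (Function.uncurry fun t τ : ℝ => ENNReal.ofReal (t ^ (-1 - s)) *
      (ENNReal.ofReal (rpowDrop β τ t) * ENNReal.ofReal (heatKernel d τ x))) := by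
    have : Measurable fun p : ℝ × ℝ => rpowDrop β p.2 p.1 :=
      (measurable_rpowDrop β).comp measurable_swap
    unfold Function.uncurry heatKernel
    fun_prop
  simp_rw [← lintegral_const_mul' _ _ (ENNReal.ofReal_ne_top)]
  rw [lintegral_lintegral_swap hm.aemeasurable, rieszPotential,
    ← lintegral_rpow_mul_heatKernel (by linarith [hs.1]) hx,
    ← lintegral_const_mul' _ _ ENNReal.ofReal_ne_top]
  refine setLIntegral_congr_fun measurableSet_Ioi fun τ hτ => ?_
  simp only [← mul_assoc]
  rw [lintegral_mul_const' _ _ ENNReal.ofReal_ne_top, lintegral_rpow_mul_rpowDrop hs hβ hτ]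

/-- The sharp one-particle fractional Hardy inequality, in the range `4 - 2s ≤ d`. -/
theorem fractional_hardy {d : ℕ} (hd : 0 < d) {s : ℝ} (hs : s ∈ Set.Ioo (0:ℝ) 1)
    (hds : (4:ℝ) - 2*s ≤ (d:ℝ)) {f : Euc d → ℝ} (hf : Measurable f)
    (hf2 : ∫⁻ x, ENNReal.ofReal (f x ^ 2) ≠ ∞) :
    ENNReal.ofReal (C_fH d s) * ∫⁻ x, ENNReal.ofReal ((‖x‖ ^ (2*s))⁻¹ * f x ^ 2) ≤
      ∫⁻ x, ∫⁻ z, ENNReal.ofReal (a_sd d s * ((f x - f z)^2 / ‖x - z‖ ^ ((d:ℝ) + 2*s))) := by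
  have hs' := hs
  obtain ⟨hs0, hs1⟩ := hs'
  have hC : 0 ≤ C_fH d s := by unfold C_fH; positivity
  have : Nonempty (Fin d) := ⟨⟨0, hd⟩⟩
  have h0 : ∀ᵐ z : Euc d, z ≠ 0 := Measure.ae_ne volume 0
  set β := ((d:ℝ) + 2*s)/4 with hβdef
  have hβ : 1 ≤ β := by rw [hβdef]; linarith
  have hβd : β < (d:ℝ)/2 := by rw [hβdef]; linarith
  have hG := Real.Gamma_pos_of_pos (show 0 < 1 - s by linarith)
  set c := ENNReal.ofReal (s / (2 * Real.Gamma (1 - s))) with hc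
  set F : Euc d → ℝ≥0∞ := fun x => ENNReal.ofReal (f x ^ 2)
  have hFm : Measurable F := by fun_prop
  set R : ℝ → Euc d → ℝ≥0∞ := fun t x => ∫⁻ τ in Set.Ioi (0:ℝ),
    ENNReal.ofReal (rpowDrop β τ t) * ENNReal.ofReal (heatKernel d τ x) with hR
  have hRm : Measurable fun p : ℝ × Euc d => R p.1 p.2 := by
    refine Measurable.lintegral_prod_right' (f := fun q : (ℝ × Euc d) × ℝ =>
      ENNReal.ofReal (rpowDrop β q.2 q.1.1) * ENNReal.ofReal (heatKernel d q.2 q.1.2)) ?_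
    have h1 : Measurable fun q : (ℝ × Euc d) × ℝ => rpowDrop β q.2 q.1.1 :=
      (measurable_rpowDrop β).comp (by fun_prop : Measurable fun q : (ℝ × Euc d) × ℝ =>
        (q.2, q.1.1))
    unfold heatKernel
    fun_prop
  have hGm : Measurable fun q : ℝ × Euc d × Euc d => ENNReal.ofReal (q.1 ^ (-1 - s)) *
      (ENNReal.ofReal (heatKernel d q.1 (q.2.1 - q.2.2)) *
        ENNReal.ofReal ((f q.2.1 - f q.2.2)^2)) := by
    unfold heatKernel
    fun_prop
  calc _ = c * ∫⁻ x, 2 * (F x * (ENNReal.ofReal (rieszPotential d β x)⁻¹ *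
        ∫⁻ t in Set.Ioi (0:ℝ), ENNReal.ofReal (t ^ (-1 - s)) * R t x)) := by
        rw [← lintegral_const_mul' _ _ ENNReal.ofReal_ne_top, hc,
          ← lintegral_const_mul' _ _ ENNReal.ofReal_ne_top]
        refine lintegral_congr_ae (h0.mono fun x hx => ?_)
        have hpos1 := rieszPotential_pos hβd hx
        have hpos2 := rieszPotential_pos (show β - s < (d:ℝ)/2 by linarith) hx
        have hG1 := Real.Gamma_pos_of_pos (show 0 < β by linarith)
        have hG2 := Real.Gamma_pos_of_pos (show 0 < β - s by linarith)
        simp only [hR, F]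
        rw [lintegral_rpow_mul_lintegral_rpowDrop_mul_heatKernel hs hβ hβd hx,
          show ∀ y : ℝ≥0∞, 2 * y = ENNReal.ofReal 2 * y from fun y => by simp, ← ENNReal.ofReal_mul (by positivity),
          ← ENNReal.ofReal_mul (by positivity), ← ENNReal.ofReal_mul (by positivity),
          ← ENNReal.ofReal_mul (by positivity), ← ENNReal.ofReal_mul (by positivity),
          ← ENNReal.ofReal_mul (by positivity)]
        congr 1
        rw [← mul_assoc, ← hardy_constant_eq hs (by linarith) hx]
        ring
    _ = c * ∫⁻ t in Set.Ioi (0:ℝ), ENNReal.ofReal (t ^ (-1 - s)) *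
        (2 * ∫⁻ x, F x * (ENNReal.ofReal (rieszPotential d β x)⁻¹ * R t x)) := by
        congr 1
        trans ∫⁻ x, ∫⁻ t in Set.Ioi (0:ℝ), 2 * (F x * (ENNReal.ofReal (rieszPotential d β x)⁻¹ *
          (ENNReal.ofReal (t ^ (-1 - s)) * R t x)))
        · refine lintegral_congr fun x => ?_
          rw [lintegral_const_mul' 2 _ (by simp), lintegral_const_mul' (F x) _ ENNReal.ofReal_ne_top,
            lintegral_const_mul' _ _ ENNReal.ofReal_ne_top]
        rw [lintegral_lintegral_swap]
        · refine setLIntegral_congr_fun measurableSet_Ioi fun t ht => ?_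
          rw [← lintegral_const_mul' 2 _ (by simp), ← lintegral_const_mul' _ _ ENNReal.ofReal_ne_top]
          refine lintegral_congr fun x => ?_
          ring
        · have : Measurable fun p : Euc d × ℝ => R p.2 p.1 := hRm.comp measurable_swap
          unfold Function.uncurry
          fun_prop
    _ ≤ c * ∫⁻ t in Set.Ioi (0:ℝ), ENNReal.ofReal (t ^ (-1 - s)) *
        ∫⁻ x, ∫⁻ z, ENNReal.ofReal (heatKernel d t (x - z)) *
          ENNReal.ofReal ((f x - f z)^2) := by
        gcongr c * ?_
        refine setLIntegral_mono' measurableSet_Ioi fun t ht => ?_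
        gcongr ENNReal.ofReal (t ^ (-1 - s)) * ?_
        refine ground_state_inequality (k := fun x z => ENNReal.ofReal (heatKernel d t (x - z)))
          ?_ (fun x z => by rw [heatKernel_sub_comm]) (fun x => ?_) hf
          (measurable_rieszPotential d β) (h0.mono fun x hx => rieszPotential_pos hβd hx) hf2
          (h0.mono fun x hx => lintegral_heatKernel_mul_rieszPotential_add hd hβ hβd ht hx)
        · unfold Function.uncurry heatKernel; fun_prop
        · rw [lintegral_sub_left_eq_self (fun z => ENNReal.ofReal (heatKernel d t z)) x,
            lintegral_heatKernel ht]
    _ = c * ∫⁻ x, ∫⁻ z, ∫⁻ t in Set.Ioi (0:ℝ), ENNReal.ofReal (t ^ (-1 - s)) *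
        (ENNReal.ofReal (heatKernel d t (x - z)) * ENNReal.ofReal ((f x - f z)^2)) := by
        congr 1
        simp_rw [← lintegral_const_mul' _ _ (ENNReal.ofReal_ne_top)]
        rw [lintegral_lintegral_swap]
        · refine lintegral_congr fun x => ?_
          rw [lintegral_lintegral_swap]
          exact (hGm.comp (by fun_prop : Measurable fun p : ℝ × Euc d => (p.1, x, p.2))).aemeasurable
        · exact (Measurable.lintegral_prod_right' (f := fun q : (ℝ × Euc d) × Euc d => _)
            (hGm.comp (by fun_prop : Measurable fun q : (ℝ × Euc d) × Euc d =>
              (q.1.1, q.1.2, q.2)))).aemeasurable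
    _ = _ := by
        rw [hc, ← lintegral_const_mul' _ _ ENNReal.ofReal_ne_top]
        refine lintegral_congr fun x => ?_
        rw [← lintegral_const_mul' _ _ ENNReal.ofReal_ne_top]
        refine lintegral_congr fun z => ?_
        by_cases hxz : x = z
        · simp [hxz]
        · have h1 : a_sd d s * ((f x - f z)^2 / ‖x - z‖ ^ ((d:ℝ) + 2*s)) =
              a_sd d s / ‖x - z‖ ^ ((d:ℝ) + 2*s) * (f x - f z)^2 := by ring
          rw [h1, ENNReal.ofReal_mul' (sq_nonneg _), ofReal_a_sd_mul hd hs (sub_ne_zero.2 hxz),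
            mul_assoc, ← lintegral_mul_const' _ _ ENNReal.ofReal_ne_top]
          simp_rw [mul_assoc]

lemma schur_inequality {a b c : ℝ} (ha : 0 ≤ a) (hb : 0 ≤ b) (hc : 0 ≤ c) :
    0 ≤ a * (a - b) * (a - c) + b * (b - a) * (b - c) + c * (c - a) * (c - b) := by
  have key : ∀ x y z : ℝ, 0 ≤ z → z ≤ y → y ≤ x →
      0 ≤ x * (x - y) * (x - z) + y * (y - x) * (y - z) + z * (z - x) * (z - y) := by
    intro x y z hz hzy hyx
    have h1 : 0 ≤ (x - y) ^ 2 * (x + y - z) := mul_nonneg (sq_nonneg _) (by linarith)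
    have h2 : 0 ≤ z * ((x - z) * (y - z)) :=
      mul_nonneg hz (mul_nonneg (by linarith) (by linarith))
    nlinarith
  rcases le_total a b with h1 | h1 <;> rcases le_total b c with h2 | h2 <;>
    rcases le_total a c with h3 | h3
  · linarith [key c b a ha h1 h2]
  · linarith [key c b a ha h1 h2]
  · linarith [key b c a ha h3 h2]
  · linarith [key b a c hc h3 h1]
  · linarith [key c a b hb h1 h3]
  · linarith [key a c b hb h2 h3]
  · linarith [key a b c hc h2 h1]
  · linarith [key a b c hc h2 h1]

lemma Pcirc_nonneg {d : ℕ} {x₁ x₂ x₃ : Euc d} (h₁₂ : x₁ ≠ x₂) (h₂₃ : x₂ ≠ x₃) (h₃₁ : x₃ ≠ x₁) :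
    2 * Pcirc x₁ x₂ x₃ = (4 * ‖x₁ - x₂‖^2 * ‖x₃ - x₁‖^2 -
      (‖x₁ - x₂‖^2 + ‖x₃ - x₁‖^2 - ‖x₂ - x₃‖^2)^2) /
        (‖x₁ - x₂‖^2 * ‖x₂ - x₃‖^2 * ‖x₃ - x₁‖^2) ∧ 0 ≤ Pcirc x₁ x₂ x₃ := by
  have hA : 0 < ‖x₁ - x₂‖ := norm_pos_iff.2 (sub_ne_zero.2 h₁₂)
  have hB : 0 < ‖x₂ - x₃‖ := norm_pos_iff.2 (sub_ne_zero.2 h₂₃)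
  have hC : 0 < ‖x₃ - x₁‖ := norm_pos_iff.2 (sub_ne_zero.2 h₃₁)
  have polar : ∀ x y z : Euc d, ⟪x - y, z - y⟫ = (‖x - y‖^2 + ‖y - z‖^2 - ‖z - x‖^2) / 2 := by
    intro x y z
    have h := norm_sub_sq_real (x - y) (z - y)
    rw [sub_sub_sub_cancel_right, norm_sub_rev x z, norm_sub_rev z y] at h
    linarith
  have h : 2 * Pcirc x₁ x₂ x₃ = (4 * ‖x₁ - x₂‖^2 * ‖x₃ - x₁‖^2 -
      (‖x₁ - x₂‖^2 + ‖x₃ - x₁‖^2 - ‖x₂ - x₃‖^2)^2) /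
        (‖x₁ - x₂‖^2 * ‖x₂ - x₃‖^2 * ‖x₃ - x₁‖^2) := by
    rw [Pcirc, polar x₃ x₁ x₂, polar x₁ x₂ x₃, polar x₂ x₃ x₁, norm_sub_rev x₂ x₁,
      norm_sub_rev x₃ x₂, norm_sub_rev x₁ x₃]
    field_simp
    ring
  refine ⟨h, ?_⟩
  have hcs := abs_real_inner_le_norm (x₃ - x₁) (x₂ - x₁)
  have hcs2 : ⟪x₃ - x₁, x₂ - x₁⟫^2 ≤ (‖x₃ - x₁‖ * ‖x₂ - x₁‖)^2 :=
    sq_le_sq' (by linarith [neg_abs_le ⟪x₃ - x₁, x₂ - x₁⟫]) ((le_abs_self _).trans hcs)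
  rw [polar, norm_sub_rev x₂ x₁] at hcs2
  have : 0 ≤ 2 * Pcirc x₁ x₂ x₃ := by
    rw [h]
    refine div_nonneg ?_ (by positivity)
    nlinarith
  linarith

/-- The circumradius weight is dominated by the pair weights, via `abc ≤ 3√3 R³` and AM-GM. -/
lemma three_rpow_mul_Pcirc_rpow_le {d : ℕ} {s : ℝ} (hs : 0 < s) {x₁ x₂ x₃ : Euc d}
    (h₁₂ : x₁ ≠ x₂) (h₂₃ : x₂ ≠ x₃) (h₃₁ : x₃ ≠ x₁) :
    (3:ℝ) ^ (1 - s) * (2 * Pcirc x₁ x₂ x₃) ^ s ≤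
      (‖x₁ - x₂‖ ^ (2*s))⁻¹ + (‖x₂ - x₃‖ ^ (2*s))⁻¹ + (‖x₃ - x₁‖ ^ (2*s))⁻¹ := by
  obtain ⟨hP, hP0⟩ := Pcirc_nonneg h₁₂ h₂₃ h₃₁
  have hroot : ∀ r : ℝ, 0 < r → ∃ X : ℝ, 0 < X ∧ r^2 = X^3 ∧
      (r ^ (2*s))⁻¹ = ((X ^ s)⁻¹)^3 := by
    intro r hr
    refine ⟨r ^ ((2:ℝ)/3), by positivity, ?_, ?_⟩
    · rw [← Real.rpow_natCast, ← Real.rpow_natCast, ← Real.rpow_mul hr.le]; norm_num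
    · rw [inv_pow, ← Real.rpow_natCast, ← Real.rpow_mul hr.le, ← Real.rpow_mul hr.le]
      congr 2; push_cast; ring
  obtain ⟨X, hX, hX2, hXs⟩ := hroot _ (norm_pos_iff.2 (sub_ne_zero.2 h₁₂))
  obtain ⟨Y, hY, hY2, hYs⟩ := hroot _ (norm_pos_iff.2 (sub_ne_zero.2 h₂₃))
  obtain ⟨Z, hZ, hZ2, hZs⟩ := hroot _ (norm_pos_iff.2 (sub_ne_zero.2 h₃₁))
  rw [hX2, hY2, hZ2] at hP
  rw [hXs, hYs, hZs]
  have hbound : 2 * Pcirc x₁ x₂ x₃ ≤ 3 / (X * Y * Z) := by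
    rw [hP, div_le_div_iff₀ (by positivity) (by positivity)]
    have h1 := schur_inequality (sq_nonneg X) (sq_nonneg Y) (sq_nonneg Z)
    have h2 : 0 ≤ (X*Y)^2 * (X-Y)^2 + (Y*Z)^2 * (Y-Z)^2 + (Z*X)^2 * (Z-X)^2 := by positivity
    have h3 : 4 * X^3 * Z^3 - (X^3 + Z^3 - Y^3)^2 ≤ 3 * (X*Y*Z)^2 := by nlinarith
    calc _ ≤ 3 * (X*Y*Z)^2 * (X*Y*Z) := by gcongr
      _ = _ := by ring
  have hpow : (2 * Pcirc x₁ x₂ x₃) ^ s ≤ 3 ^ s * ((X ^ s)⁻¹ * (Y ^ s)⁻¹ * (Z ^ s)⁻¹) := by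
    refine (Real.rpow_le_rpow (by linarith) hbound hs.le).trans_eq ?_
    rw [Real.div_rpow (by norm_num) (by positivity), Real.mul_rpow (by positivity) hZ.le,
      Real.mul_rpow hX.le hY.le]
    field_simp
  have h3 : (3:ℝ) ^ (1 - s) * 3 ^ s = 3 := by
    rw [← Real.rpow_add (by norm_num)]; simp
  have amgm : ∀ p q r : ℝ, 0 < p → 0 < q → 0 < r → 3 * (p * q * r) ≤ p^3 + q^3 + r^3 := by
    intro p q r hp hq hr
    nlinarith [mul_nonneg (by positivity : 0 ≤ p + q + r)
      (by positivity : 0 ≤ (p - q)^2 + (q - r)^2 + (r - p)^2)]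
  calc _ ≤ (3:ℝ) ^ (1 - s) * (3 ^ s * ((X ^ s)⁻¹ * (Y ^ s)⁻¹ * (Z ^ s)⁻¹)) := by gcongr
    _ = 3 * ((X ^ s)⁻¹ * (Y ^ s)⁻¹ * (Z ^ s)⁻¹) := by rw [← mul_assoc, h3]
    _ ≤ _ := amgm _ _ _ (by positivity) (by positivity) (by positivity)

lemma fractional_hardy_translate {d : ℕ} (hd : 0 < d) {s : ℝ} (hs : s ∈ Set.Ioo (0:ℝ) 1)
    (hds : (4:ℝ) - 2*s ≤ (d:ℝ)) {f : Euc d → ℝ} (hf : Measurable f)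
    (hf2 : ∫⁻ x, ENNReal.ofReal (f x ^ 2) ≠ ∞) (b : Euc d) :
    ENNReal.ofReal (C_fH d s) * ∫⁻ x, ENNReal.ofReal ((‖x - b‖ ^ (2*s))⁻¹ * f x ^ 2) ≤
      ∫⁻ x, ∫⁻ z, ENNReal.ofReal (a_sd d s * ((f x - f z)^2 / ‖x - z‖ ^ ((d:ℝ) + 2*s))) := by
  have h := fractional_hardy hd hs hds (f := fun x => f (x + b)) (by fun_prop)
    (by rwa [lintegral_add_right_eq_self (fun x => ENNReal.ofReal (f x ^ 2)) b])
  rw [← lintegral_add_right_eq_self (fun x =>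
      ENNReal.ofReal ((‖x - b‖ ^ (2*s))⁻¹ * f x ^ 2)) b,
    ← lintegral_add_right_eq_self (fun x => ∫⁻ z,
      ENNReal.ofReal (a_sd d s * ((f x - f z)^2 / ‖x - z‖ ^ ((d:ℝ) + 2*s)))) b]
  refine le_of_eq_of_le ?_ (h.trans_eq (lintegral_congr fun x => ?_))
  · simp_rw [add_sub_cancel_right]
  · rw [← lintegral_add_right_eq_self (fun z =>
      ENNReal.ofReal (a_sd d s * ((f (x + b) - f z)^2 / ‖x + b - z‖ ^ ((d:ℝ) + 2*s)))) b]
    simp_rw [add_sub_add_right_eq_sub]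

/-- The `i`-th kinetic energy of an `N`-particle wave function, as an extended real number. -/
def lkinetic (d N : ℕ) (s : ℝ) (u : (Fin N → Euc d) → ℝ) (i : Fin N) : ℝ≥0∞ :=
  ∫⁻ x : Fin N → Euc d, ∫⁻ z : Euc d, ENNReal.ofReal
    (a_sd d s * ((u x - u (Function.update x i z))^2 / ‖x i - z‖ ^ ((d:ℝ) + 2*s)))

lemma measurable_kinetic_integrand {d N : ℕ} (s : ℝ) {u : (Fin N → Euc d) → ℝ}
    (hu : Measurable u) (i : Fin N) : Measurable fun p : (Fin N → Euc d) × Euc d =>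
      a_sd d s * ((u p.1 - u (Function.update p.1 i p.2))^2 /
        ‖p.1 i - p.2‖ ^ ((d:ℝ) + 2*s)) := by
  have h : Measurable fun p : (Fin N → Euc d) × Euc d => Function.update p.1 i p.2 :=
    measurable_update'
  fun_prop

lemma measurable_lintegral_kinetic_integrand {d N : ℕ} (s : ℝ) {u : (Fin N → Euc d) → ℝ}
    (hu : Measurable u) (i : Fin N) : Measurable fun x : Fin N → Euc d => ∫⁻ z : Euc d,
      ENNReal.ofReal (a_sd d s * ((u x - u (Function.update x i z))^2 /
        ‖x i - z‖ ^ ((d:ℝ) + 2*s))) :=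
  (measurable_kinetic_integrand s hu i).ennreal_ofReal.lintegral_prod_right'

lemma lintegral_pi_le_of_update {d N : ℕ} {F G : (Fin N → Euc d) → ℝ≥0∞} (hF : Measurable F)
    (hG : Measurable G) (i : Fin N) (h : ∀ x, ∫⁻ y, F (Function.update x i y) ≤
      ∫⁻ y, G (Function.update x i y)) : ∫⁻ x, F x ≤ ∫⁻ x, G x := by
  refine lintegral_le_of_lmarginal_le {i} hF hG ?_
  rw [lmarginal_singleton, lmarginal_singleton]
  exact h

lemma hardy_le_lkinetic {d N : ℕ} (hd : 0 < d) {s : ℝ} (hs : s ∈ Set.Ioo (0:ℝ) 1)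
    (hds : (4:ℝ) - 2*s ≤ (d:ℝ)) {u : (Fin N → Euc d) → ℝ} (hu : Continuous u)
    (hu_supp : HasCompactSupport u) {i j : Fin N} (hij : i ≠ j) :
    ENNReal.ofReal (C_fH d s) * ∫⁻ x, ENNReal.ofReal ((‖x i - x j‖ ^ (2*s))⁻¹ * u x ^ 2) ≤
      lkinetic d N s u i := by
  have hum := hu.measurable
  have hm : Measurable fun x : Fin N → Euc d =>
      ENNReal.ofReal ((‖x i - x j‖ ^ (2*s))⁻¹ * u x ^ 2) := by fun_prop
  rw [← lintegral_const_mul _ hm]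
  refine lintegral_pi_le_of_update (hm.const_mul _)
    (measurable_lintegral_kinetic_integrand s hum i) i fun x => ?_
  have hfc : Continuous fun y => u (Function.update x i y) :=
    hu.comp (continuous_const.update i continuous_id)
  have hfs : HasCompactSupport fun y => u (Function.update x i y) :=
    hu_supp.comp_isClosedEmbedding (isClosedEmbedding_update x i)
  have hint : Integrable fun y => u (Function.update x i y) ^ 2 := by
    simp_rw [sq]
    exact (hfc.mul hfc).integrable_of_hasCompactSupport hfs.mul_left
  have key := fractional_hardy_translate hd hs hds hfc.measurable
    hint.lintegral_lt_top.ne (x j)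
  rw [← lintegral_const_mul' _ _ ENNReal.ofReal_ne_top] at key
  simpa only [Function.update_self, Function.update_of_ne hij.symm, Function.update_idem]
    using key

lemma lintegral_min_norm_sq_div_lt_top {d : ℕ} (hd : 0 < d) {s : ℝ} (hs : s ∈ Set.Ioo (0:ℝ) 1) :
    ∫⁻ w : Euc d, ENNReal.ofReal (min (‖w‖^2) 1 / ‖w‖ ^ ((d:ℝ) + 2*s)) < ∞ := by
  obtain ⟨hs0, hs1⟩ := hs
  have : Nontrivial (Euc d) := by
    have : Nonempty (Fin d) := ⟨⟨0, hd⟩⟩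
    infer_instance
  refine Integrable.lintegral_lt_top (f := fun w : Euc d =>
    min (‖w‖^2) 1 / ‖w‖ ^ ((d:ℝ) + 2*s)) ?_
  rw [integrable_fun_norm_addHaar volume (f := fun r : ℝ => min (r^2) 1 / r ^ ((d:ℝ) + 2*s)),
    finrank_euclideanSpace_fin, ← Set.Ioc_union_Ioi_eq_Ioi zero_le_one]
  have hmeas : Measurable fun r : ℝ => r ^ (d - 1) • (min (r^2) 1 / r ^ ((d:ℝ) + 2*s)) := by
    fun_prop
  have hpow : ∀ r : ℝ, 0 < r → r ^ (d - 1) = r ^ ((d:ℝ) - 1) := by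
    intro r hr
    rw [← Real.rpow_natCast, Nat.cast_sub hd, Nat.cast_one]
  refine IntegrableOn.union ?_ ?_
  · have h1 : IntegrableOn (fun r : ℝ => r ^ (1 - 2*s)) (Set.Ioc 0 1) :=
      (intervalIntegrable_iff_integrableOn_Ioc_of_le zero_le_one).1
        (intervalIntegral.intervalIntegrable_rpow' (by linarith))
    refine Integrable.mono' h1 hmeas.aestronglyMeasurable
      ((ae_restrict_iff' measurableSet_Ioc).2 (.of_forall fun r hr => ?_))
    have hr0 : 0 < r := hr.1
    rw [Real.norm_of_nonneg (by positivity), smul_eq_mul, hpow r hr0]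
    calc r ^ ((d:ℝ) - 1) * (min (r^2) 1 / r ^ ((d:ℝ) + 2*s))
        ≤ r ^ ((d:ℝ) - 1) * (r^2 / r ^ ((d:ℝ) + 2*s)) := by gcongr; exact min_le_left _ _
      _ = r ^ (1 - 2*s) := by
        rw [← Real.rpow_two, ← Real.rpow_sub hr0, ← Real.rpow_add hr0]; congr 1; ring
  · have h1 : IntegrableOn (fun r : ℝ => r ^ (-1 - 2*s)) (Set.Ioi 1) :=
      integrableOn_Ioi_rpow_of_lt (by linarith) one_pos
    refine Integrable.mono' h1 hmeas.aestronglyMeasurable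
      ((ae_restrict_iff' measurableSet_Ioi).2 (.of_forall fun r hr => ?_))
    have hr0 : 0 < r := one_pos.trans hr
    rw [Real.norm_of_nonneg (by positivity), smul_eq_mul, hpow r hr0]
    calc r ^ ((d:ℝ) - 1) * (min (r^2) 1 / r ^ ((d:ℝ) + 2*s))
        ≤ r ^ ((d:ℝ) - 1) * (1 / r ^ ((d:ℝ) + 2*s)) := by gcongr; exact min_le_right _ _
      _ = r ^ (-1 - 2*s) := by
        rw [one_div, ← Real.rpow_neg hr0.le, ← Real.rpow_add hr0]; congr 1; ring

lemma a_sd_nonneg (d : ℕ) {s : ℝ} (hs : s ∈ Set.Ioo (0:ℝ) 1) : 0 ≤ a_sd d s := by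
  obtain ⟨hs0, hs1⟩ := hs
  have h1 := Real.Gamma_pos_of_pos (show 0 < 1 - s by linarith)
  have h2 := Real.Gamma_pos_of_pos (show 0 < ((d:ℝ) + 2*s)/2 by positivity)
  unfold a_sd
  positivity

lemma lkinetic_lt_top {d N : ℕ} (hd : 0 < d) {s : ℝ} (hs : s ∈ Set.Ioo (0:ℝ) 1)
    {u : (Fin N → Euc d) → ℝ} (hu : ContDiff ℝ 1 u) (hu_supp : HasCompactSupport u)
    (i : Fin N) : lkinetic d N s u i < ∞ := by
  obtain ⟨L, hL⟩ := hu.lipschitzWith_of_hasCompactSupport hu_supp one_ne_zero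
  obtain ⟨M, hM⟩ := hu_supp.exists_bound_of_continuous hu.continuous
  have hup : ∀ (x : Fin N → Euc d) (z : Euc d),
      (u x - u (Function.update x i z))^2 ≤ (L^2 + 4*M^2) * min (‖x i - z‖^2) 1 := by
    intro x z
    have h1 : |u x - u (Function.update x i z)| ≤ L * ‖x i - z‖ := by
      have h := hL.dist_le_mul x (Function.update x i z)
      rw [Real.dist_eq] at h
      refine h.trans ?_
      gcongr
      rw [dist_pi_le_iff (norm_nonneg _)]
      intro k
      by_cases hk : k = i
      · subst hk; rw [Function.update_self, dist_eq_norm]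
      · rw [Function.update_of_ne hk, dist_self]; positivity
    have h2 : |u x - u (Function.update x i z)| ≤ 2 * M := by
      have ha := hM x
      have hb := hM (Function.update x i z)
      rw [Real.norm_eq_abs] at ha hb
      linarith [abs_sub (u x) (u (Function.update x i z))]
    rw [← sq_abs]
    have h1' := pow_le_pow_left₀ (abs_nonneg _) h1 2
    have h2' := pow_le_pow_left₀ (abs_nonneg _) h2 2
    rcases min_cases (‖x i - z‖^2) 1 with ⟨h, -⟩ | ⟨h, -⟩ <;> rw [h]
    · nlinarith [mul_nonneg (sq_nonneg M) (sq_nonneg ‖x i - z‖)]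
    · nlinarith [sq_nonneg (L:ℝ)]
  set S := tsupport u
  have hS : MeasurableSet S := (isClosed_tsupport u).measurableSet
  set h : Euc d → ℝ≥0∞ := fun w => ENNReal.ofReal (min (‖w‖^2) 1 / ‖w‖ ^ ((d:ℝ) + 2*s)) with hh
  have hhm : Measurable h := by fun_prop
  have hheven : ∀ y z, h (y - z) = h (z - y) := fun y z => by simp only [hh, norm_sub_rev]
  set χ : (Fin N → Euc d) → ℝ≥0∞ := S.indicator 1
  have hχ : Measurable χ := measurable_one.indicator hS
  set K : ℝ≥0∞ := ENNReal.ofReal (a_sd d s * (L^2 + 4*M^2)) with hK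
  have hint : ∀ y : Euc d, ∫⁻ z, h (y - z) = ∫⁻ w, h w := fun y =>
    lintegral_sub_left_eq_self h y
  have hA : ∫⁻ x, ∫⁻ z, χ x * h (x i - z) < ∞ := by
    have : ∀ x : Fin N → Euc d, ∫⁻ z, χ x * h (x i - z) = χ x * ∫⁻ w, h w := fun x => by
      rw [lintegral_const_mul _ (by fun_prop), hint]
    simp_rw [this]
    rw [lintegral_mul_const _ hχ, lintegral_indicator_one hS]
    exact ENNReal.mul_lt_top hu_supp.measure_lt_top (lintegral_min_norm_sq_div_lt_top hd hs)
  have hB : ∫⁻ x, ∫⁻ z, χ (Function.update x i z) * h (x i - z) < ∞ := by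
    refine lt_of_le_of_lt ?_ hA
    have hm1 : Measurable fun p : (Fin N → Euc d) × Euc d =>
        χ (Function.update p.1 i p.2) * h (p.1 i - p.2) := by fun_prop
    have hm2 : Measurable fun p : (Fin N → Euc d) × Euc d => χ p.1 * h (p.1 i - p.2) := by
      fun_prop
    refine lintegral_pi_le_of_update hm1.lintegral_prod_right' hm2.lintegral_prod_right' i
      fun x => ?_
    simp only [Function.update_self, Function.update_idem]
    rw [lintegral_lintegral_swap]
    · simp_rw [hheven]
      exact le_rfl
    · have : Measurable fun z : Euc d => Function.update x i z := measurable_update x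
      unfold Function.uncurry
      fun_prop
  calc lkinetic d N s u i ≤ ∫⁻ x, ∫⁻ z,
        K * (χ x * h (x i - z) + χ (Function.update x i z) * h (x i - z)) := by
        refine lintegral_mono fun x => lintegral_mono fun z => ?_
        by_cases hx : x ∈ S ∨ Function.update x i z ∈ S
        · have h1 : 1 ≤ χ x + χ (Function.update x i z) := by
            rcases hx with hx | hx <;> simp [χ, hx]
          rw [← add_mul]
          calc _ ≤ K * (1 * h (x i - z)) := by
                rw [one_mul, hK, hh,
                  ← ENNReal.ofReal_mul (mul_nonneg (a_sd_nonneg d hs) (by positivity)), mul_assoc]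
                refine ENNReal.ofReal_le_ofReal
                  (mul_le_mul_of_nonneg_left ?_ (a_sd_nonneg d hs))
                rw [← mul_div_assoc]
                gcongr
                exact hup x z
            _ ≤ _ := by gcongr
        · push Not at hx
          rw [image_eq_zero_of_notMem_tsupport hx.1, image_eq_zero_of_notMem_tsupport hx.2]
          simp
    _ = K * ((∫⁻ x, ∫⁻ z, χ x * h (x i - z)) +
        ∫⁻ x, ∫⁻ z, χ (Function.update x i z) * h (x i - z)) := by
        have hm2 : Measurable fun p : (Fin N → Euc d) × Euc d => χ p.1 * h (p.1 i - p.2) := by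
          fun_prop
        rw [← lintegral_add_left hm2.lintegral_prod_right',
          ← lintegral_const_mul' _ _ ENNReal.ofReal_ne_top]
        refine lintegral_congr fun x => ?_
        rw [lintegral_const_mul' _ _ ENNReal.ofReal_ne_top,
          lintegral_add_left (show Measurable fun z => χ x * h (x i - z) by fun_prop)]
    _ < ∞ := ENNReal.mul_lt_top ENNReal.ofReal_lt_top (ENNReal.add_lt_top.2 ⟨hA, hB⟩)

lemma kinetic_eq_sum_toReal {d N : ℕ} (hd : 0 < d) {s : ℝ} (hs : s ∈ Set.Ioo (0:ℝ) 1)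
    {u : (Fin N → Euc d) → ℝ} (hu : ContDiff ℝ 1 u) (hu_supp : HasCompactSupport u) :
    kinetic d N s u = ∑ i, (lkinetic d N s u i).toReal := by
  refine Finset.sum_congr rfl fun i _ => ?_
  have hum := hu.continuous.measurable
  have hm := measurable_lintegral_kinetic_integrand s hum i
  simp_rw [← integral_const_mul]
  rw [lkinetic, ← integral_toReal hm.aemeasurable
    (ae_lt_top hm (lkinetic_lt_top hd hs hu hu_supp i).ne)]
  refine integral_congr_ae (.of_forall fun x => ?_)
  refine integral_eq_lintegral_of_nonneg_ae (.of_forall fun z => ?_)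
    ((measurable_kinetic_integrand s hum i).comp measurable_prodMk_left).aestronglyMeasurable
  exact mul_nonneg (a_sd_nonneg d hs) (by positivity)

/-- **Corollary 3.1**: geometric three-particle fractional Hardy inequality with the
circumradius weight `(2P)^s = 1/R_{123}^{2s}`. -/
theorem geometric_three_particle_Hardy
    (d : ℕ) (hd : 0 < d) (s : ℝ) (hs : s ∈ Set.Ioo (0:ℝ) 1)
    (hds : (4:ℝ) - 2*s ≤ (d:ℝ))
    (u : (Fin 3 → Euc d) → ℝ)
    (hu_smooth : ContDiff ℝ (⊤ : ℕ∞) u) (hu_supp : HasCompactSupport u)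
    (hu_off : tsupport u ⊆ {x : Fin 3 → Euc d | ∀ i j, i ≠ j → x i ≠ x j}) :
    (3:ℝ)^(1-s) * C_fH d s *
      ∫ x : Fin 3 → Euc d, (2 * Pcirc (x 0) (x 1) (x 2))^s * (u x)^2
      ≤ kinetic d 3 s u := by
  have hu : ContDiff ℝ 1 u := hu_smooth.of_le (by exact_mod_cast le_top)
  have hum := hu.continuous.measurable
  have hC : 0 ≤ C_fH d s := by unfold C_fH; positivity
  have hfin := lkinetic_lt_top hd hs hu hu_supp
  have hdist : ∀ x, u x ≠ 0 → x 0 ≠ x 1 ∧ x 1 ≠ x 2 ∧ x 2 ≠ x 0 := fun x hx =>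
    have h := hu_off (subset_tsupport u hx)
    ⟨h 0 1 (by decide), h 1 2 (by decide), h 2 0 (by decide)⟩
  have hpt : ∀ x, 0 ≤ (2 * Pcirc (x 0) (x 1) (x 2))^s * (u x)^2 ∧
      (3:ℝ)^(1-s) * ((2 * Pcirc (x 0) (x 1) (x 2))^s * (u x)^2) ≤
        (‖x 0 - x 1‖ ^ (2*s))⁻¹ * u x ^ 2 + (‖x 1 - x 2‖ ^ (2*s))⁻¹ * u x ^ 2 +
          (‖x 2 - x 0‖ ^ (2*s))⁻¹ * u x ^ 2 := by
    intro x
    by_cases hx : u x = 0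
    · simp [hx]
    · obtain ⟨h01, h12, h20⟩ := hdist x hx
      have hP := (Pcirc_nonneg h01 h12 h20).2
      refine ⟨by positivity, ?_⟩
      rw [← mul_assoc, ← add_mul, ← add_mul]
      gcongr
      exact three_rpow_mul_Pcirc_rpow_le hs.1 h01 h12 h20
  have hmeas : Measurable fun x : Fin 3 → Euc d =>
      (2 * Pcirc (x 0) (x 1) (x 2))^s * (u x)^2 := by
    unfold Pcirc; fun_prop
  have key : ENNReal.ofReal ((3:ℝ)^(1-s) * C_fH d s) *
      ∫⁻ x : Fin 3 → Euc d, ENNReal.ofReal ((2 * Pcirc (x 0) (x 1) (x 2))^s * (u x)^2) ≤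
        ∑ i, lkinetic d 3 s u i := by
    calc _ = ENNReal.ofReal (C_fH d s) * ∫⁻ x : Fin 3 → Euc d, ENNReal.ofReal
          ((3:ℝ)^(1-s) * ((2 * Pcirc (x 0) (x 1) (x 2))^s * (u x)^2)) := by
          rw [mul_comm ((3:ℝ)^(1-s)), ENNReal.ofReal_mul hC, mul_assoc]
          simp_rw [ENNReal.ofReal_mul (show 0 ≤ (3:ℝ)^(1-s) by positivity)]
          rw [lintegral_const_mul' _ _ ENNReal.ofReal_ne_top]
      _ ≤ ENNReal.ofReal (C_fH d s) * ∫⁻ x : Fin 3 → Euc d,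
          (ENNReal.ofReal ((‖x 0 - x 1‖ ^ (2*s))⁻¹ * u x ^ 2) +
            ENNReal.ofReal ((‖x 1 - x 2‖ ^ (2*s))⁻¹ * u x ^ 2) +
            ENNReal.ofReal ((‖x 2 - x 0‖ ^ (2*s))⁻¹ * u x ^ 2)) := by
          gcongr with x
          rw [← ENNReal.ofReal_add (by positivity) (by positivity),
            ← ENNReal.ofReal_add (by positivity) (by positivity)]
          exact ENNReal.ofReal_le_ofReal (hpt x).2
      _ = ENNReal.ofReal (C_fH d s) *
            (∫⁻ x : Fin 3 → Euc d, ENNReal.ofReal ((‖x 0 - x 1‖ ^ (2*s))⁻¹ * u x ^ 2)) +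
          ENNReal.ofReal (C_fH d s) *
            (∫⁻ x : Fin 3 → Euc d, ENNReal.ofReal ((‖x 1 - x 2‖ ^ (2*s))⁻¹ * u x ^ 2)) +
          ENNReal.ofReal (C_fH d s) *
            ∫⁻ x : Fin 3 → Euc d, ENNReal.ofReal ((‖x 2 - x 0‖ ^ (2*s))⁻¹ * u x ^ 2) := by
          rw [lintegral_add_left (by fun_prop), lintegral_add_left (by fun_prop), mul_add, mul_add]
      _ ≤ _ := by
          rw [Fin.sum_univ_three]
          exact add_le_add (add_le_add
            (hardy_le_lkinetic hd hs hds hu.continuous hu_supp (by decide))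
            (hardy_le_lkinetic hd hs hds hu.continuous hu_supp (by decide)))
            (hardy_le_lkinetic hd hs hds hu.continuous hu_supp (by decide))
  rw [kinetic_eq_sum_toReal hd hs hu hu_supp, ← ENNReal.toReal_sum fun i _ => (hfin i).ne,
    integral_eq_lintegral_of_nonneg_ae (.of_forall fun x => (hpt x).1)
      hmeas.aestronglyMeasurable,
    ← ENNReal.toReal_ofReal (show 0 ≤ (3:ℝ)^(1-s) * C_fH d s by positivity),
    ← ENNReal.toReal_mul]
  exact ENNReal.toReal_mono (ENNReal.sum_lt_top.2 fun i _ => hfin i).ne key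
end
end
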